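/- In the standing setup, suppose the conformal external ray R^0_θ of X^0 = X lands on 0. Then there exists a continuous map H : (Bd(X) ∪ R^0_θ) × [0,1] → ℂ with H^0 = id, H(z,t) = h(z,t) for all z ∈ Bd(X) and t ∈ [0,1], each H^t := H(·,t) injective, and such that for each t ∈ [0,1] the set H^t(R^0_θ) is a conformal external ray of X^t which lands on 0. -/

import Mathlib

open Set Metric Topology Filter

/-- The union of the unbounded connected components of the complement of `K`;
for compact `K` this is the (unique) unbounded component of `ℂ \ K`. -/
def unbddComp (K : Set ℂ) : Set ℂ :=
  {z : ℂ | z ∈ Kᶜ ∧ ¬ Bornology.IsBounded (connectedComponentIn Kᶜ z)}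

/-- `X^t = ℂ \ U^t`, where `U^t` is the unbounded component of `ℂ \ h^t(Bd X)`. -/
def XtSet (h : ℂ → ℝ → ℂ) (X : Set ℂ) (t : ℝ) : Set ℂ :=
  (unbddComp ((fun z => h z t) '' frontier X))ᶜ

/-- The normalized Riemann map `φ : 𝔻 → U ∪ {∞}`, `φ(0) = ∞`, encoded by its finite
part `f` on the punctured disk: `f` is an injective holomorphic map of `𝔻 \ {0}` onto
`U`, with a simple pole at `0` with positive "derivative": `z·f(z) → c > 0` as `z → 0`. -/
def IsNormalizedRiemannMap (U : Set ℂ) (f : ℂ → ℂ) : Prop :=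
  DifferentiableOn ℂ f (Metric.ball 0 1 \ {0}) ∧
  Set.InjOn f (Metric.ball 0 1 \ {0}) ∧
  f '' (Metric.ball 0 1 \ {0}) = U ∧
  ∃ c : ℝ, 0 < c ∧ Filter.Tendsto (fun z : ℂ => z * f z) (𝓝[≠] 0) (𝓝 (c : ℂ))



/-- homotopy lifting through `exp`. -/
theorem hl_lift {Z : Type*} [TopologicalSpace Z] (S : Set Z) (f : Z → ℝ → ℂ)
    (hf : ContinuousOn (fun p : Z × ℝ => f p.1 p.2) (S ×ˢ Icc 0 1))
    (hne : ∀ z ∈ S, ∀ t ∈ Icc (0:ℝ) 1, f z t ≠ 0) (g0 : Z → ℂ) (hg0 : ContinuousOn g0 S)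
    (he : ∀ z ∈ S, Complex.exp (g0 z) = f z 0) :
    ∃ g : Z → ℝ → ℂ, ContinuousOn (fun p : Z × ℝ => g p.1 p.2) (S ×ˢ Icc 0 1) ∧
      (∀ z ∈ S, ∀ t ∈ Icc (0:ℝ) 1, Complex.exp (g z t) = f z t) ∧ ∀ z ∈ S, g z 0 = g0 z := by
  classical
  let H : C(unitInterval × S, {z : ℂ // z ≠ 0}) :=
    ⟨fun p => ⟨f p.2 p.1, hne _ p.2.2 _ p.1.2⟩, by
      refine Continuous.subtype_mk ?_ _
      exact hf.comp_continuous (f := fun p : unitInterval × S => ((p.2 : Z), (p.1 : ℝ)))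
        (by fun_prop) (fun p => ⟨p.2.2, p.1.2⟩)⟩
  let F : C(S, ℂ) := ⟨fun a => g0 a, continuousOn_iff_continuous_domRestrict.1 hg0⟩
  have H0 : ∀ a, H (0, a) = (fun z : ℂ ↦ (⟨_, z.exp_ne_zero⟩ : {z : ℂ // z ≠ 0})) (F a) := by
    intro a
    apply Subtype.ext
    exact (he a a.2).symm
  let L := Complex.isCoveringMap_exp.liftHomotopy H F H0
  have hL : ∀ t a, Complex.exp (L (t, a)) = f a t := by
    intro t a
    have := congrFun (Complex.isCoveringMap_exp.liftHomotopy_lifts H F H0) (t, a)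
    exact congrArg Subtype.val this
  have hL0 : ∀ a, L (0, a) = g0 a := fun a =>
    Complex.isCoveringMap_exp.liftHomotopy_zero H F H0 a
  refine ⟨fun z t => if hz : z ∈ S ∧ t ∈ Icc (0:ℝ) 1 then L (⟨t, hz.2⟩, ⟨z, hz.1⟩) else 0,
    ?_, ?_, ?_⟩
  · rw [continuousOn_iff_continuous_domRestrict]
    have : Continuous fun q : (S ×ˢ Icc (0:ℝ) 1 : Set (Z × ℝ)) =>
        L (⟨q.1.2, q.2.2⟩, ⟨q.1.1, q.2.1⟩) := by
      refine L.continuous.comp ?_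
      fun_prop
    convert this using 2 with q
    have hq := q.2
    simp only [Set.domRestrict_apply]
    rw [dif_pos ⟨hq.1, hq.2⟩]
  · intro z hz t ht
    simp only [dif_pos (show z ∈ S ∧ t ∈ Icc (0:ℝ) 1 from ⟨hz, ht⟩)]
    exact hL _ _
  · intro z hz
    simp only [dif_pos (show z ∈ S ∧ (0:ℝ) ∈ Icc (0:ℝ) 1 from ⟨hz, by simp⟩)]
    exact hL0 ⟨z, hz⟩

theorem exp_inj_close {u v : ℂ} (h : Complex.exp u = Complex.exp v)
    (hc : |u.im - v.im| < 2 * Real.pi) : u = v := by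
  obtain ⟨n, hn⟩ := Complex.exp_eq_exp_iff_exists_int.1 h
  have him : u.im - v.im = n * (2 * Real.pi) := by
    rw [hn]; simp
  rw [him, abs_mul, abs_of_pos Real.two_pi_pos] at hc
  have : |(n:ℝ)| < 1 := by
    by_contra hcon
    push Not at hcon
    nlinarith [Real.pi_pos]
  have hn0 : n = 0 := by
    have : |n| < 1 := by exact_mod_cast this
    exact Int.abs_lt_one_iff.1 this
  rw [hn, hn0]; simp

theorem log_unique {Z : Type*} [TopologicalSpace Z] {S : Set Z} (hS : IsPreconnected S)
    {g1 g2 : Z → ℂ} (h1 : ContinuousOn g1 S) (h2 : ContinuousOn g2 S)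
    (he : ∀ z ∈ S, Complex.exp (g1 z) = Complex.exp (g2 z)) {z0 : Z} (hz0 : z0 ∈ S)
    (h0 : g1 z0 = g2 z0) : ∀ z ∈ S, g1 z = g2 z := by
  refine Complex.isCoveringMap_exp.eqOn_of_comp_eqOn hS h1 h2 ?_ hz0 h0
  intro z hz
  exact Subtype.ext (he z hz)

/-- two logarithms of the same function differ by a locally constant function -/
theorem log_diff_loc {Z : Type*} [TopologicalSpace Z] {S : Set Z}
    {g1 g2 : Z → ℂ} (h1 : ContinuousOn g1 S) (h2 : ContinuousOn g2 S)
    (he : ∀ z ∈ S, Complex.exp (g1 z) = Complex.exp (g2 z)) {z0 : Z} (hz0 : z0 ∈ S) :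
    ∀ᶠ z in 𝓝[S] z0, g1 z - g2 z = g1 z0 - g2 z0 := by
  have hc : ContinuousWithinAt (fun z => (g1 z - g2 z).im) S z0 :=
    Complex.continuous_im.continuousAt.comp_continuousWithinAt ((h1 z0 hz0).sub (h2 z0 hz0))
  have := hc (Metric.ball_mem_nhds _ Real.two_pi_pos)
  filter_upwards [this, self_mem_nhdsWithin] with z hz hzS
  apply exp_inj_close
  · rw [Complex.exp_sub, Complex.exp_sub, he z hzS, he z0 hz0, div_self (Complex.exp_ne_zero _),
      div_self (Complex.exp_ne_zero _)]
  · rw [mem_preimage, Metric.mem_ball, Real.dist_eq] at hz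
    exact hz

theorem log_diff_const {Z : Type*} [TopologicalSpace Z] {S : Set Z} (hS : IsPreconnected S)
    {g1 g2 : Z → ℂ} (h1 : ContinuousOn g1 S) (h2 : ContinuousOn g2 S)
    (he : ∀ z ∈ S, Complex.exp (g1 z) = Complex.exp (g2 z)) {z0 : Z} (hz0 : z0 ∈ S) :
    ∀ z ∈ S, g1 z - g2 z = g1 z0 - g2 z0 := by
  have := log_unique hS (g1 := fun z => g1 z - g2 z) (g2 := fun _ => g1 z0 - g2 z0)
    (h1.sub h2) continuousOn_const (fun z hz => by
      rw [Complex.exp_sub, Complex.exp_sub, he z hz, he z0 hz0, div_self (Complex.exp_ne_zero _),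
      div_self (Complex.exp_ne_zero _)]) hz0 rfl
  exact this

theorem no_log_circle (g : ℂ → ℂ) (hg : ContinuousOn g (sphere 0 1))
    (he : ∀ z ∈ sphere (0:ℂ) 1, Complex.exp (g z) = z) : False := by
  have hm : ∀ s : ℝ, Complex.exp (s * Complex.I) ∈ sphere (0:ℂ) 1 := by
    intro s; simp [Complex.norm_exp_ofReal_mul_I]
  have hc : Continuous fun s : ℝ => g (Complex.exp (s * Complex.I)) :=
    hg.comp_continuous (by fun_prop) hm
  have := log_diff_const (S := (univ : Set ℝ)) isPreconnected_univ
    (g1 := fun s : ℝ => g (Complex.exp (s * Complex.I))) (g2 := fun s : ℝ => (s * Complex.I : ℂ))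
    hc.continuousOn (by fun_prop) (fun s _ => he _ (hm s)) (z0 := 0) (mem_univ _)
    (2 * Real.pi) (mem_univ _)
  simp at this

theorem unbddComp_subset (K : Set ℂ) : unbddComp K ⊆ Kᶜ := fun _ h => h.1

theorem mem_unbddComp_of_comp {K : Set ℂ} {p q : ℂ} (hp : p ∈ unbddComp K)
    (hq : q ∈ connectedComponentIn Kᶜ p) : q ∈ unbddComp K := by
  refine ⟨connectedComponentIn_subset _ _ hq, ?_⟩
  rw [← connectedComponentIn_eq hq]
  exact hp.2

theorem isOpen_unbddComp {K : Set ℂ} (hK : IsCompact K) : IsOpen (unbddComp K) := by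
  rw [isOpen_iff_mem_nhds]
  intro p hp
  have : IsOpen (connectedComponentIn Kᶜ p) := hK.isClosed.isOpen_compl.connectedComponentIn
  exact mem_of_superset (this.mem_nhds (mem_connectedComponentIn hp.1))
    (fun q hq => mem_unbddComp_of_comp hp hq)

theorem closure_unbddComp {K : Set ℂ} (hK : IsCompact K) :
    closure (unbddComp K) ⊆ unbddComp K ∪ K := by
  intro p hp
  by_cases hpK : p ∈ K
  · exact Or.inr hpK
  left
  have ho : IsOpen (connectedComponentIn Kᶜ p) := hK.isClosed.isOpen_compl.connectedComponentIn
  obtain ⟨q, hq1, hq2⟩ := mem_closure_iff.1 hp _ ho (mem_connectedComponentIn hpK)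
  refine mem_unbddComp_of_comp hq2 ?_
  rw [← connectedComponentIn_eq hq1]
  exact mem_connectedComponentIn hpK

theorem borsuk_a {K : Set ℂ} (hK : IsCompact K) {p : ℂ} (hp : p ∈ unbddComp K) :
    ∃ g : ℂ → ℂ, ContinuousOn g K ∧ ∀ z ∈ K, Complex.exp (g z) = z - p := by
  obtain ⟨R, hR⟩ := hK.isBounded.subset_closedBall 0
  have ho : IsOpen (connectedComponentIn Kᶜ p) := hK.isClosed.isOpen_compl.connectedComponentIn
  obtain ⟨q, hq, hqR⟩ : ∃ q ∈ connectedComponentIn Kᶜ p, R < ‖q‖ := by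
    by_contra hcon
    push Not at hcon
    exact hp.2 (isBounded_closedBall.subset (fun q hq => by
      simpa using hcon q hq : _ ⊆ closedBall (0:ℂ) R))
  have hpc : IsPathConnected (connectedComponentIn Kᶜ p) := by
    rw [← ho.isConnected_iff_isPathConnected]
    exact isConnected_connectedComponentIn_iff.2 hp.1
  obtain ⟨γ, hγ⟩ := hpc.joinedIn q hq p (mem_connectedComponentIn hp.1)
  have hlt : ∀ z ∈ K, ‖z / q‖ < 1 := by
    intro z hz
    have h1 : ‖z‖ ≤ R := by simpa using hR hz
    rw [norm_div, div_lt_one (by linarith [norm_nonneg z])]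
    linarith
  have hq0 : ∀ z ∈ K, q ≠ 0 := by
    rintro z hz rfl
    have h1 : ‖z‖ ≤ R := by simpa using hR hz
    simp at hqR
    linarith [norm_nonneg z]
  have hslit : ∀ z ∈ K, 1 - z / q ∈ Complex.slitPlane := by
    intro z hz
    left
    have := (Complex.abs_re_le_norm (z/q)).trans_lt (hlt z hz)
    simp only [Complex.sub_re, Complex.one_re]
    linarith [(abs_lt.1 this).2]
  obtain ⟨g, hg, hge, -⟩ := hl_lift K (fun z s => z - γ.extend s)
    (by
      apply Continuous.continuousOn
      exact continuous_fst.sub (γ.continuous_extend.comp continuous_snd))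
    (fun z hz t ht h0 => by
      have : z ∈ Kᶜ := by
        rw [sub_eq_zero.1 h0, γ.extend_apply ht]
        exact connectedComponentIn_subset _ _ (hγ _)
      exact this hz)
    (fun z => Complex.log (-q) + Complex.log (1 - z / q))
    (continuousOn_const.add ((by fun_prop : ContinuousOn (fun z : ℂ => 1 - z / q) K).clog hslit))
    (fun z hz => by
      rw [Complex.exp_add, Complex.exp_log (neg_ne_zero.2 (hq0 z hz)),
        Complex.exp_log (Complex.slitPlane_ne_zero (hslit z hz))]
      have := hq0 z hz
      simp only [γ.extend_zero]
      field_simp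
      ring)
  refine ⟨fun z => g z 1, ?_, fun z hz => ?_⟩
  · exact hg.comp (f := fun z : ℂ => (z, (1:ℝ))) (by fun_prop) (fun z hz => ⟨hz, by simp⟩)
  · rw [hge z hz 1 (by simp)]; simp

theorem borsuk_b {K : Set ℂ} (hK : IsCompact K) {p : ℂ} (hp : p ∉ K) (g : ℂ → ℂ)
    (hg : ContinuousOn g K) (he : ∀ z ∈ K, Complex.exp (g z) = z - p) : p ∈ unbddComp K := by
  classical
  refine ⟨hp, fun hb => ?_⟩
  set W := connectedComponentIn Kᶜ p with hW
  have ho : IsOpen W := hK.isClosed.isOpen_compl.connectedComponentIn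
  have hpW : p ∈ W := mem_connectedComponentIn hp
  have hfr : frontier W ⊆ K := by
    intro z hz
    by_contra hzK
    rw [ho.frontier_eq] at hz
    obtain ⟨q, hq1, hq2⟩ := mem_closure_iff.1 hz.1 _
      (hK.isClosed.isOpen_compl.connectedComponentIn : IsOpen (connectedComponentIn Kᶜ z))
      (mem_connectedComponentIn hzK)
    apply hz.2
    rw [hW, connectedComponentIn_eq hq2, ← connectedComponentIn_eq hq1]
    exact mem_connectedComponentIn hzK
  obtain ⟨G, hG⟩ := ContinuousMap.exists_restrict_eq (Y := ℂ) hK.isClosed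
    ⟨K.domRestrict g, continuousOn_iff_continuous_domRestrict.1 hg⟩
  have hGg : ∀ z ∈ K, G z = g z := fun z hz => congrArg (fun F => F ⟨z, hz⟩) hG
  let F : ℂ → ℂ := fun z => if z ∈ W then Complex.exp (G z) else z - p
  have hF : Continuous F := by
    apply Continuous.if
    · intro a ha
      have : a ∈ K := hfr ha
      rw [hGg a this, he a this]
    · exact Complex.continuous_exp.comp G.continuous
    · fun_prop
  have hFne : ∀ z, F z ≠ 0 := by
    intro z
    by_cases hz : z ∈ W
    · simp [F, hz]
    · simp only [F, hz, if_false]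
      intro h
      rw [sub_eq_zero] at h
      exact hz (h ▸ hpW)
  obtain ⟨R, hR⟩ := hb.subset_closedBall p
  have hR0 : 0 ≤ R := by simpa using hR hpW
  obtain ⟨k, hk, hke, -⟩ := hl_lift (sphere (0:ℂ) 1) (fun z s => F (p + s * (R + 1) * z))
    (by apply Continuous.continuousOn; fun_prop) (fun _ _ _ _ => hFne _) (fun _ => G p)
    continuousOn_const (fun z hz => by simp [F, hpW])
  apply no_log_circle (fun z => k z 1 - Real.log (R + 1))
  · refine ContinuousOn.sub ?_ continuousOn_const
    exact hk.comp (f := fun z : ℂ => (z, (1:ℝ))) (by fun_prop) (fun z hz => ⟨hz, by simp⟩)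
  · intro z hz
    have hz1 : ‖z‖ = 1 := by simpa using hz
    have hnW : p + (1:ℝ) * (R + 1) * z ∉ W := by
      intro hcon
      have := hR hcon
      rw [mem_closedBall, dist_eq_norm] at this
      have h2 : ‖p + (1:ℝ) * (R + 1) * z - p‖ = R + 1 := by
        have : p + (1:ℝ) * (R + 1) * z - p = ((R + 1 : ℝ) : ℂ) * z := by push_cast; ring
        rw [this, norm_mul, hz1, Complex.norm_real, Real.norm_of_nonneg (by linarith), mul_one]
      linarith
    rw [Complex.exp_sub, hke z hz 1 (by simp)]
    simp only [F, hnW, if_false]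
    rw [← Complex.ofReal_exp, Real.exp_log (by linarith)]
    have : ((R + 1 : ℝ) : ℂ) ≠ 0 := by
      have : R + 1 ≠ 0 := by linarith
      exact_mod_cast this
    field_simp
    push_cast; ring

/-- stability of the unbounded component under small perturbations -/
theorem bor {K : Set ℂ} (hK : IsCompact K) {f1 f2 : ℂ → ℂ} (h1 : ContinuousOn f1 K)
    (h2 : ContinuousOn f2 K) (hi : InjOn f2 K) {p : ℂ}
    (hd : ∀ z ∈ K, ‖f1 z - f2 z‖ < ‖f1 z - p‖) (hp : p ∈ unbddComp (f1 '' K)) :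
    p ∈ unbddComp (f2 '' K) := by
  obtain ⟨g, hg, hge⟩ := borsuk_a (hK.image_of_continuousOn h1) hp
  have hne : ∀ z ∈ K, f1 z - p ≠ 0 := fun z hz h => by
    have := hd z hz
    rw [h, norm_zero] at this
    exact absurd this (not_lt.2 (norm_nonneg _))
  have hsl : ∀ z ∈ K, (f2 z - p) / (f1 z - p) ∈ Complex.slitPlane := by
    intro z hz
    left
    have h3 : (f2 z - p) / (f1 z - p) = 1 - (f1 z - f2 z) / (f1 z - p) := by
      have := hne z hz
      field_simp; ring
    have h4 : ‖(f1 z - f2 z) / (f1 z - p)‖ < 1 := by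
      rw [norm_div, div_lt_one (norm_pos_iff.2 (hne z hz))]
      exact hd z hz
    have := (Complex.abs_re_le_norm ((f1 z - f2 z) / (f1 z - p))).trans_lt h4
    rw [h3, Complex.sub_re, Complex.one_re]
    linarith [(abs_lt.1 this).2]
  let k : ℂ → ℂ := fun z => g (f1 z) + Complex.log ((f2 z - p) / (f1 z - p))
  have hk : ContinuousOn k K := by
    refine (hg.comp h1 (mapsTo_image _ _)).add ?_
    exact ((h2.sub continuousOn_const).div (h1.sub continuousOn_const) hne).clog hsl
  have hke : ∀ z ∈ K, Complex.exp (k z) = f2 z - p := by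
    intro z hz
    simp only [k]
    rw [Complex.exp_add, hge _ (mem_image_of_mem _ hz),
      Complex.exp_log (Complex.slitPlane_ne_zero (hsl z hz))]
    have := hne z hz
    field_simp
  have hpn : p ∉ f2 '' K := by
    rintro ⟨z, hz, rfl⟩
    have := hke z hz
    rw [sub_self] at this
    exact Complex.exp_ne_zero _ this
  classical
  have hinv : ContinuousOn (Function.invFunOn f2 K) (f2 '' K) := by
    rw [continuousOn_iff_isClosed]
    intro T hT
    refine ⟨f2 '' (T ∩ K), ((hK.inter_left hT).image_of_continuousOn
      (h2.mono inter_subset_right)).isClosed, ?_⟩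
    ext w
    constructor
    · rintro ⟨hw, z, hz, rfl⟩
      refine ⟨⟨z, ⟨?_, hz⟩, rfl⟩, mem_image_of_mem _ hz⟩
      have : Function.invFunOn f2 K (f2 z) = z := hi.leftInvOn_invFunOn hz
      rw [mem_preimage, this] at hw
      exact hw
    · rintro ⟨⟨z, ⟨hzT, hz⟩, rfl⟩, -⟩
      refine ⟨?_, mem_image_of_mem _ hz⟩
      rw [mem_preimage, hi.leftInvOn_invFunOn hz]
      exact hzT
  refine borsuk_b (hK.image_of_continuousOn h2) hpn (fun w => k (Function.invFunOn f2 K w))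
    (hk.comp hinv (fun w hw => Function.invFunOn_mem hw)) ?_
  rintro _ ⟨z, hz, rfl⟩
  rw [hi.leftInvOn_invFunOn hz, hke z hz]



theorem log_differentiable {S : Set ℂ} (hS : IsOpen S) {f g : ℂ → ℂ}
    (hf : DifferentiableOn ℂ f S) (hg : ContinuousOn g S)
    (he : ∀ z ∈ S, Complex.exp (g z) = f z) : DifferentiableOn ℂ g S := by
  intro z0 hz0
  have hne : ∀ z ∈ S, f z ≠ 0 := fun z hz => he z hz ▸ Complex.exp_ne_zero _
  have hfd : DifferentiableAt ℂ f z0 := hf.differentiableAt (hS.mem_nhds hz0)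
  have hd : DifferentiableAt ℂ (fun z => g z0 + Complex.log (f z / f z0)) z0 := by
    refine (differentiableAt_const _).add ((hfd.div_const _).clog ?_)
    rw [div_self (hne z0 hz0)]
    exact Complex.one_mem_slitPlane
  have hev : ∀ᶠ z in 𝓝 z0, g z = g z0 + Complex.log (f z / f z0) := by
    have hc : ContinuousAt (fun z => (g z).im) z0 :=
      Complex.continuous_im.continuousAt.comp (hg.continuousAt (hS.mem_nhds hz0))
    have hc2 : ContinuousAt (fun z => (g z0 + Complex.log (f z / f z0)).im) z0 :=
      Complex.continuous_im.continuousAt.comp hd.continuousAt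
    have h3 := (hc.sub hc2) (Metric.ball_mem_nhds _ Real.two_pi_pos)
    filter_upwards [h3, hS.mem_nhds hz0] with z hz hzS
    apply exp_inj_close
    · rw [Complex.exp_add, he z hzS, he z0 hz0,
        Complex.exp_log (div_ne_zero (hne z hzS) (hne z0 hz0))]
      have := hne z0 hz0
      field_simp
    · rw [mem_preimage, Metric.mem_ball, Real.dist_eq] at hz
      simp only [Pi.sub_apply] at hz
      rw [div_self (hne z0 hz0)] at hz
      simpa using hz
  exact (hd.congr_of_eventuallyEq hev).differentiableWithinAt

theorem exists_log_ball {R : ℝ} {f : ℂ → ℂ} (hf : DifferentiableOn ℂ f (ball 0 R))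
    (hne : ∀ z ∈ ball (0:ℂ) R, f z ≠ 0) (l0 : ℂ) (hl0 : Complex.exp l0 = f 0) :
    ∃ g : ℂ → ℂ, DifferentiableOn ℂ g (ball 0 R) ∧
      (∀ z ∈ ball (0:ℂ) R, Complex.exp (g z) = f z) ∧ (0 < R → g 0 = l0) := by
  have hm : ∀ z ∈ ball (0:ℂ) R, ∀ s ∈ Icc (0:ℝ) 1, (s:ℂ) * z ∈ ball (0:ℂ) R := by
    intro z hz s hs
    rw [mem_ball_zero_iff] at hz ⊢
    rw [norm_mul, Complex.norm_real, Real.norm_of_nonneg hs.1]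
    nlinarith [norm_nonneg z, hs.2]
  obtain ⟨g, hg, hge, hg0⟩ := hl_lift (ball (0:ℂ) R) (fun z s => f (s * z))
    (hf.continuousOn.comp (by fun_prop) (fun p hp => hm p.1 hp.1 p.2 hp.2))
    (fun z hz s hs => hne _ (hm z hz s hs)) (fun _ => l0) continuousOn_const
    (fun z hz => by simpa using hl0)
  have hc : ContinuousOn (fun z => g z 1) (ball 0 R) :=
    hg.comp (f := fun z : ℂ => (z, (1:ℝ))) (by fun_prop) (fun z hz => ⟨hz, by simp⟩)
  have he : ∀ z ∈ ball (0:ℂ) R, Complex.exp (g z 1) = f z := by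
    intro z hz
    rw [hge z hz 1 (by simp)]; simp
  refine ⟨fun z => g z 1, log_differentiable isOpen_ball hf hc he, he, fun hR => ?_⟩
  have h0 : (0:ℂ) ∈ ball (0:ℂ) R := by simpa using hR
  have hcs : ContinuousOn (fun s : ℝ => g 0 s) (Icc 0 1) :=
    hg.comp (f := fun s : ℝ => ((0:ℂ), s)) (by fun_prop) (fun s hs => ⟨h0, hs⟩)
  have := log_unique (S := Icc (0:ℝ) 1) isPreconnected_Icc hcs
    (continuousOn_const (c := l0)) (fun s hs => by rw [hge 0 h0 s hs]; simpa using hl0.symm)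
    (z0 := 0) (by simp) (hg0 0 h0) 1 (by simp)
  exact this

/-- the inverse of an injective holomorphic map -/
theorem univ_inv {S : Set ℂ} (hS : IsOpen S) {f : ℂ → ℂ} (hf : DifferentiableOn ℂ f S)
    (hi : InjOn f S) :
    IsOpen (f '' S) ∧ DifferentiableOn ℂ (Function.invFunOn f S) (f '' S) ∧
      ∀ z ∈ S, deriv f z ≠ 0 := by
  have han : ∀ z ∈ S, AnalyticAt ℂ f z := fun z hz => hf.analyticAt (hS.mem_nhds hz)
  have hnc : ∀ z ∈ S, ∀ c, ¬ ∀ᶠ w in 𝓝 z, f w = c := by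
    intro z hz c hev
    have h1 : ∀ᶠ w in 𝓝 z, w = z := by
      filter_upwards [hev, hS.mem_nhds hz] with w hw hwS
      exact hi hwS hz (hw.trans hev.self_of_nhds.symm)
    have h2 : ∃ᶠ w in 𝓝 z, w ≠ z := by
      have : (𝓝[≠] z).NeBot := inferInstance
      exact frequently_iff_neBot.2 this
    exact h2 (h1.mono fun w hw => by simpa using hw)
  have hmap : ∀ z ∈ S, 𝓝 (f z) ≤ map f (𝓝 z) := fun z hz =>
    ((han z hz).eventually_constant_or_nhds_le_map_nhds).resolve_left (hnc z hz _)
  set k := Function.invFunOn f S with hk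
  have hkf : ∀ z ∈ S, k (f z) = z := fun z hz => hi.leftInvOn_invFunOn hz
  have hopen : IsOpen (f '' S) := by
    rw [isOpen_iff_mem_nhds]
    rintro _ ⟨z, hz, rfl⟩
    exact hmap z hz (image_mem_map (hS.mem_nhds hz))
  have hkc : ∀ z ∈ S, ContinuousAt k (f z) := by
    intro z hz
    rw [ContinuousAt, hkf z hz, tendsto_def]
    intro T hT
    have : f '' (T ∩ S) ∈ 𝓝 (f z) := hmap z hz (image_mem_map (inter_mem hT (hS.mem_nhds hz)))
    filter_upwards [this]
    rintro _ ⟨w, ⟨hwT, hwS⟩, rfl⟩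
    rw [mem_preimage, hkf w hwS]; exact hwT
  have hfk : ∀ y ∈ f '' S, f (k y) = y := fun y hy => Function.invFunOn_eq hy
  have hkd0 : ∀ z ∈ S, deriv f z ≠ 0 → DifferentiableAt ℂ k (f z) := by
    intro z hz hd
    have := HasDerivAt.of_local_left_inverse (f := f) (g := k) (a := f z) (f' := deriv f z)
      (hkc z hz) (by rw [hkf z hz]; exact (han z hz).differentiableAt.hasDerivAt) hd
      (by
        filter_upwards [hopen.mem_nhds (mem_image_of_mem f hz)] with y hy
        exact hfk y hy)
    exact this.differentiableAt
  have hkd : ∀ z ∈ S, DifferentiableAt ℂ k (f z) := by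
    intro z hz
    have hda : AnalyticAt ℂ (deriv f) z := (han z hz).deriv
    have hne : ∀ᶠ w in 𝓝[≠] z, deriv f w ≠ 0 := by
      refine hda.eventually_eq_zero_or_eventually_ne_zero.resolve_left ?_
      intro h0
      obtain ⟨r, hr, hrS⟩ := Metric.eventually_nhds_iff_ball.1 (h0.and (hS.mem_nhds hz))
      apply hnc z hz (f z)
      filter_upwards [Metric.ball_mem_nhds z hr] with w hw
      exact (convex_ball z r).is_const_of_fderivWithin_eq_zero (𝕜 := ℂ) (f := f)
        (fun y hy => ((han y (hrS y hy).2).differentiableAt).differentiableWithinAt)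
        (fun y hy => by
          rw [fderivWithin_of_isOpen isOpen_ball hy]
          ext
          simpa using (hrS y hy).1) hw (mem_ball_self hr)
    refine (Complex.analyticAt_of_differentiable_on_punctured_nhds_of_continuousAt ?_
      (hkc z hz)).differentiableAt
    have h1 : Tendsto k (𝓝[≠] (f z)) (𝓝[≠] z) := by
      apply tendsto_nhdsWithin_of_tendsto_nhds_of_eventually_within
      · have := hkc z hz
        rw [ContinuousAt, hkf z hz] at this
        exact this.mono_left nhdsWithin_le_nhds
      · filter_upwards [self_mem_nhdsWithin,
          nhdsWithin_le_nhds (hopen.mem_nhds (mem_image_of_mem f hz))] with y hy hyS hcon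
        apply hy
        rw [← hfk y hyS]
        have : k y = z := hcon
        rw [this]; rfl
    filter_upwards [h1.eventually hne,
      nhdsWithin_le_nhds (hopen.mem_nhds (mem_image_of_mem f hz))] with y hy hyS
    have := hkd0 (k y) (Function.invFunOn_mem hyS) hy
    rwa [hfk y hyS] at this
  refine ⟨hopen, ?_, ?_⟩
  · rintro _ ⟨z, hz, rfl⟩
    exact (hkd z hz).differentiableWithinAt
  · intro z hz h0
    have h1 : HasDerivAt (k ∘ f) (deriv k (f z) * deriv f z) z :=
      (hkd z hz).hasDerivAt.comp z (han z hz).differentiableAt.hasDerivAt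
    have h2 : HasDerivAt (k ∘ f) 1 z := by
      refine (hasDerivAt_id z).congr_of_eventuallyEq ?_
      filter_upwards [hS.mem_nhds hz] with w hw
      exact hkf w hw
    have := h1.unique h2
    rw [h0, mul_zero] at this
    exact zero_ne_one this

theorem harnack_pos {u : ℂ → ℂ} (hu : DifferentiableOn ℂ u (ball 0 1)) {m : ℝ} (hm : 0 < m)
    (h0 : u 0 = m) (hre : ∀ z ∈ ball (0:ℂ) 1, 0 ≤ (u z).re) {z : ℂ} (hz : ‖z‖ < 1) :
    ‖u z‖ ≤ m * (1 + ‖z‖) / (1 - ‖z‖) ∧ m * (1 - ‖z‖) / (1 + ‖z‖) ≤ (u z).re := by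
  have hne : ∀ z ∈ ball (0:ℂ) 1, u z + m ≠ 0 := by
    intro z hz h
    have h1 := congrArg Complex.re h
    simp at h1
    linarith [hre z hz]
  have hsch : ‖(u z - m) / (u z + m)‖ ≤ ‖z‖ := by
    refine Complex.norm_le_norm_of_mapsTo_ball (f := fun z => (u z - m) / (u z + m)) (R := 1)
      ((hu.sub_const _).div (hu.add_const _) hne) ?_ (by simp [h0]) hz
    intro w hw
    rw [mem_closedBall_zero_iff, norm_div]
    apply div_le_one_of_le₀ _ (norm_nonneg _)
    rw [Complex.norm_def, Complex.norm_def]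
    apply Real.sqrt_le_sqrt
    rw [Complex.normSq_apply, Complex.normSq_apply]
    simp only [Complex.sub_re, Complex.ofReal_re, Complex.sub_im, Complex.ofReal_im, sub_zero,
      Complex.add_re, Complex.add_im, add_zero]
    nlinarith [mul_nonneg hm.le (hre w hw)]
  set r := ‖z‖ with hr
  have hr0 : 0 ≤ r := norm_nonneg _
  set k := (u z - m) / (u z + m) with hk
  have hn := hne z (by simpa using hz)
  have h1 : u z * (1 - k) = m * (1 + k) := by
    rw [hk]; field_simp; ring
  have hk1 : 1 - r ≤ ‖1 - k‖ := by
    have := norm_sub_norm_le (1:ℂ) k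
    rw [norm_one] at this
    linarith
  have hk2 : ‖1 + k‖ ≤ 1 + r := by
    have := norm_add_le (1:ℂ) k
    rw [norm_one] at this
    linarith
  have h2 : ‖u z‖ * ‖1 - k‖ = m * ‖1 + k‖ := by
    rw [← norm_mul, h1, norm_mul, Complex.norm_real, Real.norm_of_nonneg hm.le]
  constructor
  · rw [le_div_iff₀ (by linarith)]
    calc ‖u z‖ * (1 - r) ≤ ‖u z‖ * ‖1 - k‖ := by gcongr
      _ = m * ‖1 + k‖ := h2
      _ ≤ m * (1 + r) := by gcongr
  · have hkn : ‖k‖ < 1 := lt_of_le_of_lt hsch hz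
    have hk0 : 1 - k ≠ 0 := by
      intro h; rw [h, norm_zero] at hk1; linarith
    have h3 : u z = m * ((1 + k) / (1 - k)) := by
      field_simp; linear_combination h1
    have h4 : ((1 + k) / (1 - k)).re = (1 - ‖k‖^2) / ‖1 - k‖^2 := by
      rw [Complex.div_re, ← Complex.normSq_eq_norm_sq, ← Complex.normSq_eq_norm_sq, ← add_div]
      congr 1
      rw [Complex.normSq_apply]
      simp
      ring
    rw [h3, Complex.re_ofReal_mul, h4, mul_div_assoc]
    gcongr m * ?_
    have h5 : ‖1 - k‖ ≤ 1 + ‖k‖ := by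
      have := norm_sub_le (1:ℂ) k
      rw [norm_one] at this; linarith
    have h6 : 0 < ‖1 - k‖ := norm_pos_iff.2 hk0
    calc (1 - r) / (1 + r) ≤ (1 - ‖k‖) / (1 + ‖k‖) := by
          rw [div_le_div_iff₀ (by linarith) (by linarith [norm_nonneg k])]
          nlinarith
      _ = (1 - ‖k‖^2) / (1 + ‖k‖)^2 := by
          have : 1 + ‖k‖ ≠ 0 := by linarith [norm_nonneg k]
          field_simp; ring
      _ ≤ (1 - ‖k‖^2) / ‖1 - k‖^2 := by
          apply div_le_div_of_nonneg_left _ (by positivity) (by gcongr)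
          nlinarith [norm_nonneg k]

/-- Harnack inequality for functions with nonnegative real part. -/
theorem harnack {u : ℂ → ℂ} (hu : DifferentiableOn ℂ u (ball 0 1)) {m : ℝ}
    (h0 : u 0 = m) (hre : ∀ z ∈ ball (0:ℂ) 1, 0 ≤ (u z).re) {z : ℂ} (hz : ‖z‖ < 1) :
    ‖u z‖ ≤ m * (1 + ‖z‖) / (1 - ‖z‖) ∧ m * (1 - ‖z‖) / (1 + ‖z‖) ≤ (u z).re := by
  have hm : 0 ≤ m := by
    have := hre 0 (by simp)
    rw [h0] at this; simpa using this
  have hz0 := norm_nonneg z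
  have key : ∀ ε : ℝ, 0 < ε → ‖u z + ε‖ ≤ (m + ε) * (1 + ‖z‖) / (1 - ‖z‖) ∧
      (m + ε) * (1 - ‖z‖) / (1 + ‖z‖) ≤ (u z).re + ε := by
    intro ε hε
    have := harnack_pos (u := fun z => u z + ε) (hu.add_const _) (m := m + ε) (by linarith)
      (by simp [h0]) (fun w hw => by simpa using add_nonneg (hre w hw) hε.le) hz
    simpa using this
  constructor
  · have h1 : Tendsto (fun ε : ℝ => ‖u z + ε‖) (𝓝[>] 0) (𝓝 ‖u z + (0:ℝ)‖) :=
      (Continuous.tendsto (by fun_prop) 0).mono_left nhdsWithin_le_nhds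
    have h2 : Tendsto (fun ε : ℝ => (m + ε) * (1 + ‖z‖) / (1 - ‖z‖)) (𝓝[>] 0)
        (𝓝 ((m + 0) * (1 + ‖z‖) / (1 - ‖z‖))) :=
      (Continuous.tendsto (by fun_prop) 0).mono_left nhdsWithin_le_nhds
    have := le_of_tendsto_of_tendsto h1 h2
      (eventually_of_mem self_mem_nhdsWithin fun ε hε => (key ε hε).1)
    simpa using this
  · have h1 : Tendsto (fun ε : ℝ => (u z).re + ε) (𝓝[>] 0) (𝓝 ((u z).re + 0)) :=
      (Continuous.tendsto (by fun_prop) 0).mono_left nhdsWithin_le_nhds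
    have h2 : Tendsto (fun ε : ℝ => (m + ε) * (1 - ‖z‖) / (1 + ‖z‖)) (𝓝[>] 0)
        (𝓝 ((m + 0) * (1 - ‖z‖) / (1 + ‖z‖))) :=
      (Continuous.tendsto (by fun_prop) 0).mono_left nhdsWithin_le_nhds
    have := le_of_tendsto_of_tendsto h2 h1
      (eventually_of_mem self_mem_nhdsWithin fun ε hε => (key ε hε).2)
    simpa using this


/-- data of a normalized exterior Riemann map `φ(z) = exp (G z) / z`. -/
structure Rie (U : Set ℂ) (G : ℂ → ℂ) : Prop where
  diff : DifferentiableOn ℂ G (ball 0 1)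
  im0 : (G 0).im = 0
  inj : InjOn (fun z => Complex.exp (G z) / z) (ball 0 1 \ {0})
  img : (fun z => Complex.exp (G z) / z) '' (ball 0 1 \ {0}) = U
  re : ∀ z ∈ ball (0:ℂ) 1, (G z).re ≤ 0
  zero : (0:ℂ) ∉ U

namespace Rie

variable {U : Set ℂ} {G : ℂ → ℂ}

theorem mem (h : Rie U G) {z : ℂ} (hz : ‖z‖ < 1) (h0 : z ≠ 0) : Complex.exp (G z) / z ∈ U := by
  rw [← h.img]
  exact mem_image_of_mem (fun z => Complex.exp (G z) / z) ⟨by simpa using hz, h0⟩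

theorem exists_pre (h : Rie U G) {u : ℂ} (hu : u ∈ U) :
    ∃ z : ℂ, ‖z‖ < 1 ∧ z ≠ 0 ∧ Complex.exp (G z) / z = u := by
  rw [← h.img] at hu
  obtain ⟨z, hz, rfl⟩ := hu
  exact ⟨z, by simpa using hz.1, hz.2, rfl⟩

/-- the reciprocal map -/
theorem F_inj (h : Rie U G) : InjOn (fun z => z * Complex.exp (- G z)) (ball 0 1) := by
  intro z hz w hw hzw
  simp only at hzw
  by_cases hz0 : z = 0
  · subst hz0
    rw [zero_mul] at hzw
    rcases mul_eq_zero.1 hzw.symm with h1 | h1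
    · exact h1.symm
    · exact absurd h1 (Complex.exp_ne_zero _)
  by_cases hw0 : w = 0
  · subst hw0
    rw [zero_mul] at hzw
    exact absurd hzw (mul_ne_zero hz0 (Complex.exp_ne_zero _))
  apply h.inj ⟨hz, hz0⟩ ⟨hw, hw0⟩
  have h1 : ∀ x : ℂ, Complex.exp (G x) / x = (x * Complex.exp (- G x))⁻¹ := by
    intro x
    rw [Complex.exp_neg, mul_inv, inv_inv, div_eq_mul_inv, mul_comm]
  simp only [h1, hzw]

theorem F_diff (h : Rie U G) : DifferentiableOn ℂ (fun z => z * Complex.exp (- G z)) (ball 0 1) :=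
  differentiableOn_id.mul h.diff.neg.cexp

theorem F_img (h : Rie U G) {v : ℂ} (hv : v⁻¹ ∈ U) :
    v ∈ (fun z => z * Complex.exp (- G z)) '' (ball 0 1) := by
  obtain ⟨z, hz, hz0, hzu⟩ := h.exists_pre hv
  refine ⟨z, by simpa using hz, ?_⟩
  show z * Complex.exp (- G z) = v
  rw [← inv_inv v, ← hzu, Complex.exp_neg]
  simp [div_eq_mul_inv]

theorem isOpen (h : Rie U G) : IsOpen U := by
  rw [← h.img]
  refine (univ_inv (isOpen_ball.sdiff isClosed_singleton) ?_ h.inj).1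
  exact (h.diff.mono sdiff_subset).cexp.div differentiableOn_id (fun z hz => hz.2)

theorem m_nonneg (h : Rie U G) : 0 ≤ -(G 0).re := by
  have := h.re 0 (by simp)
  linarith

theorem harn (h : Rie U G) {z : ℂ} (hz : ‖z‖ < 1) :
    ‖G z‖ ≤ -(G 0).re * (1 + ‖z‖) / (1 - ‖z‖) ∧
      (G z).re ≤ - (-(G 0).re * (1 - ‖z‖) / (1 + ‖z‖)) := by
  have := harnack (u := fun z => - G z) h.diff.neg (m := -(G 0).re)
    (by apply Complex.ext <;> simp [h.im0]) (fun w hw => by simpa using h.re w hw) hz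
  simp only [norm_neg, Complex.neg_re] at this
  exact ⟨this.1, by linarith [this.2]⟩

end Rie

theorem rie_of_norm {U : Set ℂ} {f : ℂ → ℂ} (hf : IsNormalizedRiemannMap U f)
    (h0 : (0:ℂ) ∉ U) (hU : ∀ z : ℂ, 1 ≤ ‖z‖ → z ∈ U) :
    ∃ G, Rie U G ∧ ∀ z : ℂ, ‖z‖ < 1 → z ≠ 0 → f z = Complex.exp (G z) / z := by
  classical
  obtain ⟨hd, hi, him, c, hc, hlim⟩ := hf
  let g : ℂ → ℂ := Function.update (fun z => z * f z) 0 (c:ℂ)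
  have hg0 : g 0 = c := by simp [g]
  have hgz : ∀ z, z ≠ 0 → g z = z * f z := fun z hz => by simp [g, hz]
  have hgd : DifferentiableOn ℂ g (ball 0 1) := by
    rw [← Complex.differentiableOn_compl_singleton_and_continuousAt_iff
      (ball_mem_nhds (0:ℂ) one_pos)]
    constructor
    · refine (differentiableOn_id.mul hd).congr (fun z hz => ?_)
      exact hgz z hz.2
    · exact continuousAt_update_same.2 hlim
  have hfU : ∀ z ∈ ball (0:ℂ) 1, z ≠ 0 → f z ∈ U := by
    intro z hz hz0
    rw [← him]; exact mem_image_of_mem _ ⟨hz, hz0⟩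
  have hgne : ∀ z ∈ ball (0:ℂ) 1, g z ≠ 0 := by
    intro z hz
    by_cases hz0 : z = 0
    · rw [hz0, hg0]; exact_mod_cast hc.ne'
    · rw [hgz z hz0]
      refine mul_ne_zero hz0 (fun h => h0 ?_)
      rw [← h]; exact hfU z hz hz0
  obtain ⟨G, hGd, hGe, hG0⟩ := exists_log_ball hgd hgne (Real.log c) (by
    rw [hg0, ← Complex.ofReal_exp, Real.exp_log hc])
  have hG0' := hG0 one_pos
  have hfe : ∀ z ∈ ball (0:ℂ) 1, z ≠ 0 → f z = Complex.exp (G z) / z := by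
    intro z hz hz0
    rw [hGe z hz, hgz z hz0]; field_simp
  have hEq : EqOn f (fun z => Complex.exp (G z) / z) (ball 0 1 \ {0}) := fun z hz =>
    hfe z hz.1 hz.2
  refine ⟨G, ?_, fun z hz hz0 => hfe z (by simpa using hz) hz0⟩
  have hinj := hi.congr hEq
  have himg : (fun z => Complex.exp (G z) / z) '' (ball 0 1 \ {0}) = U := by
    rw [← him]; exact (image_congr hEq).symm
  let F : ℂ → ℂ := fun z => z * Complex.exp (- G z)
  have hFfz : ∀ z ∈ ball (0:ℂ) 1, z ≠ 0 → F z = (f z)⁻¹ := by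
    intro z hz hz0
    rw [hfe z hz hz0]; simp [F, Complex.exp_neg, div_eq_mul_inv]
  have hF0 : F 0 = 0 := by simp [F]
  have hFne : ∀ z, z ≠ 0 → F z ≠ 0 := fun z hz => mul_ne_zero hz (Complex.exp_ne_zero _)
  have hFi : InjOn F (ball 0 1) := by
    intro z hz w hw hzw
    by_cases hz0 : z = 0
    · subst hz0
      by_contra hne
      exact hFne w (Ne.symm hne) (by rw [← hzw, hF0])
    by_cases hw0 : w = 0
    · subst hw0
      exact absurd (by rw [hzw, hF0]) (hFne z hz0)
    apply hi ⟨hz, hz0⟩ ⟨hw, hw0⟩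
    rw [hFfz z hz hz0, hFfz w hw hw0] at hzw
    exact inv_injective hzw
  have hFd : DifferentiableOn ℂ F (ball 0 1) := differentiableOn_id.mul hGd.neg.cexp
  obtain ⟨hFo, hkd, -⟩ := univ_inv isOpen_ball hFd hFi
  have hsub : ball (0:ℂ) 1 ⊆ F '' ball 0 1 := by
    intro v hv
    by_cases hv0 : v = 0
    · exact ⟨0, by simp, by rw [hF0, hv0]⟩
    have hvU : v⁻¹ ∈ U := by
      apply hU
      rw [norm_inv]
      exact (one_le_inv₀ (norm_pos_iff.2 hv0)).2 (mem_ball_zero_iff.1 hv).le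
    rw [← him] at hvU
    obtain ⟨z, hz, hzv⟩ := hvU
    exact ⟨z, hz.1, by rw [hFfz z hz.1 hz.2, hzv, inv_inv]⟩
  have hre : ∀ z ∈ ball (0:ℂ) 1, (G z).re ≤ 0 := by
    have key : ∀ z ∈ ball (0:ℂ) 1, ‖z‖ ≤ ‖F z‖ := by
      intro z hz
      by_cases hFz : ‖F z‖ < 1
      · have := Complex.norm_le_norm_of_mapsTo_ball (f := Function.invFunOn F (ball 0 1)) (R := 1)
          (hkd.mono hsub) (fun v hv => ball_subset_closedBall (Function.invFunOn_mem (hsub hv)))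
          (by
            have := hFi.leftInvOn_invFunOn (show (0:ℂ) ∈ ball (0:ℂ) 1 by simp)
            rwa [hF0] at this) hFz
        rwa [hFi.leftInvOn_invFunOn hz] at this
      · have : ‖z‖ < 1 := by simpa using hz
        linarith
    have hne : ∀ z ∈ ball (0:ℂ) 1, z ≠ 0 → (G z).re ≤ 0 := by
      intro z hz hz0
      have h1 := key z hz
      have h2 : ‖F z‖ = ‖z‖ * Real.exp (-(G z).re) := by
        simp [F, Complex.norm_exp]
      rw [h2] at h1
      have h3 : 0 < ‖z‖ := norm_pos_iff.2 hz0
      have h4 : 1 ≤ Real.exp (-(G z).re) := by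
        by_contra hcon
        push Not at hcon
        nlinarith
      have := Real.one_le_exp_iff.1 h4
      linarith
    intro z hz
    by_cases hz0 : z = 0
    · subst hz0
      have hc : ContinuousAt (fun z => (G z).re) 0 :=
        Complex.continuous_re.continuousAt.comp
          (hGd.continuousOn.continuousAt (ball_mem_nhds (0:ℂ) one_pos))
      refine le_of_tendsto (hc.tendsto.mono_left (nhdsWithin_le_nhds (s := {0}ᶜ))) ?_
      filter_upwards [self_mem_nhdsWithin, nhdsWithin_le_nhds (ball_mem_nhds (0:ℂ) one_pos)]
        with w hw hw1
      exact hne w hw1 hw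
    · exact hne z hz hz0
  exact ⟨hGd, by rw [hG0']; exact Complex.ofReal_im _, hinj, himg, hre, h0⟩

/-- lower bound for the capacity. -/
theorem Rie.m_bound {U : Set ℂ} {G : ℂ → ℂ} (h : Rie U G) {p : ℂ} (hp : p ∉ U) {d : ℝ}
    (hd : 0 < d) (hpd : d ≤ ‖p‖) : -(G 0).re ≤ 3 * Real.log (4 / d) := by
  set m := -(G 0).re with hm
  by_contra hcon
  push Not at hcon
  have hlt : 4 / d < Real.exp (m / 3) := by
    rw [← Real.log_lt_iff_lt_exp (by positivity)]
    linarith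
  have hlt' : 4 < d * Real.exp (m / 3) := by
    rw [div_lt_iff₀ hd] at hlt
    linarith
  have hQ : ∀ z ∈ ball (0:ℂ) 1, 1 - p * (z * Complex.exp (- G z)) ≠ 0 := by
    intro z hz h1
    by_cases hz0 : z = 0
    · simp [hz0] at h1
    apply hp
    have := h.mem (by simpa using hz) hz0
    convert this using 1
    have h2 : p * (z * Complex.exp (- G z)) = 1 := (sub_eq_zero.1 h1).symm
    rw [eq_div_iff hz0]
    rw [Complex.exp_neg] at h2
    have := Complex.exp_ne_zero (G z)
    field_simp at h2
    linear_combination h2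
  have hdiff : DifferentiableOn ℂ (fun z => (1 - p * (z * Complex.exp (- G z)))⁻¹) (ball 0 1) :=
    (((h.F_diff).const_mul p).const_sub 1).inv hQ
  have hcb : closedBall (0:ℂ) (1/2) ⊆ ball 0 1 := closedBall_subset_ball (by norm_num)
  have hmax := Complex.norm_le_of_forall_mem_frontier_norm_le (U := ball (0:ℂ) (1/2))
    (f := fun z => (1 - p * (z * Complex.exp (- G z)))⁻¹) isBounded_ball
    (DifferentiableOn.diffContOnCl (hdiff.mono (by
      rw [closure_ball _ (by norm_num)]; exact hcb))) (C := 1 / (4/2 - 1 + (d * Real.exp (m/3) / 2 - 2)))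
    (fun z hz => by
      rw [frontier_ball _ (by norm_num), mem_sphere_zero_iff_norm] at hz
      have h1 := (h.harn (z := z) (by rw [hz]; norm_num)).2
      rw [hz, ← hm] at h1
      have h1' : m * (1 - 1 / 2) / (1 + 1 / 2) = m / 3 := by ring
      have h2 : m / 3 ≤ -(G z).re := by linarith
      have h3 : ‖p * (z * Complex.exp (- G z))‖ = ‖p‖ * (1/2 * Real.exp (-(G z).re)) := by
        rw [norm_mul, norm_mul, hz, Complex.norm_exp, Complex.neg_re]
      have h4 : d * Real.exp (m/3) / 2 ≤ ‖p * (z * Complex.exp (- G z))‖ := by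
        rw [h3]
        have : Real.exp (m/3) ≤ Real.exp (-(G z).re) := Real.exp_le_exp.2 h2
        have h5 : d * Real.exp (m/3) ≤ ‖p‖ * Real.exp (-(G z).re) := by gcongr
        linarith
      have h6 := norm_sub_norm_le (p * (z * Complex.exp (- G z))) 1
      rw [norm_one, norm_sub_rev] at h6
      rw [norm_inv, ← one_div]
      apply one_div_le_one_div_of_le (by linarith)
      linarith) (z := 0) (subset_closure (by simp))
  simp only [zero_mul, mul_zero, sub_zero, inv_one, norm_one] at hmax
  rw [le_div_iff₀ (by linarith)] at hmax
  linarith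

/-- uniform distance of the compact part of the image from points outside `U`. -/
theorem Rie.dist_bound {M s : ℝ} (hs : 0 < s) (hs1 : s < 1) :
    ∃ δ : ℝ, 0 < δ ∧ ∀ (U : Set ℂ) (G : ℂ → ℂ), Rie U G → -(G 0).re ≤ M → ∀ p ∉ U, ‖p‖ ≤ 1 →
      ∀ z : ℂ, z ≠ 0 → ‖z‖ ≤ s → δ ≤ ‖Complex.exp (G z) / z - p‖ := by
  set s' := (1 + s) / 2 with hs'
  have hss : s < s' := by rw [hs']; linarith
  have hs'1 : s' < 1 := by rw [hs']; linarith
  have hs'0 : 0 < s' := by linarith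
  set N := max M 0 * (1 + s') / (1 - s') with hN
  set L := 1 + Real.exp N with hL
  have hN0 : 0 ≤ N := by
    rw [hN]; apply div_nonneg (mul_nonneg (le_max_right _ _) (by linarith)) (by linarith)
  have hL1 : 1 ≤ L := by rw [hL]; linarith [Real.exp_pos N]
  set C := Real.log L * (1 + s / s') / (1 - s / s') with hC
  refine ⟨Real.exp (-N) * (L * Real.exp (-C)), by positivity, ?_⟩
  intro U G h hM p hp hp1 z hz0 hzs
  have hGb : ∀ w : ℂ, ‖w‖ < s' → ‖G w‖ ≤ N := by
    intro w hw
    refine (h.harn (hw.trans hs'1)).1.trans ?_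
    have h1 : -(G 0).re ≤ max M 0 := hM.trans (le_max_left _ _)
    rw [hN]
    have h2 := norm_nonneg w
    rw [div_le_div_iff₀ (by linarith) (by linarith)]
    have h3 : -(G 0).re * (1 + ‖w‖) ≤ max M 0 * (1 + s') := by
      apply mul_le_mul h1 (by linarith) (by linarith) (le_max_right _ _)
    apply mul_le_mul h3 (by linarith) (by linarith)
    exact mul_nonneg (le_max_right _ _) (by linarith)
  have hQ : ∀ z ∈ ball (0:ℂ) 1, 1 - p * (z * Complex.exp (- G z)) ≠ 0 := by
    intro z hz h1
    by_cases hz0 : z = 0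
    · simp [hz0] at h1
    apply hp
    have := h.mem (by simpa using hz) hz0
    convert this using 1
    have h2 : p * (z * Complex.exp (- G z)) = 1 := (sub_eq_zero.1 h1).symm
    rw [eq_div_iff hz0]
    rw [Complex.exp_neg] at h2
    have := Complex.exp_ne_zero (G z)
    field_simp at h2
    linear_combination h2
  have hsc : ∀ w ∈ ball (0:ℂ) 1, ‖(s':ℂ) * w‖ < s' := by
    intro w hw
    rw [norm_mul, Complex.norm_real, Real.norm_of_nonneg hs'0.le]
    have : ‖w‖ < 1 := by simpa using hw
    nlinarith
  have hsm : MapsTo (fun w => (s':ℂ) * w) (ball 0 1) (ball (0:ℂ) 1) := fun w hw => by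
    simpa using (hsc w hw).trans hs'1
  let q : ℂ → ℂ := fun w => (L:ℂ) / (1 - p * ((s' * w) * Complex.exp (- G (s' * w))))
  have hqd : DifferentiableOn ℂ q (ball 0 1) := by
    refine DifferentiableOn.div (differentiableOn_const _) ?_ (fun w hw => hQ _ (hsm hw))
    refine ((DifferentiableOn.comp h.F_diff ?_ hsm).const_mul p).const_sub 1
    fun_prop
  have hL0 : (L:ℂ) ≠ 0 := by
    have : L ≠ 0 := by linarith
    exact_mod_cast this
  obtain ⟨l, hld, hle, hl0⟩ := exists_log_ball hqd
    (fun w hw => div_ne_zero hL0 (hQ _ (hsm hw))) (Real.log L) (by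
      simp only [q]
      rw [← Complex.ofReal_exp, Real.exp_log (by linarith)]; simp)
  have hnorm : ∀ w ∈ ball (0:ℂ) 1, Real.exp ((l w).re) =
      L / ‖1 - p * ((s' * w) * Complex.exp (- G (s' * w)))‖ := by
    intro w hw
    rw [← Complex.norm_exp, hle w hw, norm_div, Complex.norm_real, Real.norm_of_nonneg (by linarith)]
  have hre : ∀ w ∈ ball (0:ℂ) 1, 0 ≤ (l w).re := by
    intro w hw
    rw [← Real.one_le_exp_iff, hnorm w hw, le_div_iff₀ (norm_pos_iff.2 (hQ _ (hsm hw))), one_mul]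
    refine (norm_sub_le _ _).trans ?_
    rw [norm_one, hL]
    gcongr
    rw [norm_mul, norm_mul, Complex.norm_exp, Complex.neg_re]
    have h1 : -(G (s' * w)).re ≤ N := by
      have h2 := hGb _ (hsc w hw)
      have h3 := Complex.abs_re_le_norm (G (s' * w))
      linarith [(abs_le.1 (h3.trans h2)).1]
    have h2 : ‖(s':ℂ) * w‖ ≤ 1 := ((hsc w hw).trans hs'1).le
    calc ‖p‖ * (‖(s':ℂ) * w‖ * Real.exp (-(G (s' * w)).re))
        ≤ 1 * (1 * Real.exp N) := by gcongr
      _ = Real.exp N := by ring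
  have hs'c : (s':ℂ) ≠ 0 := by exact_mod_cast hs'0.ne'
  have hwn : ‖z / s'‖ = ‖z‖ / s' := by
    rw [norm_div, Complex.norm_real, Real.norm_of_nonneg hs'0.le]
  have hw1 : ‖z / s'‖ < 1 := by
    rw [hwn, div_lt_one hs'0]; linarith
  have hh := (harnack hld (m := Real.log L) (hl0 one_pos) hre hw1).1
  have hlog0 : 0 ≤ Real.log L := Real.log_nonneg hL1
  have hhC : (l (z / s')).re ≤ C := by
    refine (Complex.re_le_norm _).trans (hh.trans ?_)
    have h1 : ‖z / s'‖ ≤ s / s' := by rw [hwn]; gcongr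
    have h2 : s / s' < 1 := by rw [div_lt_one hs'0]; exact hss
    rw [hC]
    have h3 := norm_nonneg (z / s')
    rw [div_le_div_iff₀ (by linarith) (by linarith)]
    apply mul_le_mul (by gcongr) (by linarith) (by linarith)
    exact mul_nonneg hlog0 (by linarith)
  have hmul : (s':ℂ) * (z / s') = z := by field_simp
  have hQn := hnorm (z / s') (by simpa using hw1)
  rw [hmul] at hQn
  have hz1 : ‖z‖ < 1 := by linarith
  have hQpos : 0 < ‖1 - p * (z * Complex.exp (- G z))‖ :=
    norm_pos_iff.2 (hQ z (by simpa using hz1))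
  have hQl : L * Real.exp (-C) ≤ ‖1 - p * (z * Complex.exp (- G z))‖ := by
    have h1 : L / ‖1 - p * (z * Complex.exp (- G z))‖ ≤ Real.exp C := by
      rw [← hQn]; exact Real.exp_le_exp.2 hhC
    rw [div_le_iff₀ hQpos] at h1
    rw [Real.exp_neg, ← div_eq_mul_inv, div_le_iff₀ (Real.exp_pos _)]
    linarith
  have hfac : Complex.exp (G z) / z - p =
      (Complex.exp (G z) / z) * (1 - p * (z * Complex.exp (- G z))) := by
    rw [Complex.exp_neg]
    have := Complex.exp_ne_zero (G z)
    field_simp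
  rw [hfac, norm_mul]
  have hφ : Real.exp (-N) ≤ ‖Complex.exp (G z) / z‖ := by
    rw [norm_div, Complex.norm_exp, le_div_iff₀ (norm_pos_iff.2 hz0)]
    have h2 := hGb z (by linarith)
    have h3 := Complex.abs_re_le_norm (G z)
    have h4 : -N ≤ (G z).re := by linarith [(abs_le.1 (h3.trans h2)).1]
    have h5 := Real.exp_le_exp.2 h4
    nlinarith [Real.exp_pos (-N), norm_nonneg z]
  gcongr


theorem Rie.kap {U1 U2 : Set ℂ} {G1 G2 : ℂ → ℂ} (h1 : Rie U1 G1) (h2 : Rie U2 G2) {s : ℝ}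
    (hs : 0 < s) (hs1 : s < 1)
    (hsub : ∀ z : ℂ, z ≠ 0 → ‖z‖ < s → Complex.exp (G1 z) / z ∈ U2) :
    ∃ κ : ℂ → ℂ, DifferentiableOn ℂ κ (ball 0 s) ∧ κ 0 = 0 ∧
      (∀ z ∈ ball (0:ℂ) s, ‖κ z‖ < 1) ∧
      (∀ z ∈ ball (0:ℂ) s, ‖κ z‖ ≤ ‖z‖ / s) ∧
      (∀ z ∈ ball (0:ℂ) s, ‖dslope κ 0 z‖ ≤ 1 / s) ∧
      (∀ z ∈ ball (0:ℂ) s, κ z * Complex.exp (- G2 (κ z)) = z * Complex.exp (- G1 z)) ∧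
      deriv κ 0 = Complex.exp (G2 0 - G1 0) := by
  set F1 : ℂ → ℂ := fun z => z * Complex.exp (- G1 z) with hF1
  set F2 : ℂ → ℂ := fun z => z * Complex.exp (- G2 z) with hF2
  have hbs : ball (0:ℂ) s ⊆ ball 0 1 := ball_subset_ball hs1.le
  have hm : MapsTo F1 (ball 0 s) (F2 '' ball 0 1) := by
    intro z hz
    by_cases hz0 : z = 0
    · exact ⟨0, by simp, by simp [hF1, hF2, hz0]⟩
    · apply h2.F_img
      have := hsub z hz0 (by simpa using hz)
      convert this using 1
      simp [hF1, Complex.exp_neg, div_eq_mul_inv]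
  obtain ⟨hFo, hkd, -⟩ := univ_inv isOpen_ball h2.F_diff h2.F_inj
  let κ : ℂ → ℂ := fun z => Function.invFunOn F2 (ball 0 1) (F1 z)
  have hκd : DifferentiableOn ℂ κ (ball 0 s) := hkd.comp (h1.F_diff.mono hbs) hm
  have hκ0 : κ 0 = 0 := by
    have := h2.F_inj.leftInvOn_invFunOn (show (0:ℂ) ∈ ball (0:ℂ) 1 by simp)
    simpa [κ, hF1, hF2] using this
  have hκ1 : ∀ z ∈ ball (0:ℂ) s, ‖κ z‖ < 1 := fun z hz => by
    have := Function.invFunOn_mem (hm hz)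
    simpa using this
  have hmaps : MapsTo κ (ball 0 s) (closedBall (κ 0) 1) := fun z hz => by
    rw [hκ0]; simpa using (hκ1 z hz).le
  have heq : ∀ z ∈ ball (0:ℂ) s, F2 (κ z) = F1 z := fun z hz => Function.invFunOn_eq (hm hz)
  refine ⟨κ, hκd, hκ0, hκ1, ?_, fun z hz => Complex.norm_dslope_le_div_of_mapsTo_ball hκd hmaps hz,
    heq, ?_⟩
  · intro z hz
    have := Complex.dist_le_div_mul_dist_of_mapsTo_ball hκd hmaps hz
    rw [hκ0, dist_zero_right, dist_zero_right] at this
    calc ‖κ z‖ ≤ 1 / s * ‖z‖ := this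
      _ = ‖z‖ / s := by ring
  · have hder : ∀ G : ℂ → ℂ, DifferentiableOn ℂ G (ball 0 1) →
        HasDerivAt (fun z => z * Complex.exp (- G z)) (Complex.exp (- G 0)) 0 := by
      intro G hG
      have hG' : HasDerivAt G (deriv G 0) 0 :=
        (hG.differentiableAt (ball_mem_nhds (0:ℂ) one_pos)).hasDerivAt
      have h3 := (hasDerivAt_id (0:ℂ)).mul hG'.neg.cexp
      have h4 : (1 * Complex.exp ((-G) 0) + id 0 * (Complex.exp ((-G) 0) * -deriv G 0) : ℂ)
          = Complex.exp (- G 0) := by simp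
      rw [← h4]
      exact h3
    have hκ' : HasDerivAt κ (deriv κ 0) 0 :=
      (hκd.differentiableAt (ball_mem_nhds (0:ℂ) hs)).hasDerivAt
    have hc : HasDerivAt (F2 ∘ κ) (Complex.exp (- G2 0) * deriv κ 0) 0 := by
      apply HasDerivAt.comp
      · rw [hκ0]; exact hder G2 h2.diff
      · exact hκ'
    have hc2 : HasDerivAt (F2 ∘ κ) (Complex.exp (- G1 0)) 0 := by
      refine (hder G1 h1.diff).congr_of_eventuallyEq ?_
      filter_upwards [ball_mem_nhds (0:ℂ) hs] with z hz
      exact heq z hz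
    have := hc.unique hc2
    rw [sub_eq_add_neg, Complex.exp_add, ← this, Complex.exp_neg]
    field_simp

theorem Rie.pre_bound {U1 U2 : Set ℂ} {G1 G2 : ℂ → ℂ} (h1 : Rie U1 G1) (h2 : Rie U2 G2) {s : ℝ}
    (hs : 0 < s) (hs1 : s < 1)
    (hsub : ∀ z : ℂ, z ≠ 0 → ‖z‖ < s → Complex.exp (G1 z) / z ∈ U2) {z w : ℂ} (hz : ‖z‖ < s)
    (hw : ‖w‖ < 1) (h : Complex.exp (G2 w) / w = Complex.exp (G1 z) / z) : ‖w‖ ≤ ‖z‖ / s := by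
  obtain ⟨κ, -, -, hκ1, hκb, -, hκe, -⟩ := h1.kap h2 hs hs1 hsub
  have hzb : z ∈ ball (0:ℂ) s := by simpa using hz
  have : w = κ z := by
    apply h2.F_inj (by simpa using hw) (by simpa using hκ1 z hzb)
    simp only
    rw [hκe z hzb, Complex.exp_neg, Complex.exp_neg]
    have := congrArg (fun x => x⁻¹) h
    simp only [inv_div] at this
    simpa [div_eq_mul_inv] using this
  rw [this]
  exact hκb z hzb

/-- closeness of the Riemann maps of nearby domains. -/
theorem Rie.conv_one {U2 : Set ℂ} {G2 : ℂ → ℂ} (h2 : Rie U2 G2) {r ε : ℝ} (hr0 : 0 < r) (hr : r < 1)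
    (hε : 0 < ε) : ∃ s, r < s ∧ s < 1 ∧ ∀ (U1 : Set ℂ) (G1 : ℂ → ℂ), Rie U1 G1 →
      (∀ z : ℂ, z ≠ 0 → ‖z‖ < s → Complex.exp (G1 z) / z ∈ U2) →
      (∀ z : ℂ, z ≠ 0 → ‖z‖ < s → Complex.exp (G2 z) / z ∈ U1) →
      ∀ z : ℂ, ‖z‖ ≤ r → ‖G1 z - G2 z‖ < ε := by
  set r' := (1 + r) / 2 with hr'
  have hr'1 : r' < 1 := by rw [hr']; linarith
  have huc : UniformContinuousOn G2 (closedBall 0 r') :=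
    (isCompact_closedBall (0:ℂ) r').uniformContinuousOn_of_continuous
      (h2.diff.continuousOn.mono (closedBall_subset_ball hr'1))
  obtain ⟨δ1, hδ1, hδ⟩ := Metric.uniformContinuousOn_iff.1 huc (ε/2) (by linarith)
  set δ2 := min (min δ1 (ε / 4)) (min ((1 - r)/2) (1/2)) with hδ2
  have hδ2pos : 0 < δ2 := by
    rw [hδ2]; refine lt_min (lt_min hδ1 (by linarith)) (lt_min (by linarith) (by norm_num))
  have hδa : δ2 ≤ δ1 := (min_le_left _ _).trans (min_le_left _ _)
  have hδb : δ2 ≤ ε / 4 := (min_le_left _ _).trans (min_le_right _ _)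
  have hδc : δ2 ≤ (1 - r)/2 := (min_le_right _ _).trans (min_le_left _ _)
  have hδd : δ2 ≤ 1/2 := (min_le_right _ _).trans (min_le_right _ _)
  obtain ⟨s, ⟨hrs, hs1⟩, hes⟩ : ∃ s, s ∈ Ioo r 1 ∧
      (1 / s - 1) + (1 / s - s) * (1 + r / s) / (1 - r / s) < δ2 := by
    have hc : ContinuousAt (fun s : ℝ => (1 / s - 1) + (1 / s - s) * (1 + r / s) / (1 - r / s)) 1 := by
      have h1 : (1:ℝ) ≠ 0 := one_ne_zero
      have h2 : 1 - r / (1:ℝ) ≠ 0 := by rw [div_one]; linarith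
      fun_prop (disch := assumption)
    have h0 : (1 / (1:ℝ) - 1) + (1 / (1:ℝ) - 1) * (1 + r / 1) / (1 - r / 1) = 0 := by norm_num
    have hev : ∀ᶠ s in 𝓝[<] (1:ℝ),
        (1 / s - 1) + (1 / s - s) * (1 + r / s) / (1 - r / s) < δ2 :=
      nhdsWithin_le_nhds (hc.eventually_lt_const (lt_of_eq_of_lt h0 hδ2pos))
    obtain ⟨s, h1, h2⟩ := (hev.and (Ioo_mem_nhdsLT hr)).exists
    exact ⟨s, h2, h1⟩
  have hs : 0 < s := by linarith
  refine ⟨s, hrs, hs1, ?_⟩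
  intro U1 G1 h1 hsub1 hsub2 z hz
  obtain ⟨κ, hκd, hκ0, hκ1, hκb, hκq, hκe, hκ'⟩ := h1.kap h2 hs hs1 hsub1
  obtain ⟨μ, hμd, hμ0, -, -, hμq, -, hμ'⟩ := h2.kap h1 hs hs1 hsub2
  set q := dslope κ 0 with hq
  have hqd : DifferentiableOn ℂ q (ball 0 s) :=
    (Complex.differentiableOn_dslope (ball_mem_nhds (0:ℂ) hs)).2 hκd
  have hq0 : q 0 = Complex.exp (G2 0 - G1 0) := by rw [hq, dslope_same, hκ']
  set a := (G2 0).re - (G1 0).re with ha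
  have hreal : G2 0 - G1 0 = (a : ℂ) := by
    apply Complex.ext <;> simp [h1.im0, h2.im0, ha]
  have hq0' : q 0 = (Real.exp a : ℂ) := by rw [hq0, hreal, Complex.ofReal_exp]
  have has : s ≤ Real.exp a := by
    have := hμq 0 (by simpa using hs)
    rw [dslope_same, hμ', Complex.norm_exp] at this
    have h3 : (G1 0 - G2 0).re = -a := by simp [ha]
    rw [h3, Real.exp_neg, ← one_div, one_div_le_one_div (Real.exp_pos _) hs] at this
    exact this
  have hsc : MapsTo (fun w => (s:ℂ) * w) (ball 0 1) (ball (0:ℂ) s) := by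
    intro w hw
    have : ‖w‖ < 1 := by simpa using hw
    simp only [mem_ball_zero_iff, norm_mul, Complex.norm_real, Real.norm_of_nonneg hs.le]
    nlinarith
  have hsC : (s:ℂ) ≠ 0 := by exact_mod_cast hs.ne'
  have hq1 : ∀ z : ℂ, ‖z‖ ≤ r → ‖q z - 1‖ < δ2 := by
    intro z hz
    have hzs : ‖z / s‖ = ‖z‖ / s := by
      rw [norm_div, Complex.norm_real, Real.norm_of_nonneg hs.le]
    have hzs1 : ‖z / s‖ ≤ r / s := by rw [hzs]; gcongr
    have hrs1 : r / s < 1 := by rw [div_lt_one hs]; exact hrs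
    have hh := (harnack (u := fun w => ((1 / s : ℝ) : ℂ) - q (s * w)) (m := 1 / s - Real.exp a)
      ((hqd.comp (by fun_prop) hsc).const_sub _) (by simp [hq0'])
      (fun w hw => by
        have h3 := (Complex.re_le_norm (q (s * w))).trans (hκq _ (hsc hw))
        simp only [Complex.sub_re, Complex.ofReal_re]
        linarith) (lt_of_le_of_lt hzs1 hrs1)).1
    have hmul : (s:ℂ) * (z / s) = z := by field_simp
    simp only [hmul] at hh
    have h4 : ‖((1 / s : ℝ) : ℂ) - q z‖ ≤ (1 / s - s) * (1 + r / s) / (1 - r / s) := by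
      refine hh.trans ?_
      have h5 := norm_nonneg (z / s)
      have h6 : 0 ≤ 1 / s - Real.exp a := by
        have := hκq 0 (by simpa using hs)
        rw [hq0', Complex.norm_real, Real.norm_of_nonneg (Real.exp_pos _).le] at this
        linarith
      rw [div_le_div_iff₀ (by linarith) (by linarith)]
      apply mul_le_mul _ (by linarith) (by linarith) _
      · apply mul_le_mul (by linarith) (by linarith) (by linarith) (by linarith)
      · apply mul_nonneg (by linarith) (by linarith)
    have h7 : ‖(1:ℂ) - ((1 / s : ℝ) : ℂ)‖ = 1 / s - 1 := by
      rw [← Complex.ofReal_one, ← Complex.ofReal_sub, Complex.norm_real, Real.norm_eq_abs, abs_sub_comm,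
        abs_of_nonneg]
      rw [sub_nonneg, le_div_iff₀ hs]; linarith
    calc ‖q z - 1‖ = ‖((1:ℂ) - ((1 / s : ℝ) : ℂ)) + (((1 / s : ℝ) : ℂ) - q z)‖ := by
          rw [norm_sub_rev]; congr 1; ring
      _ ≤ (1 / s - 1) + (1 / s - s) * (1 + r / s) / (1 - r / s) := by
          refine (norm_add_le _ _).trans ?_
          rw [h7]; gcongr
      _ < δ2 := hes
  have hrb : ∀ z : ℂ, ‖z‖ ≤ r → z ∈ ball (0:ℂ) s := fun z hz => by
    rw [mem_ball_zero_iff]; linarith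
  have hκz : ∀ z, κ z = z * q z := by
    intro z
    by_cases hz0 : z = 0
    · simp [hz0, hκ0]
    · rw [hq, dslope_of_ne _ hz0, slope_def_field, hκ0]; field_simp; ring
  have hqsl : ∀ z : ℂ, ‖z‖ ≤ r → q z ∈ Complex.slitPlane := by
    intro z hz
    left
    have h3 := (Complex.abs_re_le_norm (q z - 1)).trans_lt (hq1 z hz)
    rw [Complex.sub_re, Complex.one_re] at h3
    linarith [(abs_lt.1 h3).1]
  have hGc : ContinuousOn G1 (closedBall 0 r) :=
    h1.diff.continuousOn.mono (closedBall_subset_ball hr)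
  have hcb : closedBall (0:ℂ) r ⊆ ball 0 s := closedBall_subset_ball hrs
  have hrepr : ∀ z ∈ closedBall (0:ℂ) r, G1 z = G2 (κ z) - Complex.log (q z) := by
    apply log_unique (z0 := 0) (convex_closedBall (0:ℂ) r).isPreconnected hGc
    · refine ContinuousOn.sub ?_ ?_
      · exact h2.diff.continuousOn.comp (hκd.continuousOn.mono hcb) (fun z hz => by
          simpa using hκ1 z (hcb hz))
      · exact (hqd.continuousOn.mono hcb).clog (fun z hz => hqsl z (by simpa using hz))
    · intro z hz
      have hz' : ‖z‖ ≤ r := by simpa using hz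
      rw [Complex.exp_sub, Complex.exp_log (Complex.slitPlane_ne_zero (hqsl z hz'))]
      have hqne := Complex.slitPlane_ne_zero (hqsl z hz')
      by_cases hz0 : z = 0
      · subst hz0
        rw [hκ0, hq0, Complex.exp_sub]; field_simp
      · have h3 := hκe z (hcb hz)
        rw [Complex.exp_neg, Complex.exp_neg] at h3
        nth_rw 1 [hκz z] at h3
        have h4 := Complex.exp_ne_zero (G1 z)
        have h5 := Complex.exp_ne_zero (G2 (κ z))
        field_simp at h3 ⊢
        linear_combination h3
    · simpa using hr0.le
    · rw [hκ0, hq0', ← Complex.ofReal_log (Real.exp_pos _).le, Real.log_exp, ← hreal]; ring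
  rw [hrepr z (by simpa using hz)]
  have hd := hq1 z hz
  have hlog : ‖Complex.log (q z)‖ ≤ 3 / 2 * ‖q z - 1‖ := by
    have := Complex.norm_log_one_add_half_le_self (z := q z - 1) (by linarith)
    simpa using this
  have hκd : dist (κ z) z < δ1 := by
    rw [dist_eq_norm, hκz z]
    have : z * q z - z = z * (q z - 1) := by ring
    rw [this, norm_mul]
    nlinarith [norm_nonneg z, norm_nonneg (q z - 1)]
  have hκr : κ z ∈ closedBall (0:ℂ) r' := by
    rw [mem_closedBall_zero_iff]
    have h3 : ‖κ z‖ ≤ ‖z‖ + ‖z‖ * ‖q z - 1‖ := by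
      rw [← norm_mul]
      calc ‖κ z‖ = ‖z + z * (q z - 1)‖ := by rw [hκz z]; congr 1; ring
        _ ≤ _ := norm_add_le _ _
    rw [hr']
    nlinarith [norm_nonneg z, norm_nonneg (q z - 1)]
  have hzr : z ∈ closedBall (0:ℂ) r' := by
    rw [mem_closedBall_zero_iff, hr']; linarith
  have h5 := hδ _ hκr _ hzr hκd
  rw [dist_eq_norm] at h5
  calc ‖G2 (κ z) - Complex.log (q z) - G2 z‖ = ‖(G2 (κ z) - G2 z) - Complex.log (q z)‖ := by
        congr 1; ring
    _ ≤ ‖G2 (κ z) - G2 z‖ + ‖Complex.log (q z)‖ := norm_sub_le _ _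
    _ < ε / 2 + 3 / 2 * (ε / 4) := by
        have : ‖q z - 1‖ < ε / 4 := by linarith
        linarith
    _ < ε := by linarith


theorem Rie.phi_diff {U : Set ℂ} {G : ℂ → ℂ} (h : Rie U G) :
    DifferentiableOn ℂ (fun z => Complex.exp (G z) / z) (ball 0 1 \ {0}) :=
  (h.diff.mono sdiff_subset).cexp.div differentiableOn_id (fun _ hz => hz.2)

theorem Rie.compact_pre {U : Set ℂ} {G : ℂ → ℂ} (h : Rie U G) {Q : Set ℂ} (hQ : IsCompact Q)
    (hQU : Q ⊆ U) : ∃ ρ : ℝ, 0 < ρ ∧ ρ < 1 ∧ ∀ z : ℂ, ‖z‖ < 1 → z ≠ 0 → Complex.exp (G z) / z ∈ Q →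
      ‖z‖ ≤ ρ := by
  obtain ⟨hFo, hkd, -⟩ := univ_inv (isOpen_ball.sdiff isClosed_singleton) h.phi_diff h.inj
  rw [h.img] at hkd
  set iv := Function.invFunOn (fun z => Complex.exp (G z) / z) (ball 0 1 \ {0}) with hiv
  rcases Q.eq_empty_or_nonempty with rfl | hne
  · exact ⟨1/2, by norm_num, by norm_num, fun z _ _ h => absurd h (notMem_empty _)⟩
  obtain ⟨q, hq, hmax⟩ := hQ.exists_isMaxOn hne ((hkd.continuousOn.mono hQU).norm)
  have hmem : ∀ q ∈ U, iv q ∈ ball (0:ℂ) 1 \ {0} := fun q hq => by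
    apply Function.invFunOn_mem
    rw [← h.img] at hq
    exact hq
  refine ⟨‖iv q‖, ?_, ?_, ?_⟩
  · exact norm_pos_iff.2 (hmem q (hQU hq)).2
  · simpa using (hmem q (hQU hq)).1
  · intro z hz hz0 hzQ
    have := hmax hzQ
    simp only [mem_ofPred_eq] at this
    have h2 : iv (Complex.exp (G z) / z) = z :=
      h.inj.leftInvOn_invFunOn (show z ∈ ball (0:ℂ) 1 \ {0} from ⟨by simpa using hz, hz0⟩)
    rwa [h2] at this

theorem conn_of_rie {K : Set ℂ} {G : ℂ → ℂ} (hK : IsCompact K) (hKb : ∀ z ∈ K, ‖z‖ ≤ 1)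
    (h : Rie (unbddComp K) G)
    (hfr : K ⊆ closure (unbddComp K)) : IsPreconnected K := by
  rw [isPreconnected_closed_iff]
  intro t t' ht ht' hKt ⟨x, hxK, hxt⟩ ⟨y, hyK, hyt⟩
  by_contra hcon
  have hdisj : Disjoint (K ∩ t) (K ∩ t') := by
    rw [Set.disjoint_left]
    intro u hu hu'
    exact hcon ⟨u, hu.1, hu.2, hu'.2⟩
  obtain ⟨O1, O2, hO1, hO2, hs1, hs2, hOd⟩ :=
    SeparatedNhds.of_isCompact_isCompact (hK.inter_right ht) (hK.inter_right ht') hdisj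
  have hKO : K ⊆ O1 ∪ O2 := fun u hu => (hKt hu).elim (fun h => Or.inl (hs1 ⟨hu, h⟩))
    (fun h => Or.inr (hs2 ⟨hu, h⟩))
  set Q := (closedBall (0:ℂ) 2 ∩ closure (unbddComp K)) ∩ (O1 ∪ O2)ᶜ with hQ
  have hQc : IsCompact Q := ((isCompact_closedBall (0:ℂ) 2).inter_right isClosed_closure).inter_right
    (hO1.union hO2).isClosed_compl
  have hQU : Q ⊆ unbddComp K := by
    intro q hq
    rcases closure_unbddComp hK hq.1.2 with h1 | h1
    · exact h1
    · exact absurd (hKO h1) hq.2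
  obtain ⟨ρ, hρ0, hρ1, hρ⟩ := h.compact_pre hQc hQU
  set r := max ρ (1/2) with hr
  have hr1 : r < 1 := max_lt hρ1 (by norm_num)
  have hr0 : 0 < r := lt_max_of_lt_left hρ0
  have hrh : 1/2 ≤ r := le_max_right _ _
  have hann : ∀ z : ℂ, r < ‖z‖ → ‖z‖ < 1 → Complex.exp (G z) / z ∈ O1 ∪ O2 := by
    intro z hz hz1
    have hz0 : z ≠ 0 := norm_pos_iff.1 (by linarith)
    by_contra hc
    have hU := h.mem hz1 hz0
    have := hρ z hz1 hz0 ⟨⟨?_, subset_closure hU⟩, hc⟩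
    · linarith [le_max_left ρ (1/2)]
    · rw [mem_closedBall_zero_iff, norm_div, Complex.norm_exp, div_le_iff₀ (by linarith)]
      have := Real.exp_le_one_iff.2 (h.re z (by simpa using hz1))
      linarith
  set S : Set ℂ := {w : ℂ | 0 < w.re} ∩ {w : ℂ | w.re < -Real.log r} with hS
  have hSc : IsPreconnected S :=
    ((convex_halfSpace_re_gt 0).inter (convex_halfSpace_re_lt _)).isPreconnected
  set P : Set ℂ := (fun w => Complex.exp (G (Complex.exp (-w))) / Complex.exp (-w)) '' S with hP
  have hSn : ∀ w ∈ S, r < ‖Complex.exp (-w)‖ ∧ ‖Complex.exp (-w)‖ < 1 := by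
    intro w ⟨h1, h2⟩
    simp only [mem_ofPred_eq] at h1 h2
    rw [Complex.norm_exp, Complex.neg_re]
    constructor
    · rw [← Real.exp_log hr0]
      exact Real.exp_lt_exp.2 (by linarith)
    · rw [← Real.exp_zero]
      exact Real.exp_lt_exp.2 (by linarith)
  have hPc : IsPreconnected P := by
    apply hSc.image
    refine h.phi_diff.continuousOn.comp (f := fun w => Complex.exp (-w)) (by fun_prop) ?_
    intro w hw
    exact ⟨by simpa using (hSn w hw).2, Complex.exp_ne_zero _⟩
  have hPO : P ⊆ O1 ∪ O2 := by
    rintro _ ⟨w, hw, rfl⟩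
    exact hann _ (hSn w hw).1 (hSn w hw).2
  obtain ⟨δ, hδ, hδb⟩ := Rie.dist_bound (M := -(G 0).re) hr0 hr1
  have hmeet : ∀ p ∈ K, ∀ O : Set ℂ, IsOpen O → p ∈ O → (P ∩ O).Nonempty := by
    intro p hp O hO hpO
    have hpU : p ∉ unbddComp K := fun hh => hh.1 hp
    obtain ⟨u, ⟨huO, hub⟩, huU⟩ := mem_closure_iff.1 (hfr hp) (O ∩ ball p δ) (hO.inter isOpen_ball)
      ⟨hpO, mem_ball_self hδ⟩
    obtain ⟨z, hz1, hz0, rfl⟩ := h.exists_pre huU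
    have hrz : r < ‖z‖ := by
      by_contra hc
      have := hδb _ G h le_rfl p hpU (hKb p hp) z hz0 (not_lt.1 hc)
      rw [mem_ball, dist_eq_norm] at hub
      linarith
    refine ⟨_, ⟨-Complex.log z, ⟨?_, ?_⟩, rfl⟩, ?_⟩
    · simp only [mem_ofPred_eq, Complex.neg_re, Complex.log_re]
      linarith [Real.log_neg (norm_pos_iff.2 hz0) hz1]
    · simp only [mem_ofPred_eq, Complex.neg_re, Complex.log_re]
      linarith [Real.log_lt_log hr0 hrz]
    · simp only [neg_neg, Complex.exp_log hz0]; exact huO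
  obtain ⟨u, -, hu1, hu2⟩ := hPc O1 O2 hO1 hO2 hPO (hmeet x hxK O1 hO1 (hs1 ⟨hxK, hxt⟩))
    (hmeet y hyK O2 hO2 (hs2 ⟨hyK, hyt⟩))
  exact Set.disjoint_left.1 hOd hu1 hu2

/-- the family setting -/
structure Fam (K : Set ℂ) (h : ℂ → ℝ → ℂ) (G : ℝ → ℂ → ℂ) : Prop where
  cpt : IsCompact K
  conn : IsPreconnected K
  zero : (0:ℂ) ∈ K
  nt : ∃ x ∈ K, x ≠ 0
  fr : K ⊆ closure (unbddComp K)
  cont : ContinuousOn (fun p : ℂ × ℝ => h p.1 p.2) (K ×ˢ Icc 0 1)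
  inj : ∀ t ∈ Icc (0:ℝ) 1, InjOn (fun z => h z t) K
  hid : ∀ z ∈ K, h z 0 = z
  fix : ∀ t ∈ Icc (0:ℝ) 1, h 0 t = 0
  bd : ∀ t ∈ Icc (0:ℝ) 1, ∀ z ∈ K, ‖h z t‖ < 1
  rie : ∀ t ∈ Icc (0:ℝ) 1, Rie (unbddComp ((fun z => h z t) '' K)) (G t)

namespace Fam
variable {K : Set ℂ} {h : ℂ → ℝ → ℂ} {G : ℝ → ℂ → ℂ}

theorem ht (F : Fam K h G) {t : ℝ} (ht : t ∈ Icc (0:ℝ) 1) : ContinuousOn (fun z => h z t) K :=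
  F.cont.comp (f := fun z => (z, t)) (by fun_prop) (fun z hz => ⟨hz, ht⟩)

theorem cptK (F : Fam K h G) {t : ℝ} (ht : t ∈ Icc (0:ℝ) 1) : IsCompact ((fun z => h z t) '' K) :=
  F.cpt.image_of_continuousOn (F.ht ht)

theorem ne0 (F : Fam K h G) {t : ℝ} (ht : t ∈ Icc (0:ℝ) 1) {x : ℂ} (hx : x ∈ K) (hx0 : x ≠ 0) :
    h x t ≠ 0 := fun hc => hx0 (F.inj t ht hx F.zero (by simp [hc, F.fix t ht]))

theorem exM (F : Fam K h G) : ∃ M : ℝ, 0 ≤ M ∧ ∀ t ∈ Icc (0:ℝ) 1, -(G t 0).re ≤ M := by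
  obtain ⟨x, hx, hx0⟩ := F.nt
  have hc : ContinuousOn (fun t => ‖h x t‖) (Icc 0 1) :=
    (F.cont.comp (f := fun t => (x, t)) (by fun_prop) (fun t ht => ⟨hx, ht⟩)).norm
  obtain ⟨t1, ht1, hmin⟩ := (isCompact_Icc (a := (0:ℝ)) (b := 1)).exists_isMinOn ⟨0, by simp⟩ hc
  have hd : 0 < ‖h x t1‖ := norm_pos_iff.2 (F.ne0 ht1 hx hx0)
  have hb : ∀ t ∈ Icc (0:ℝ) 1, -(G t 0).re ≤ 3 * Real.log (4 / ‖h x t1‖) := by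
    intro t ht
    exact (F.rie t ht).m_bound (p := h x t) (fun hh => hh.1 ⟨x, hx, rfl⟩) hd (hmin ht)
  exact ⟨_, ((F.rie 0 (by simp)).m_nonneg).trans (hb 0 (by simp)), hb⟩

theorem distb (F : Fam K h G) {s : ℝ} (hs : 0 < s) (hs1 : s < 1) : ∃ δ : ℝ, 0 < δ ∧
    ∀ t ∈ Icc (0:ℝ) 1, ∀ x ∈ K, ∀ z : ℂ, z ≠ 0 → ‖z‖ ≤ s →
      δ ≤ ‖Complex.exp (G t z) / z - h x t‖ := by
  obtain ⟨M, -, hM⟩ := F.exM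
  obtain ⟨δ, hδ, hb⟩ := Rie.dist_bound (M := M) hs hs1
  refine ⟨δ, hδ, fun t ht x hx z hz0 hz => ?_⟩
  exact hb _ _ (F.rie t ht) (hM t ht) _ (fun hh => hh.1 ⟨x, hx, rfl⟩) (F.bd t ht x hx).le z hz0 hz

theorem unif (F : Fam K h G) {ε : ℝ} (hε : 0 < ε) : ∃ τ : ℝ, 0 < τ ∧ ∀ t ∈ Icc (0:ℝ) 1,
    ∀ t' ∈ Icc (0:ℝ) 1, |t - t'| < τ → ∀ x ∈ K, ‖h x t - h x t'‖ < ε := by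
  have huc := (F.cpt.prod (isCompact_Icc (a := (0:ℝ)) (b := 1))).uniformContinuousOn_of_continuous
    F.cont
  obtain ⟨τ, hτ, hb⟩ := Metric.uniformContinuousOn_iff.1 huc ε hε
  refine ⟨τ, hτ, fun t ht t' ht' htt x hx => ?_⟩
  have := hb (x, t) ⟨hx, ht⟩ (x, t') ⟨hx, ht'⟩ (by
    rw [Prod.dist_eq]; simpa [Real.dist_eq] using htt)
  simpa [dist_eq_norm] using this

theorem stay (F : Fam K h G) {s : ℝ} (hs : 0 < s) (hs1 : s < 1) : ∃ τ : ℝ, 0 < τ ∧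
    ∀ t ∈ Icc (0:ℝ) 1, ∀ t' ∈ Icc (0:ℝ) 1, |t - t'| < τ → ∀ z : ℂ, z ≠ 0 → ‖z‖ ≤ s →
      Complex.exp (G t z) / z ∈ unbddComp ((fun z => h z t') '' K) := by
  obtain ⟨δ, hδ, hb⟩ := F.distb hs hs1
  obtain ⟨τ, hτ, hu⟩ := F.unif hδ
  refine ⟨τ, hτ, fun t ht t' ht' htt z hz0 hz => ?_⟩
  refine bor F.cpt (F.ht ht) (F.ht ht') (F.inj t' ht') (fun x hx => ?_)
    ((F.rie t ht).mem (lt_of_le_of_lt hz hs1) hz0)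
  rw [norm_sub_rev (h x t) (Complex.exp _ / _)]
  exact (hu t ht t' ht' htt x hx).trans_le (hb t ht x hx z hz0 hz)

theorem conv (F : Fam K h G) {t0 : ℝ} (ht0 : t0 ∈ Icc (0:ℝ) 1) {r ε : ℝ} (hr0 : 0 < r) (hr : r < 1)
    (hε : 0 < ε) : ∃ τ : ℝ, 0 < τ ∧ ∀ t ∈ Icc (0:ℝ) 1, |t - t0| < τ → ∀ z : ℂ, ‖z‖ ≤ r →
      ‖G t z - G t0 z‖ < ε := by
  obtain ⟨s, hrs, hs1, hb⟩ := (F.rie t0 ht0).conv_one hr0 hr hε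
  obtain ⟨τ, hτ, hst⟩ := F.stay (hr0.trans hrs) hs1
  refine ⟨τ, hτ, fun t ht htt => hb _ _ (F.rie t ht) ?_ ?_⟩
  · exact fun z hz0 hz => hst t ht t0 ht0 htt z hz0 hz.le
  · exact fun z hz0 hz => hst t0 ht0 t ht (by rwa [abs_sub_comm]) z hz0 hz.le

theorem jcont (F : Fam K h G) :
    ContinuousOn (fun p : ℝ × ℂ => G p.1 p.2) (Icc (0:ℝ) 1 ×ˢ ball (0:ℂ) 1) := by
  rintro ⟨t0, z0⟩ ⟨ht0, hz0⟩
  have hz0' : ‖z0‖ < 1 := by simpa using hz0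
  set r := (1 + ‖z0‖) / 2 with hr
  have hr1 : r < 1 := by rw [hr]; linarith
  have hr0 : 0 < r := by rw [hr]; linarith [norm_nonneg z0]
  have hzr : ‖z0‖ < r := by rw [hr]; linarith
  rw [Metric.continuousWithinAt_iff']
  intro ε hε
  obtain ⟨τ, hτ, hb⟩ := F.conv ht0 hr0 hr1 (half_pos hε)
  have hcz : ContinuousAt (G t0) z0 :=
    ((F.rie t0 ht0).diff.differentiableAt (isOpen_ball.mem_nhds hz0)).continuousAt
  have h1 : ∀ᶠ p : ℝ × ℂ in 𝓝[Icc (0:ℝ) 1 ×ˢ ball (0:ℂ) 1] (t0, z0),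
      |p.1 - t0| < τ ∧ ‖p.2‖ < r ∧ dist (G t0 p.2) (G t0 z0) < ε / 2 := by
    apply nhdsWithin_le_nhds
    have ha : ∀ᶠ p : ℝ × ℂ in 𝓝 (t0, z0), |p.1 - t0| < τ := by
      have : ContinuousAt (fun p : ℝ × ℂ => |p.1 - t0|) (t0, z0) := by fun_prop
      exact this.eventually_lt_const (by simpa using hτ)
    have hb' : ∀ᶠ p : ℝ × ℂ in 𝓝 (t0, z0), ‖p.2‖ < r := by
      have : ContinuousAt (fun p : ℝ × ℂ => ‖p.2‖) (t0, z0) := by fun_prop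
      exact this.eventually_lt_const (by simpa using hzr)
    have hc : ∀ᶠ p : ℝ × ℂ in 𝓝 (t0, z0), dist (G t0 p.2) (G t0 z0) < ε / 2 := by
      have : ContinuousAt (fun p : ℝ × ℂ => G t0 p.2) (t0, z0) :=
        ContinuousAt.comp (g := G t0) (f := Prod.snd) hcz continuousAt_snd
      exact (Metric.continuousAt_iff'.1 this) _ (half_pos hε)
    exact ha.and (hb'.and hc)
  filter_upwards [h1, self_mem_nhdsWithin] with p ⟨h1, h2, h3⟩ hp
  have h4 := hb p.1 hp.1 h1 p.2 h2.le
  calc dist (G p.1 p.2) (G t0 z0) ≤ dist (G p.1 p.2) (G t0 p.2) + dist (G t0 p.2) (G t0 z0) :=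
        dist_triangle _ _ _
    _ < ε := by rw [dist_eq_norm (G p.1 p.2)]; linarith

end Fam

theorem unbdd_frontier {X : Set ℂ} (hXc : IsCompact X) (hX : IsConnected Xᶜ) :
    unbddComp (frontier X) = Xᶜ := by
  have hfs : frontier X ⊆ X := hXc.isClosed.frontier_subset
  ext p
  constructor
  · rintro ⟨hp, hu⟩ hpX
    apply hu
    apply hXc.isBounded.subset
    intro q hq
    by_contra hqX
    have hpre : IsPreconnected (connectedComponentIn (frontier X)ᶜ p) :=
      isPreconnected_connectedComponentIn
    have hcov : connectedComponentIn (frontier X)ᶜ p ⊆ interior X ∪ Xᶜ := by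
      intro u hu
      have h1 := connectedComponentIn_subset _ _ hu
      by_cases huX : u ∈ X
      · left
        by_contra hui
        exact h1 ⟨subset_closure huX, hui⟩
      · exact Or.inr huX
    have hpm := mem_connectedComponentIn hp
    obtain ⟨u, -, hu1, hu2⟩ := hpre (interior X) Xᶜ isOpen_interior hXc.isClosed.isOpen_compl hcov
      ⟨p, hpm, (hcov hpm).resolve_right (fun hh => hh hpX)⟩ ⟨q, hq, hqX⟩
    exact hu2 (interior_subset hu1)
  · intro hp
    refine ⟨fun hh => hp (hfs hh), fun hb => ?_⟩
    have hsub : Xᶜ ⊆ connectedComponentIn (frontier X)ᶜ p :=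
      hX.isPreconnected.subset_connectedComponentIn hp (compl_subset_compl.2 hfs)
    have h1 : Bornology.IsBounded (univ : Set ℂ) := by
      rw [← union_compl_self X]; exact hXc.isBounded.union (hb.subset hsub)
    exact NormedSpace.unbounded_univ ℝ ℂ h1


/-- logarithmic Riemann map -/
noncomputable def psi (G : ℂ → ℂ) (w : ℂ) : ℂ := w + G (Complex.exp (-w))

theorem exp_neg_ball {w : ℂ} (hw : 0 < w.re) : Complex.exp (-w) ∈ ball (0:ℂ) 1 \ {0} := by
  refine ⟨?_, Complex.exp_ne_zero _⟩
  rw [mem_ball_zero_iff, Complex.norm_exp, Complex.neg_re, ← Real.exp_zero]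
  exact Real.exp_lt_exp.2 (by linarith)

section
variable {U : Set ℂ} {G : ℂ → ℂ}

theorem psi_exp (G : ℂ → ℂ) (w : ℂ) :
    Complex.exp (psi G w) = Complex.exp (G (Complex.exp (-w))) / Complex.exp (-w) := by
  rw [psi, Complex.exp_add, Complex.exp_neg, div_inv_eq_mul, mul_comm]

theorem psi_per (G : ℂ → ℂ) (w : ℂ) (n : ℤ) :
    psi G (w + n * (2 * Real.pi * Complex.I)) = psi G w + n * (2 * Real.pi * Complex.I) := by
  have : Complex.exp (-(w + n * (2 * Real.pi * Complex.I))) = Complex.exp (-w) := by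
    rw [Complex.exp_eq_exp_iff_exists_int]
    exact ⟨-n, by push_cast; ring⟩
  rw [psi, psi, this]; ring

theorem psi_inj (h : Rie U G) {w w' : ℂ} (hw : 0 < w.re) (hw' : 0 < w'.re)
    (he : psi G w = psi G w') : w = w' := by
  have h1 := congrArg Complex.exp he
  rw [psi_exp, psi_exp] at h1
  have h2 := h.inj (exp_neg_ball hw) (exp_neg_ball hw') h1
  rw [psi, psi, h2] at he
  exact add_right_cancel he

theorem psi_mem (h : Rie U G) {w : ℂ} (hw : 0 < w.re) : Complex.exp (psi G w) ∈ U := by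
  rw [psi_exp]
  exact h.mem (by simpa using (exp_neg_ball hw).1) (exp_neg_ball hw).2

theorem psi_surj (h : Rie U G) {a : ℂ} (ha : Complex.exp a ∈ U) : ∃ w : ℂ, 0 < w.re ∧ psi G w = a := by
  obtain ⟨z, hz, hz0, hza⟩ := h.exists_pre ha
  have h1 : Complex.exp (psi G (-Complex.log z)) = Complex.exp a := by
    rw [psi_exp, neg_neg, Complex.exp_log hz0, hza]
  obtain ⟨n, hn⟩ := Complex.exp_eq_exp_iff_exists_int.1 h1.symm
  refine ⟨-Complex.log z + n * (2 * Real.pi * Complex.I), ?_, ?_⟩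
  · have : (n * (2 * Real.pi * Complex.I) : ℂ).re = 0 := by simp
    rw [Complex.add_re, this, Complex.neg_re, Complex.log_re]
    linarith [Real.log_neg (norm_pos_iff.2 hz0) hz]
  · rw [psi_per, hn]

theorem isOpen_rh : IsOpen {w : ℂ | 0 < w.re} := isOpen_lt continuous_const Complex.continuous_re

theorem psi_diff (h : Rie U G) : DifferentiableOn ℂ (psi G) {w : ℂ | 0 < w.re} := by
  have := h.diff.comp (f := fun w : ℂ => Complex.exp (-w)) (s := {w : ℂ | 0 < w.re})
    (by fun_prop) (fun w hw => (exp_neg_ball hw).1)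
  exact differentiableOn_id.add this

theorem psi_re_le (h : Rie U G) {w : ℂ} (hw : 0 < w.re) : (psi G w).re ≤ w.re := by
  have := h.re _ (exp_neg_ball hw).1
  rw [psi, Complex.add_re]; linarith

/-- along shifts, `psi` is asymptotic to a real translation. -/
theorem psi_shift (h : Rie U G) (w : ℂ) :
    Tendsto (fun r : ℝ => psi G (w + r) - (w + r)) atTop (𝓝 (G 0)) := by
  have h1 : ContinuousAt G 0 :=
    (h.diff.differentiableAt (ball_mem_nhds (0:ℂ) one_pos)).continuousAt
  have h2 : Tendsto (fun r : ℝ => Complex.exp (-(w + r))) atTop (𝓝 0) := by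
    rw [tendsto_zero_iff_norm_tendsto_zero]
    have : ∀ r : ℝ, ‖Complex.exp (-(w + r))‖ = Real.exp (-(w.re + r)) := fun r => by
      rw [Complex.norm_exp]; simp
    simp only [this]
    apply Real.tendsto_exp_neg_atTop_nhds_zero.comp
    exact tendsto_atTop_add_const_left _ _ tendsto_id
  have := h1.tendsto.comp h2
  refine this.congr (fun r => ?_)
  simp [psi]

/-- `ζ` is off the ray through `w`. -/
def OffR (G : ℂ → ℂ) (p : ℂ × ℂ) : Prop := 0 < p.2.re ∧ ∀ r : ℝ, 0 ≤ r → psi G (p.2 + r) ≠ p.1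

/-- characterization of the branch of `log (ψ w - ζ)`. -/
structure IsJ (G : ℂ → ℂ) (J : ℂ → ℂ → ℂ) : Prop where
  cont : ContinuousOn (fun p : ℂ × ℂ => J p.1 p.2) {p | OffR G p}
  exp : ∀ ζ w, OffR G (ζ, w) → Complex.exp (J ζ w) = psi G w - ζ
  lim : ∀ ζ w, OffR G (ζ, w) → Tendsto (fun r : ℝ => (J ζ (w + r)).im) atTop (𝓝 0)

theorem OffR.shift {ζ w : ℂ} (h : OffR G (ζ, w)) {r : ℝ} (hr : 0 ≤ r) : OffR G (ζ, w + r) := by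
  refine ⟨by have := h.1; simp only [Complex.add_re, Complex.ofReal_re] at *; linarith, fun s hs => ?_⟩
  have := h.2 (r + s) (by linarith)
  simpa [add_assoc] using this

theorem exists_J (h : Rie U G) : ∃ J, IsJ G J := by
  set E : ℝ → ℝ := fun s => Real.exp 1 * expNegInvGlue s with hE
  have hEc : Continuous E := by
    have : Continuous expNegInvGlue := expNegInvGlue.contDiff (n := 0) |>.continuous
    fun_prop
  have hE1 : ∀ s ∈ Icc (0:ℝ) 1, 0 ≤ E s ∧ E s ≤ 1 := by
    intro s hs
    refine ⟨mul_nonneg (Real.exp_pos _).le (expNegInvGlue.nonneg s), ?_⟩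
    rcases hs.1.eq_or_lt with h0 | h0
    · rw [hE, ← h0]; simp [expNegInvGlue]
    · rw [hE]
      simp only [expNegInvGlue, not_le.2 h0, if_false]
      rw [← Real.exp_add, Real.exp_le_one_iff]
      have : 1 ≤ s⁻¹ := (one_le_inv₀ h0).2 hs.2
      linarith
  have hEs : ∀ s : ℝ, 0 < s → E s = Real.exp (-(1 / s - 1)) := by
    intro s hs
    rw [hE]
    simp only [expNegInvGlue, not_le.2 hs, if_false]
    rw [← Real.exp_add]; congr 1; rw [one_div]; ring
  have hE0 : E 0 = 0 := by rw [hE]; simp [expNegInvGlue]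
  let f : ℂ × ℂ → ℝ → ℂ := fun p s => 1 + s * (p.2 - 1 + G (Complex.exp (-p.2) * E s) - p.1)
  have hfpos : ∀ p : ℂ × ℂ, ∀ s : ℝ, 0 < s → f p s = s * (psi G (p.2 + ((1 / s - 1 : ℝ) : ℂ)) - p.1) := by
    intro p s hs
    have hsC : (s:ℂ) ≠ 0 := by exact_mod_cast hs.ne'
    have : Complex.exp (-(p.2 + ((1 / s - 1 : ℝ) : ℂ))) = Complex.exp (-p.2) * E s := by
      rw [hEs s hs, neg_add, Complex.exp_add, Complex.ofReal_exp]; push_cast; rfl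
    simp only [f, psi, this]
    push_cast
    field_simp
    ring
  set S : Set (ℂ × ℂ) := {p | OffR G p} with hS
  have hball : ∀ p ∈ S, ∀ s ∈ Icc (0:ℝ) 1, Complex.exp (-p.2) * E s ∈ ball (0:ℂ) 1 := by
    intro p hp s hs
    have h1 : ‖Complex.exp (-p.2)‖ < 1 := by simpa using (exp_neg_ball hp.1).1
    have h2 := hE1 s hs
    rw [mem_ball_zero_iff, norm_mul, Complex.norm_real, Real.norm_of_nonneg h2.1]
    nlinarith [norm_nonneg (Complex.exp (-p.2))]
  have hfc : ContinuousOn (fun q : (ℂ × ℂ) × ℝ => f q.1 q.2) (S ×ˢ Icc 0 1) := by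
    have hG : ContinuousOn (fun q : (ℂ × ℂ) × ℝ => G (Complex.exp (-q.1.2) * E q.2)) (S ×ˢ Icc 0 1) := by
      refine h.diff.continuousOn.comp ?_ (fun q hq => hball q.1 hq.1 q.2 hq.2)
      apply Continuous.continuousOn
      fun_prop
    have h1 : ContinuousOn (fun q : (ℂ × ℂ) × ℝ => (q.2 : ℂ)) (S ×ˢ Icc 0 1) :=
      (Complex.continuous_ofReal.comp continuous_snd).continuousOn
    have h2 : ContinuousOn (fun q : (ℂ × ℂ) × ℝ => q.1.2 - 1) (S ×ˢ Icc 0 1) :=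
      Continuous.continuousOn (by fun_prop)
    have h3 : ContinuousOn (fun q : (ℂ × ℂ) × ℝ => q.1.1) (S ×ˢ Icc 0 1) :=
      Continuous.continuousOn (by fun_prop)
    exact continuousOn_const.add (h1.mul ((h2.add hG).sub h3))
  have hne : ∀ p ∈ S, ∀ s ∈ Icc (0:ℝ) 1, f p s ≠ 0 := by
    intro p hp s hs
    rcases hs.1.eq_or_lt with h0 | h0
    · simp [f, ← h0]
    · rw [hfpos p s h0]
      refine mul_ne_zero (by exact_mod_cast h0.ne') (sub_ne_zero.2 (hp.2 _ ?_))
      rw [sub_nonneg, le_div_iff₀ h0]; linarith [hs.2]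
  obtain ⟨g, hgc, hge, hg0⟩ := hl_lift S f hfc hne (fun _ => 0) continuousOn_const
    (fun p _ => by simp [f])
  have h1m : (1:ℝ) ∈ Icc (0:ℝ) 1 := by simp
  have hJexp : ∀ p ∈ S, Complex.exp (g p 1) = psi G p.2 - p.1 := by
    intro p hp
    rw [hge p hp 1 h1m, hfpos p 1 one_pos]; simp
  have hJc : ContinuousOn (fun p : ℂ × ℂ => g p 1) S :=
    hgc.comp (f := fun p : ℂ × ℂ => (p, (1:ℝ))) (by fun_prop) (fun p hp => ⟨hp, h1m⟩)
  refine ⟨fun ζ w => g (ζ, w) 1, hJc, fun ζ w hp => hJexp (ζ, w) hp, ?_⟩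
  intro ζ w hp
  have hgs : ContinuousOn (fun s => g (ζ, w) s) (Icc 0 1) :=
    hgc.comp (f := fun s : ℝ => ((ζ, w), s)) (by fun_prop) (fun s hs => ⟨hp, hs⟩)
  have hsh : ∀ s ∈ Ioc (0:ℝ) 1, OffR G (ζ, w + ((1 / s - 1 : ℝ) : ℂ)) := by
    intro s hs
    apply hp.shift
    rw [sub_nonneg, le_div_iff₀ hs.1]; linarith [hs.2]
  have heq : ∀ s ∈ Ioc (0:ℝ) 1, g (ζ, w) s = g (ζ, w + ((1 / s - 1 : ℝ) : ℂ)) 1 + Real.log s := by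
    apply log_unique (z0 := 1) isPreconnected_Ioc (hgs.mono Ioc_subset_Icc_self)
    · refine ContinuousOn.add ?_ ?_
      · refine hJc.comp (f := fun s : ℝ => (ζ, w + ((1 / s - 1 : ℝ) : ℂ))) ?_ (fun s hs => hsh s hs)
        refine continuousOn_const.prodMk (continuousOn_const.add ?_)
        refine Complex.continuous_ofReal.comp_continuousOn ?_
        exact (continuousOn_const.div continuousOn_id (fun s hs => hs.1.ne')).sub continuousOn_const
      · exact Complex.continuous_ofReal.comp_continuousOn
          (Real.continuousOn_log.mono (fun s hs => hs.1.ne'))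
    · intro s hs
      rw [hge _ hp s ⟨hs.1.le, hs.2⟩, hfpos _ s hs.1, Complex.exp_add, hJexp _ (hsh s hs),
        ← Complex.ofReal_exp, Real.exp_log hs.1]
      ring
    · simp
    · simp
  have hlim : Tendsto (fun s => (g (ζ, w) s).im) (𝓝[>] 0) (𝓝 0) := by
    have h1 : ContinuousWithinAt (fun s => (g (ζ, w) s).im) (Icc 0 1) 0 :=
      Complex.continuous_im.continuousAt.comp_continuousWithinAt (hgs 0 (by simp))
    have h2 := h1.tendsto
    rw [hg0 _ hp] at h2
    refine h2.mono_left ?_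
    rw [← nhdsWithin_Ioc_eq_nhdsGT (zero_lt_one' ℝ)]
    exact nhdsWithin_mono _ Ioc_subset_Icc_self
  have hr : Tendsto (fun r : ℝ => (r + 1)⁻¹) atTop (𝓝[>] 0) :=
    tendsto_inv_atTop_nhdsGT_zero.comp (tendsto_atTop_add_const_right _ _ tendsto_id)
  refine (hlim.comp hr).congr' ?_
  filter_upwards [eventually_ge_atTop (0:ℝ)] with r hr0
  have hr1 : (r + 1)⁻¹ ∈ Ioc (0:ℝ) 1 := ⟨by positivity, inv_le_one_of_one_le₀ (by linarith)⟩
  have : (1 / (r + 1)⁻¹ - 1 : ℝ) = r := by simp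
  simp only [Function.comp_apply]
  rw [heq _ hr1, this, Complex.add_im, Complex.ofReal_im, add_zero]

/-- recognizing `J` along a ray. -/
theorem IsJ.eq_of {J : ℂ → ℂ → ℂ} (hJ : IsJ G J) {ζ w : ℂ} (hp : OffR G (ζ, w)) {L : ℝ → ℂ}
    (hL : ContinuousOn L (Ici 0)) (hLe : ∀ r : ℝ, 0 ≤ r → Complex.exp (L r) = psi G (w + r) - ζ)
    (hb : ∃ᶠ r in atTop, |(L r).im| < 3 * Real.pi / 2) : J ζ w = L 0 := by
  have hJc : ContinuousOn (fun r : ℝ => J ζ (w + r)) (Ici 0) :=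
    hJ.cont.comp (f := fun r : ℝ => (ζ, w + (r:ℂ))) (by fun_prop) (fun r hr => hp.shift hr)
  have hc := log_diff_const (z0 := (0:ℝ)) isPreconnected_Ici hJc hL (fun r hr => by
    rw [hLe r hr, hJ.exp _ _ (hp.shift hr)]) (by simp)
  have hev : ∀ᶠ r in atTop, |(J ζ (w + (r:ℝ))).im| < Real.pi / 2 := by
    have := (hJ.lim ζ w hp).abs
    rw [abs_zero] at this
    exact this.eventually_lt_const (by linarith [Real.pi_pos])
  obtain ⟨r, hr1, hr2, hr0⟩ := (hb.and_eventually (hev.and (eventually_ge_atTop (0:ℝ)))).exists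
  have h3 : J ζ (w + r) = L r := by
    apply exp_inj_close
    · rw [hLe r hr0, hJ.exp _ _ (hp.shift hr0)]
    · rw [abs_lt] at *; constructor <;> linarith [hr1.1, hr1.2, hr2.1, hr2.2]
  have h4 := hc r hr0
  simp only [Complex.ofReal_zero, add_zero] at h4
  rw [h3, sub_self] at h4
  exact (sub_eq_zero.1 h4.symm)

theorem psi_contr (h : Rie U G) {w : ℂ} (hw : 0 < w.re) :
    ContinuousOn (fun r : ℝ => psi G (w + r)) (Ici 0) :=
  (psi_diff h).continuousOn.comp (f := fun r : ℝ => w + (r:ℂ)) (by fun_prop) (fun r hr => by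
    have : (0:ℝ) ≤ r := hr
    show 0 < (w + (r:ℂ)).re
    simp only [Complex.add_re, Complex.ofReal_re]; linarith)

theorem IsJ.eq_log (h : Rie U G) {J : ℂ → ℂ → ℂ} (hJ : IsJ G J) {ζ w : ℂ} (hw : 0 < w.re)
    (hpos : ∀ r : ℝ, 0 ≤ r → psi G (w + r) - ζ ∈ Complex.slitPlane) :
    J ζ w = Complex.log (psi G w - ζ) := by
  have hp : OffR G (ζ, w) := ⟨hw, fun r hr he =>
    Complex.slitPlane_ne_zero (hpos r hr) (sub_eq_zero.2 he)⟩
  have := hJ.eq_of hp (L := fun r => Complex.log (psi G (w + r) - ζ))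
    (((psi_contr h hw).sub continuousOn_const).clog (fun r hr => hpos r hr))
    (fun r hr => Complex.exp_log (Complex.slitPlane_ne_zero (hpos r hr)))
    (Frequently.of_forall (fun r => by
      rw [Complex.log_im]
      have := Complex.abs_arg_le_pi (psi G (w + r) - ζ)
      linarith [Real.pi_pos]))
  simpa using this

theorem IsJ.im_lt (h : Rie U G) {J : ℂ → ℂ → ℂ} (hJ : IsJ G J) {ζ w : ℂ} (hw : 0 < w.re)
    (hpos : ∀ r : ℝ, 0 ≤ r → 0 < (psi G (w + r) - ζ).re) : |(J ζ w).im| < Real.pi / 2 := by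
  rw [hJ.eq_log h hw (fun r hr => Or.inl (hpos r hr)), Complex.log_im,
    Complex.abs_arg_lt_pi_div_two_iff]
  left
  simpa using hpos 0 le_rfl

theorem div_slit {u v : ℂ} (hv : v ≠ 0) (h : ∀ c : ℝ, 0 ≤ c → u ≠ -c * v) :
    u / v ∈ Complex.slitPlane := by
  by_contra hc
  rw [Complex.mem_slitPlane_iff] at hc
  push Not at hc
  refine h (-(u / v).re) (by linarith [hc.1]) ?_
  have : u / v = ((u / v).re : ℂ) := Complex.ext rfl (by simp [hc.2])
  push_cast
  rw [neg_neg, ← this]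
  field_simp

/-- changing `ζ` along a segment which avoids the ray. -/
theorem IsJ.ql (h : Rie U G) {J : ℂ → ℂ → ℂ} (hJ : IsJ G J) {ζ1 ζ2 w : ℂ} (hw : 0 < w.re)
    (hseg : ∀ r : ℝ, 0 ≤ r → psi G (w + r) ∉ segment ℝ ζ1 ζ2) :
    J ζ1 w = J ζ2 w + Complex.log ((psi G w - ζ1) / (psi G w - ζ2)) := by
  have hp1 : OffR G (ζ1, w) := ⟨hw, fun r hr he => hseg r hr (he ▸ left_mem_segment ℝ _ _)⟩
  have hp2 : OffR G (ζ2, w) := ⟨hw, fun r hr he => hseg r hr (he ▸ right_mem_segment ℝ _ _)⟩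
  have hne : ∀ r : ℝ, 0 ≤ r → psi G (w + r) - ζ2 ≠ 0 := fun r hr => sub_ne_zero.2 (hp2.2 r hr)
  have hsl : ∀ r : ℝ, 0 ≤ r →
      (psi G (w + r) - ζ1) / (psi G (w + r) - ζ2) ∈ Complex.slitPlane := by
    intro r hr
    apply div_slit (hne r hr)
    intro c hc he
    apply hseg r hr
    have hc1 : (0:ℝ) < 1 + c := by linarith
    refine ⟨1 / (1 + c), c / (1 + c), by positivity, by positivity, by field_simp, ?_⟩
    simp only [Complex.real_smul]
    have hc2 : (1 + c : ℂ) ≠ 0 := by exact_mod_cast hc1.ne'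
    push_cast
    field_simp
    linear_combination -he
  have hev : ∀ᶠ r in atTop, |(J ζ2 (w + (r:ℝ))).im| < Real.pi / 2 := by
    have := (hJ.lim ζ2 w hp2).abs
    rw [abs_zero] at this
    exact this.eventually_lt_const (by linarith [Real.pi_pos])
  have hJc : ContinuousOn (fun r : ℝ => J ζ2 (w + r)) (Ici 0) :=
    hJ.cont.comp (f := fun r : ℝ => (ζ2, w + (r:ℂ))) (by fun_prop) (fun r hr => hp2.shift hr)
  have := hJ.eq_of hp1 (L := fun r => J ζ2 (w + r) +
      Complex.log ((psi G (w + r) - ζ1) / (psi G (w + r) - ζ2)))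
    (hJc.add ((((psi_contr h hw).sub continuousOn_const).div
      ((psi_contr h hw).sub continuousOn_const) (fun r hr => hne r hr)).clog (fun r hr => hsl r hr)))
    (fun r hr => by
      rw [Complex.exp_add, Complex.exp_log (Complex.slitPlane_ne_zero (hsl r hr)),
        hJ.exp _ _ (hp2.shift hr)]
      have := hne r hr
      field_simp)
    (by
      apply Eventually.frequently
      filter_upwards [hev] with r hr
      rw [Complex.add_im, Complex.log_im]
      have h1 := Complex.abs_arg_le_pi ((psi G (w + r) - ζ1) / (psi G (w + r) - ζ2))
      exact (abs_add_le _ _).trans_lt (by linarith))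
  simpa using this

theorem offR_psi (h : Rie U G) {w w' : ℂ} (hw : 0 < w.re) (hw' : 0 < w'.re) (hne : w.im ≠ w'.im) :
    OffR G (psi G w', w) := by
  refine ⟨hw, fun r hr he => hne ?_⟩
  have := psi_inj h (by simp only [Complex.add_re, Complex.ofReal_re]; linarith) hw' he
  rw [← this]; simp

/-- interchanging two points. -/
theorem IsJ.swap (h : Rie U G) {J : ℂ → ℂ → ℂ} (hJ : IsJ G J) {w w' : ℂ} (hw : 0 < w.re)
    (hw' : 0 < w'.re) (hlt : w'.im < w.im) :
    J (psi G w') w = J (psi G w) w' + Real.pi * Complex.I := by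
  have hsw : ∀ r : ℝ, 0 ≤ r → 0 < (w + r).re := fun r hr => by
    simp only [Complex.add_re, Complex.ofReal_re]; linarith
  have hsw' : ∀ r : ℝ, 0 ≤ r → 0 < (w' + r).re := fun r hr => by
    simp only [Complex.add_re, Complex.ofReal_re]; linarith
  have ho1 : ∀ r : ℝ, 0 ≤ r → OffR G (psi G (w' + r), w + r) := fun r hr =>
    offR_psi h (hsw r hr) (hsw' r hr) (by simpa using hlt.ne')
  have ho2 : ∀ r : ℝ, 0 ≤ r → OffR G (psi G (w + r), w' + r) := fun r hr =>
    offR_psi h (hsw' r hr) (hsw r hr) (by simpa using hlt.ne)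
  have hc1 : ContinuousOn (fun r : ℝ => J (psi G (w' + r)) (w + r)) (Ici 0) :=
    hJ.cont.comp (f := fun r : ℝ => (psi G (w' + r), w + (r:ℂ)))
      ((psi_contr h hw').prodMk (by fun_prop)) (fun r hr => ho1 r hr)
  have hc2 : ContinuousOn (fun r : ℝ => J (psi G (w + r)) (w' + r) + Real.pi * Complex.I) (Ici 0) :=
    (hJ.cont.comp (f := fun r : ℝ => (psi G (w + r), w' + (r:ℂ)))
      ((psi_contr h hw).prodMk (by fun_prop)) (fun r hr => ho2 r hr)).add continuousOn_const
  have he : ∀ r ∈ Ici (0:ℝ), Complex.exp (J (psi G (w' + r)) (w + r)) =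
      Complex.exp (J (psi G (w + r)) (w' + r) + Real.pi * Complex.I) := by
    intro r hr
    rw [Complex.exp_add, hJ.exp _ _ (ho1 r hr), hJ.exp _ _ (ho2 r hr), Complex.exp_pi_mul_I]; ring
  set d := w.im - w'.im with hd
  have hdpos : 0 < d := by rw [hd]; linarith
  have hsh : ∀ v : ℂ, ∀ᶠ r : ℝ in atTop, |(psi G (v + r)).im - v.im| < d / 2 := by
    intro v
    have h1 := (Complex.continuous_im.tendsto _).comp (psi_shift h v)
    rw [h.im0] at h1
    have h2 := (h1.abs).eventually_lt_const (u := d / 2) (by rw [abs_zero]; linarith)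
    filter_upwards [h2] with r hr
    simpa using hr
  obtain ⟨r, hr⟩ := eventually_atTop.1 ((hsh w).and ((hsh w').and (eventually_ge_atTop (0:ℝ))))
  have hr0 := (hr r le_rfl).2.2
  have him : ∀ u : ℝ, 0 ≤ u → 0 < (psi G (w + r + u) - psi G (w' + r)).im := by
    intro u hu
    have h1 := (abs_lt.1 (hr (r + u) (by linarith)).1).1
    have h2 := (abs_lt.1 (hr r le_rfl).2.1).2
    rw [Complex.sub_im, add_assoc]; push_cast at h1; linarith
  have him' : ∀ u : ℝ, 0 ≤ u → (psi G (w' + r + u) - psi G (w + r)).im < 0 := by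
    intro u hu
    have h1 := (abs_lt.1 (hr (r + u) (by linarith)).2.1).2
    have h2 := (abs_lt.1 (hr r le_rfl).1).1
    rw [Complex.sub_im, add_assoc]; push_cast at h1; linarith
  have e1 := hJ.eq_log h (hsw r hr0) (fun u hu => Or.inr (him u hu).ne')
  have e2 := hJ.eq_log h (hsw' r hr0) (fun u hu => Or.inr (him' u hu).ne)
  have hrr : J (psi G (w' + r)) (w + r) = J (psi G (w + r)) (w' + r) + Real.pi * Complex.I := by
    apply exp_inj_close (he r hr0)
    rw [e1, e2, Complex.add_im, Complex.log_im, Complex.log_im]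
    have h1 := him 0 le_rfl
    have h2 := him' 0 le_rfl
    simp only [Complex.ofReal_zero, add_zero] at h1 h2
    have a1 := Complex.arg_nonneg_iff.2 h1.le
    have a2 := Complex.arg_le_pi (psi G (w + r) - psi G (w' + r))
    have a3 := Complex.arg_neg_iff.2 h2
    have a4 := Complex.neg_pi_lt_arg (psi G (w' + r) - psi G (w + r))
    have : ((Real.pi : ℂ) * Complex.I).im = Real.pi := by simp
    rw [this, abs_lt]
    constructor <;> linarith
  have hfin := log_diff_const (z0 := (0:ℝ)) isPreconnected_Ici hc1 hc2 he (by simp) r hr0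
  rw [hrr, sub_self] at hfin
  simpa using (sub_eq_zero.1 hfin.symm)

end


theorem det_smul_one (c : ℂ) :
    ((c • (1 : ℂ →L[ℂ] ℂ)).restrictScalars ℝ).det = ‖c‖ ^ 2 := by
  rw [← Complex.normSq_eq_norm_sq]
  have h1 : ((c • (1 : ℂ →L[ℂ] ℂ)).restrictScalars ℝ).det =
      LinearMap.det ((c • (LinearMap.id : ℂ →ₗ[ℂ] ℂ)).restrictScalars ℝ) := rfl
  rw [h1, LinearMap.det_restrictScalars]
  simp [Algebra.norm_complex_apply]

open MeasureTheory in
theorem area_lines {f : ℂ → ℂ} {α β C : ℝ}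
    (hf : DifferentiableOn ℂ f {w : ℂ | 0 < w.re}) 
    (hinj : InjOn f {w : ℂ | w.re ∈ Ioo (0:ℝ) 1 ∧ w.im ∈ Ioo α β})
    (hC : ∀ w : ℂ, w.re ∈ Ioo (0:ℝ) 1 → ‖f w‖ ≤ C) :
    ∀ᵐ y : ℝ, y ∈ Ioo α β → IntegrableOn (fun x : ℝ => deriv f ⟨x, y⟩) (Ioo 0 1) := by
  set S : Set ℂ := {w : ℂ | w.re ∈ Ioo (0:ℝ) 1 ∧ w.im ∈ Ioo α β} with hS
  have hSm : MeasurableSet S := by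
    apply MeasurableSet.inter
    · exact Complex.measurable_re measurableSet_Ioo
    · exact Complex.measurable_im measurableSet_Ioo
  have h1 : ∫⁻ w in S, ENNReal.ofReal (‖deriv f w‖ ^ 2) = volume (f '' S) := by
    rw [← lintegral_abs_det_fderiv_eq_addHaar_image volume hSm
      (f' := fun w => (deriv f w • (1 : ℂ →L[ℂ] ℂ)).restrictScalars ℝ) _ hinj]
    · refine lintegral_congr (fun w => ?_)
      rw [det_smul_one, abs_of_nonneg (by positivity)]
    · intro w hw
      have : HasDerivAt f (deriv f w) w :=
        (hf.differentiableAt (isOpen_rh.mem_nhds hw.1.1)).hasDerivAt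
      have h2 := this.hasFDerivAt.restrictScalars ℝ
      refine HasFDerivAt.hasFDerivWithinAt ?_
      convert h2 using 1
      ext; simp [mul_comm]
  have h2 : volume (f '' S) < ⊤ := by
    refine lt_of_le_of_lt (measure_mono (t := closedBall (0:ℂ) C) ?_) measure_closedBall_lt_top
    rintro _ ⟨w, hw, rfl⟩
    simpa using hC w hw.1
  have hpre : Complex.measurableEquivRealProd.symm ⁻¹' S = Ioo (0:ℝ) 1 ×ˢ Ioo α β := by
    ext p; simp [hS, Complex.measurableEquivRealProd_symm_apply]
  have h3 := (Complex.volume_preserving_equiv_real_prod.symm).setLIntegral_comp_preimage_emb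
    Complex.measurableEquivRealProd.symm.measurableEmbedding
    (fun w => ENNReal.ofReal (‖deriv f w‖ ^ 2)) S
  rw [hpre, Measure.volume_eq_prod, ← Measure.prod_restrict] at h3
  have hmeas : Measurable (fun p : ℝ × ℝ =>
      ENNReal.ofReal (‖deriv f (Complex.measurableEquivRealProd.symm p)‖ ^ 2)) := by
    have := (measurable_deriv f).comp Complex.measurableEquivRealProd.symm.measurable
    exact ENNReal.measurable_ofReal.comp ((this.norm).pow_const 2)
  rw [lintegral_prod_symm' _ hmeas, h1] at h3
  have h4 := ae_lt_top hmeas.lintegral_prod_left' (h3.trans_lt h2).ne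
  have h5 := (ae_restrict_iff' measurableSet_Ioo).1 h4
  filter_upwards [h5] with y hy hyI
  have h6 := hy hyI
  refine ⟨?_, ?_⟩
  · have : Measurable (fun x : ℝ => deriv f ⟨x, y⟩) := by
      have h7 : Measurable (fun x : ℝ => (Complex.measurableEquivRealProd.symm (x, y))) :=
        Complex.measurableEquivRealProd.symm.measurable.comp (by fun_prop)
      exact (measurable_deriv f).comp h7
    exact this.aestronglyMeasurable
  · rw [hasFiniteIntegral_iff_norm]
    calc ∫⁻ x in Ioo (0:ℝ) 1, ENNReal.ofReal ‖deriv f ⟨x, y⟩‖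
        ≤ ∫⁻ x in Ioo (0:ℝ) 1, (1 + ENNReal.ofReal (‖deriv f ⟨x, y⟩‖ ^ 2)) := by
          refine lintegral_mono (fun x => ?_)
          rw [← ENNReal.ofReal_one, ← ENNReal.ofReal_add zero_le_one (by positivity)]
          apply ENNReal.ofReal_le_ofReal
          nlinarith [sq_nonneg (‖deriv f ⟨x, y⟩‖ - 1)]
      _ = (∫⁻ _ in Ioo (0:ℝ) 1, 1) + ∫⁻ x in Ioo (0:ℝ) 1, ENNReal.ofReal (‖deriv f ⟨x, y⟩‖ ^ 2) :=
          lintegral_add_left measurable_const _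
      _ < ⊤ := by
          rw [ENNReal.add_lt_top]
          refine ⟨by simp, h6⟩

open MeasureTheory in
theorem lim_of_int {f : ℂ → ℂ} {y : ℝ} (hf : DifferentiableOn ℂ f {w : ℂ | 0 < w.re})
    (hi : IntegrableOn (fun x : ℝ => deriv f ⟨x, y⟩) (Ioo 0 1)) :
    ∃ v : ℂ, Tendsto (fun x : ℝ => f ⟨x, y⟩) (𝓝[>] 0) (𝓝 v) := by
  have hi2 : IntegrableOn (fun x : ℝ => deriv f ⟨x, y⟩) (uIcc 0 (1/2)) := by
    rw [uIcc_of_le (by norm_num), integrableOn_Icc_iff_integrableOn_Ioo]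
    exact hi.mono_set (Ioo_subset_Ioo_right (by norm_num))
  have hc := intervalIntegral.continuousOn_primitive_interval_left hi2
  have hd : ∀ x : ℝ, 0 < x → HasDerivAt (fun x : ℝ => f ⟨x, y⟩) (deriv f ⟨x, y⟩) x := by
    intro x hx
    have h1 : HasDerivAt f (deriv f ⟨x, y⟩) ⟨x, y⟩ :=
      (hf.differentiableAt (isOpen_rh.mem_nhds (show 0 < (⟨x, y⟩ : ℂ).re from hx))).hasDerivAt
    have h2 : HasDerivAt (fun x : ℝ => (⟨x, y⟩ : ℂ)) 1 x := by
      have h3 : (fun x : ℝ => (⟨x, y⟩ : ℂ)) = fun x : ℝ => (x : ℂ) + y * Complex.I := by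
        funext x; exact Complex.mk_eq_add_mul_I x y
      rw [h3]
      exact (Complex.ofRealCLM.hasDerivAt (x := x)).add_const _
    have := HasDerivAt.comp (h₂ := f) x h1 h2
    rw [mul_one] at this
    exact this
  have heq : ∀ x ∈ Ioc (0:ℝ) (1/2), f ⟨x, y⟩ = f ⟨1/2, y⟩ - ∫ u in x..(1/2), deriv f ⟨u, y⟩ := by
    intro x hx
    rw [intervalIntegral.integral_eq_sub_of_hasDerivAt (f := fun x : ℝ => f ⟨x, y⟩)]
    · ring
    · intro u hu
      rw [uIcc_of_le hx.2] at hu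
      exact hd u (lt_of_lt_of_le hx.1 hu.1)
    · rw [intervalIntegrable_iff_integrableOn_Ioc_of_le hx.2]
      refine hi2.mono_set ?_
      rw [uIcc_of_le (by norm_num)]
      exact fun u hu => ⟨hx.1.le.trans hu.1.le, hu.2⟩
  have h0 : Tendsto (fun x : ℝ => f ⟨1/2, y⟩ - ∫ u in x..(1/2), deriv f ⟨u, y⟩) (𝓝[>] 0)
      (𝓝 (f ⟨1/2, y⟩ - ∫ u in (0:ℝ)..(1/2), deriv f ⟨u, y⟩)) := by
    have h1 := (hc 0 (by simp)).tendsto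
    refine tendsto_const_nhds.sub (h1.mono_left ?_)
    rw [uIcc_of_le (by norm_num), ← nhdsWithin_Ioc_eq_nhdsGT (show (0:ℝ) < 1/2 by norm_num)]
    exact nhdsWithin_mono _ Ioc_subset_Icc_self
  refine ⟨_, h0.congr' ?_⟩
  filter_upwards [Ioc_mem_nhdsGT (show (0:ℝ) < 1/2 by norm_num)] with x hx
  exact (heq x hx).symm


section
variable {U : Set ℂ} {G : ℂ → ℂ}

theorem Rie.mean (h : Rie U G) {x : ℝ} (hx : 0 < x) (α : ℝ) :
    ∫ y in α..(α + 2 * Real.pi), (- (G (Complex.exp (-⟨x, y⟩))).re) = 2 * Real.pi * (-(G 0).re) := by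
  set R := Real.exp (-x) with hR
  have hR0 : 0 < R := Real.exp_pos _
  have hR1 : R < 1 := by rw [hR, ← Real.exp_zero]; exact Real.exp_lt_exp.2 (by linarith)
  have hcm : ∀ y : ℝ, Complex.exp (-⟨x, y⟩) = circleMap 0 R (-y) := by
    intro y
    rw [circleMap, zero_add, hR, Complex.ofReal_exp, ← Complex.exp_add, Complex.mk_eq_add_mul_I]
    congr 1; push_cast; ring
  have hdc : DiffContOnCl ℂ G (ball 0 |R|) := by
    rw [abs_of_pos hR0]
    apply DifferentiableOn.diffContOnCl
    rw [closure_ball _ hR0.ne']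
    exact h.diff.mono (closedBall_subset_ball hR1)
  have h1 := hdc.circleAverage
  rw [Real.circleAverage_def] at h1
  have hpi : (2 * Real.pi) ≠ 0 := by positivity
  have h2 : ∫ θ in (0:ℝ)..2 * Real.pi, G (circleMap 0 R θ) = (2 * Real.pi : ℝ) • G 0 := by
    rw [← h1, smul_smul, mul_inv_cancel₀ hpi, one_smul]
  have hper : Function.Periodic (fun θ => G (circleMap 0 R θ)) (2 * Real.pi) := fun θ => by
    simp only [periodic_circleMap 0 R θ]
  have hcont : Continuous (fun θ => G (circleMap 0 R θ)) := by
    refine h.diff.continuousOn.comp_continuous (continuous_circleMap 0 R) (fun θ => ?_)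
    rw [mem_ball_zero_iff]
    simpa [circleMap, abs_of_pos hR0] using hR1
  have h3 : ∫ y in α..(α + 2 * Real.pi), G (circleMap 0 R (-y)) = (2 * Real.pi : ℝ) • G 0 := by
    rw [intervalIntegral.integral_comp_neg (fun θ => G (circleMap 0 R θ)), ← h2]
    have := hper.intervalIntegral_add_eq (-(α + 2 * Real.pi)) 0
    rw [zero_add] at this
    rw [← this]; congr 1; ring
  have h4 := Complex.reCLM.intervalIntegral_comp_comm (a := α) (b := α + 2 * Real.pi)
    (f := fun y => G (circleMap 0 R (-y))) (μ := MeasureTheory.volume)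
    ((hcont.comp continuous_neg).intervalIntegrable _ _)
  rw [intervalIntegral.integral_neg]
  simp only [hcm]
  rw [h3] at h4
  simp only [Complex.reCLM_apply] at h4
  rw [h4]
  simp

open MeasureTheory in
theorem Rie.ae_not_zero (h : Rie U G) (α : ℝ) :
    ∀ᵐ y : ℝ, y ∈ Ioc α (α + 2 * Real.pi) →
      ¬ Tendsto (fun x : ℝ => (psi G ⟨x, y⟩).re) (𝓝[>] 0) atBot := by
  let s : ℕ → ℝ := fun n => 1 / ((n:ℝ) + 1)
  have hs : ∀ n, 0 < s n := fun n => by positivity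
  let u : ℕ → ℝ → ℝ := fun n y => - (G (Complex.exp (-⟨s n, y⟩))).re
  have hu0 : ∀ n y, 0 ≤ u n y := fun n y => by
    have := h.re _ (exp_neg_ball (w := ⟨s n, y⟩) (hs n)).1
    simp only [u]; linarith
  have hmk : ∀ n, Continuous (fun y : ℝ => (⟨s n, y⟩ : ℂ)) := fun n => by
    simp only [Complex.mk_eq_add_mul_I]; fun_prop
  have huc : ∀ n, Continuous (u n) := fun n => by
    refine (Complex.continuous_re.comp ?_).neg
    refine h.diff.continuousOn.comp_continuous (f := fun y : ℝ => Complex.exp (-⟨s n, y⟩)) ?_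
      (fun y => (exp_neg_ball (w := ⟨s n, y⟩) (hs n)).1)
    exact Complex.continuous_exp.comp (hmk n).neg
  have hintg : ∀ n, ∫⁻ y in Ioc α (α + 2 * Real.pi), ENNReal.ofReal (u n y) =
      ENNReal.ofReal (2 * Real.pi * (-(G 0).re)) := by
    intro n
    rw [← ofReal_integral_eq_lintegral_ofReal, ← intervalIntegral.integral_of_le
      (by linarith [Real.pi_pos]), h.mean (hs n)]
    · have := (huc n).intervalIntegrable (μ := volume) α (α + 2 * Real.pi)
      rwa [intervalIntegrable_iff_integrableOn_Ioc_of_le (by linarith [Real.pi_pos])] at this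
    · exact Eventually.of_forall (hu0 n)
  have hm : ∀ n, Measurable (fun y => ENNReal.ofReal (u n y)) := fun n =>
    ENNReal.measurable_ofReal.comp (huc n).measurable
  have hF := lintegral_liminf_le (μ := volume.restrict (Ioc α (α + 2 * Real.pi)))
    (f := fun n y => ENNReal.ofReal (u n y)) (u := atTop) hm
  simp only [hintg, liminf_const] at hF
  have h4 := ae_lt_top (Measurable.liminf hm) (hF.trans_lt ENNReal.ofReal_lt_top).ne
  have h5 := (ae_restrict_iff' measurableSet_Ioc).1 h4
  filter_upwards [h5] with y hy hyI hT
  have h6 := hy hyI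
  have hs0 : Tendsto s atTop (𝓝[>] 0) := by
    rw [tendsto_nhdsWithin_iff]
    exact ⟨tendsto_one_div_add_atTop_nhds_zero_nat, Eventually.of_forall hs⟩
  have h7 : Tendsto (fun n => u n y) atTop atTop := by
    have h8 := tendsto_neg_atBot_atTop.comp (hT.comp hs0)
    refine tendsto_atTop_mono (fun n => ?_) h8
    simp only [Function.comp_apply, psi, u, Complex.add_re]
    have := hs n
    linarith
  have h9 : Tendsto (fun n => ENNReal.ofReal (u n y)) atTop (𝓝 ⊤) :=
    ENNReal.tendsto_ofReal_atTop.comp h7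
  rw [h9.liminf_eq] at h6
  exact lt_irrefl _ h6

/-- landing of vertical limits -/
def Lands (G : ℂ → ℂ) (y : ℝ) (a : ℂ) : Prop :=
  Tendsto (fun x : ℝ => psi G ⟨x, y⟩) (𝓝[>] 0) (𝓝 a)

theorem mk_re_pos {x y : ℝ} (hx : 0 < x) : 0 < (⟨x, y⟩ : ℂ).re := hx

theorem psi_line_cont (h : Rie U G) (y : ℝ) :
    ContinuousOn (fun x : ℝ => psi G ⟨x, y⟩) (Ioi 0) :=
  (psi_diff h).continuousOn.comp (f := fun x : ℝ => (⟨x, y⟩ : ℂ))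
    (by simp only [Complex.mk_eq_add_mul_I]; fun_prop) (fun _ hx => hx)

/-- if the exponential converges to a nonzero limit, so does `psi`. -/
theorem lands_of_exp (h : Rie U G) {y : ℝ} {v : ℂ} (hv : v ≠ 0)
    (hT : Tendsto (fun x : ℝ => Complex.exp (psi G ⟨x, y⟩)) (𝓝[>] 0) (𝓝 v)) :
    ∃ a, Complex.exp a = v ∧ Lands G y a := by
  have h1 : Tendsto (fun x : ℝ => Complex.exp (psi G ⟨x, y⟩) / v) (𝓝[>] 0) (𝓝 1) := by
    have := hT.div_const v
    rwa [div_self hv] at this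
  have hsl : ∀ᶠ x : ℝ in 𝓝[>] 0, Complex.exp (psi G ⟨x, y⟩) / v ∈ Complex.slitPlane :=
    h1.eventually (Complex.isOpen_slitPlane.mem_nhds Complex.one_mem_slitPlane)
  obtain ⟨δ, hδ, hδs⟩ := (mem_nhdsGT_iff_exists_Ioo_subset).1 hsl
  have hδ0 : (0:ℝ) < δ := hδ
  have hc1 : ContinuousOn (fun x : ℝ => psi G ⟨x, y⟩) (Ioo 0 δ) :=
    (psi_line_cont h y).mono (fun x hx => hx.1)
  have hc2 : ContinuousOn (fun x : ℝ => Complex.log (Complex.exp (psi G ⟨x, y⟩) / v) + Complex.log v)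
      (Ioo 0 δ) :=
    ((hc1.cexp.div_const v).clog (fun x hx => hδs hx)).add continuousOn_const
  have hm : δ / 2 ∈ Ioo 0 δ := ⟨by linarith, by linarith⟩
  have hd := log_diff_const (z0 := δ / 2) isPreconnected_Ioo hc1 hc2 (fun x hx => by
    rw [Complex.exp_add, Complex.exp_log (Complex.slitPlane_ne_zero (hδs hx)), Complex.exp_log hv]
    field_simp) hm
  set c := psi G ⟨δ / 2, y⟩ - (Complex.log (Complex.exp (psi G ⟨δ / 2, y⟩) / v) + Complex.log v) with hc
  have hl : Tendsto (fun x : ℝ => c + (Complex.log (Complex.exp (psi G ⟨x, y⟩) / v) + Complex.log v))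
      (𝓝[>] 0) (𝓝 (c + (Complex.log 1 + Complex.log v))) :=
    tendsto_const_nhds.add ((h1.clog Complex.one_mem_slitPlane).add tendsto_const_nhds)
  have hL : Lands G y (c + (Complex.log 1 + Complex.log v)) := by
    refine hl.congr' ?_
    filter_upwards [Ioo_mem_nhdsGT hδ0] with x hx
    rw [← hd x hx]; ring
  refine ⟨_, ?_, hL⟩
  exact tendsto_nhds_unique ((Complex.continuous_exp.tendsto _).comp hL) hT

theorem not_mem_U (h : Rie U G) {ι : Type*} {l : Filter ι} [l.NeBot] {w : ι → ℂ} {v : ℂ}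
    (hw : ∀ᶠ i in l, 0 < (w i).re) (hw0 : Tendsto (fun i => (w i).re) l (𝓝 0))
    (hT : Tendsto (fun i => Complex.exp (psi G (w i))) l (𝓝 v)) : v ∉ U := by
  intro hv
  obtain ⟨ε, hε, hεU⟩ := Metric.isOpen_iff.1 h.isOpen v hv
  obtain ⟨ρ, hρ0, hρ1, hρ⟩ := h.compact_pre (isCompact_closedBall v (ε/2))
    ((closedBall_subset_ball (by linarith)).trans hεU)
  have h1 : ∀ᶠ i in l, Complex.exp (psi G (w i)) ∈ closedBall v (ε/2) :=
    hT.eventually (closedBall_mem_nhds v (by linarith))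
  have h2 : ∀ᶠ i in l, (w i).re < -Real.log ρ :=
    hw0.eventually_lt_const (by linarith [Real.log_neg hρ0 hρ1])
  obtain ⟨i, hi1, hi2, hi3⟩ := (h1.and (h2.and hw)).exists
  rw [psi_exp] at hi1
  have := hρ _ (by simpa using (exp_neg_ball hi3).1) (Complex.exp_ne_zero _) hi1
  rw [Complex.norm_exp, Complex.neg_re, ← Real.le_log_iff_exp_le hρ0] at this
  linarith

theorem lands_mem {K : Set ℂ} (hK : IsCompact K) (h : Rie (unbddComp K) G) {y : ℝ} {a : ℂ}
    (ha : Lands G y a) : Complex.exp a ∈ K := by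
  have hT : Tendsto (fun x : ℝ => Complex.exp (psi G ⟨x, y⟩)) (𝓝[>] 0) (𝓝 (Complex.exp a)) :=
    (Complex.continuous_exp.tendsto _).comp ha
  have hpos : ∀ᶠ x : ℝ in 𝓝[>] 0, 0 < x := self_mem_nhdsWithin
  have h1 : Complex.exp a ∈ closure (unbddComp K) := by
    refine mem_closure_of_tendsto hT ?_
    filter_upwards [hpos] with x hx
    exact psi_mem h (mk_re_pos hx)
  rcases closure_unbddComp hK h1 with h2 | h2
  · exact absurd h2 (not_mem_U h (w := fun x : ℝ => ⟨x, y⟩) hpos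
      (tendsto_nhdsWithin_of_tendsto_nhds tendsto_id) hT)
  · exact h2

open MeasureTheory in
theorem ae_lands (h : Rie U G) : ∀ᵐ y : ℝ, ∃ a, Lands G y a := by
  have hα : ∀ n : ℤ, ∀ᵐ y : ℝ, y ∈ Ioo (n:ℝ) (n + 2) → ∃ a, Lands G y a := by
    intro n
    have hpd : DifferentiableOn ℂ (fun w => Complex.exp (psi G w)) {w : ℂ | 0 < w.re} :=
      (psi_diff h).cexp
    have h1 := area_lines (f := fun w => Complex.exp (psi G w)) (α := n) (β := n + 2)
      (C := Real.exp 1) hpd (by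
        intro w hw w' hw' he
        simp only [psi_exp] at he
        have h2 := h.inj (exp_neg_ball hw.1.1) (exp_neg_ball hw'.1.1) he
        have h3 := exp_inj_close h2 (by
          rw [Complex.neg_im, Complex.neg_im, abs_lt]
          have a1 := hw.2; have a2 := hw'.2
          have := Real.pi_gt_three
          constructor <;> linarith [a1.1, a1.2, a2.1, a2.2])
        exact neg_injective h3)
      (fun w hw => by
        rw [Complex.norm_exp]
        exact Real.exp_le_exp.2 ((psi_re_le h hw.1).trans hw.2.le))
    filter_upwards [h1, h.ae_not_zero n] with y hy1 hy2 hyI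
    obtain ⟨v, hv⟩ := lim_of_int hpd (hy1 hyI)
    have hv0 : v ≠ 0 := by
      rintro rfl
      refine hy2 ⟨hyI.1, by linarith [hyI.2, Real.pi_gt_three]⟩ ?_
      have h3 : Tendsto (fun x : ℝ => Real.exp (psi G ⟨x, y⟩).re) (𝓝[>] 0) (𝓝 0) := by
        have := hv.norm
        simpa [Complex.norm_exp] using this
      exact Real.tendsto_exp_comp_nhds_zero.1 h3
    obtain ⟨a, -, ha⟩ := lands_of_exp h hv0 hv
    exact ⟨a, ha⟩
  have hall := ae_all_iff.2 hα
  filter_upwards [hall] with y hy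
  refine hy (⌈y⌉ - 1) ⟨?_, ?_⟩
  · have := Int.ceil_lt_add_one y; push_cast; linarith
  · have := Int.le_ceil y; push_cast; linarith

end


theorem mob_re {ζ : ℂ} (hζ : ζ ≠ 1) : ((1 + ζ) / (1 - ζ)).re = (1 - ‖ζ‖ ^ 2) / ‖1 - ζ‖ ^ 2 := by
  rw [Complex.div_re, ← Complex.normSq_eq_norm_sq, ← Complex.normSq_eq_norm_sq, ← add_div]
  congr 1
  simp [Complex.normSq_apply]
  ring

theorem mob_tan {s : ℝ} (hs : s ∈ Ioo 0 (2 * Real.pi)) :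
    circleMap 0 1 s ≠ 1 ∧
      (1 + circleMap 0 1 s) / (1 - circleMap 0 1 s) = ⟨0, Real.tan ((Real.pi - s) / 2)⟩ := by
  set c := (Real.pi - s) / 2 with hc
  have hcos : 0 < Real.cos c := Real.cos_pos_of_mem_Ioo ⟨by rw [hc]; linarith [hs.2], by
    rw [hc]; linarith [hs.1]⟩
  have h1 : circleMap 0 1 s = -(Complex.exp (-(c * Complex.I)) * Complex.exp (-(c * Complex.I))) := by
    rw [circleMap, ← Complex.exp_add]
    have : (s:ℂ) * Complex.I = -(c * Complex.I) + -(c * Complex.I) + Real.pi * Complex.I := by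
      rw [hc]; push_cast; ring
    rw [this, Complex.exp_add, Complex.exp_pi_mul_I]; simp
  have hcosC : Complex.cos c ≠ 0 := by
    rw [← Complex.ofReal_cos]; exact_mod_cast hcos.ne'
  have hE : Complex.exp (c * Complex.I) * Complex.exp (-(c * Complex.I)) = 1 := by
    rw [← Complex.exp_add]; simp
  set e := Complex.exp (-(c * Complex.I)) with he
  set f := Complex.exp (c * Complex.I) with hf
  have hcosd : Complex.cos c = (f + e) / 2 := by rw [Complex.cos, neg_mul]
  have hsind : Complex.sin c = (e - f) * Complex.I / 2 := by rw [Complex.sin, neg_mul]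
  have he0 : e ≠ 0 := Complex.exp_ne_zero _
  have hden : 1 - circleMap 0 1 s ≠ 0 := by
    rw [h1]
    have : 1 - -(e * e) = 2 * e * Complex.cos c := by rw [hcosd]; linear_combination - hE
    rw [this]
    exact mul_ne_zero (mul_ne_zero two_ne_zero he0) hcosC
  refine ⟨fun hh => hden (by rw [hh]; ring), ?_⟩
  have h3 : (⟨0, Real.tan c⟩ : ℂ) = Complex.tan c * Complex.I := by
    rw [← Complex.ofReal_tan, Complex.mk_eq_add_mul_I]; simp
  rw [h3, div_eq_iff hden, Complex.tan, h1, hcosd, hsind]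
  rw [hcosd] at hcosC
  have hfe : f + e ≠ 0 := fun hh => hcosC (by rw [hh]; simp)
  field_simp
  linear_combination (-2 * e) * hE - (e - f) * (1 + e ^ 2) * Complex.I_sq

open MeasureTheory in
theorem maxp {H : ℂ → ℂ} {C M0 : ℝ} (hH : DifferentiableOn ℂ H {w : ℂ | 0 < w.re})
    (hC : ∀ w : ℂ, 0 < w.re → ‖H w‖ ≤ C) (hb : ∀ᵐ y : ℝ, ∀ᶠ x : ℝ in 𝓝[>] 0, ‖H ⟨x, y⟩‖ ≤ M0)
    {w0 : ℂ} (hw0 : 0 < w0.re) : ‖H w0‖ ≤ M0 := by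
  set x0 := w0.re with hx0
  set y0 := w0.im with hy0
  have hpi : 0 < 2 * Real.pi := by positivity
  set N : Set ℝ := {y : ℝ | ¬ ∀ᶠ x : ℝ in 𝓝[>] 0, ‖H ⟨x, y⟩‖ ≤ M0} with hN
  have hN0 : volume N = 0 := hb
  let yy : ℝ → ℝ := fun s => y0 + x0 * Real.tan ((Real.pi - s) / 2)
  have hM0 : 0 ≤ M0 := by
    obtain ⟨y, hy⟩ := hb.exists
    obtain ⟨x, hx⟩ := hy.exists
    exact (norm_nonneg _).trans hx
  have hgood : ∀ᵐ s : ℝ, s ∈ Ioo 0 (2 * Real.pi) → ∀ᶠ x : ℝ in 𝓝[>] 0, ‖H ⟨x, yy s⟩‖ ≤ M0 := by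
    have himg : volume ((fun y : ℝ => Real.pi - 2 * Real.arctan ((y - y0) / x0)) '' N) = 0 := by
      apply addHaar_image_eq_zero_of_differentiableOn_of_addHaar_eq_zero _ _ hN0
      exact (((((differentiable_id.sub_const y0).div_const x0).arctan).const_mul 2).const_sub
        Real.pi).differentiableOn
    rw [ae_iff]
    refine measure_mono_null ?_ himg
    intro s hs
    simp only [mem_ofPred_eq, Classical.not_imp] at hs
    refine ⟨yy s, hs.2, ?_⟩
    simp only [yy]
    have h1 : (y0 + x0 * Real.tan ((Real.pi - s) / 2) - y0) / x0 = Real.tan ((Real.pi - s) / 2) := by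
      field_simp; ring
    rw [h1, Real.arctan_tan (by linarith [hs.1.2]) (by linarith [hs.1.1])]
    ring
  have hpoi : ∀ σ : ℝ, 0 < σ → ‖H (σ + w0)‖ ≤ (2 * Real.pi)⁻¹ *
      ∫ s in (0:ℝ)..2 * Real.pi, ‖H ⟨σ, yy s⟩‖ := by
    intro σ hσ
    let m : ℂ → ℂ := fun ζ => σ + (⟨0, y0⟩ + x0 * ((1 + ζ) / (1 - ζ)))
    have hmre : ∀ ζ : ℂ, ζ ≠ 1 → ‖ζ‖ ≤ 1 → σ ≤ (m ζ).re := by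
      intro ζ hζ hζ1
      have h1 := mob_re hζ
      have h2 : 0 ≤ ((1 + ζ) / (1 - ζ)).re := by
        rw [h1]; apply div_nonneg _ (by positivity); nlinarith [norm_nonneg ζ]
      simp only [m, Complex.add_re, Complex.ofReal_re, Complex.mul_re, Complex.ofReal_im, zero_mul,
        sub_zero, zero_add]
      nlinarith
    have hmd : ∀ ζ : ℂ, ζ ≠ 1 → DifferentiableAt ℂ m ζ := by
      intro ζ hζ
      have : 1 - ζ ≠ 0 := sub_ne_zero.2 hζ.symm
      simp only [m]
      fun_prop (disch := assumption)
    have hkd : ∀ ζ : ℂ, ζ ≠ 1 → ‖ζ‖ ≤ 1 → DifferentiableAt ℂ (fun ζ => H (m ζ)) ζ := by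
      intro ζ hζ hζ1
      have h1 : DifferentiableAt ℂ H (m ζ) :=
        hH.differentiableAt (isOpen_rh.mem_nhds (hσ.trans_le (hmre ζ hζ hζ1)))
      exact DifferentiableAt.comp ζ h1 (hmd ζ hζ)
    have hne1 : ∀ r : ℝ, 0 < r → r < 1 → ∀ s, circleMap 0 r s ≠ 1 ∧ ‖circleMap 0 r s‖ ≤ 1 := by
      intro r hr hr1 s
      have : ‖circleMap 0 r s‖ = r := by simp [circleMap, abs_of_pos hr]
      refine ⟨fun hh => ?_, by rw [this]; exact hr1.le⟩
      rw [hh] at this; simp at this; linarith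
    have hkc : ∀ r : ℝ, 0 < r → r < 1 → Continuous (fun s => H (m (circleMap 0 r s))) := by
      intro r hr hr1
      rw [continuous_iff_continuousAt]
      intro s
      exact ContinuousAt.comp (g := fun ζ => H (m ζ)) (f := circleMap 0 r)
        (hkd _ (hne1 r hr hr1 s).1 (hne1 r hr hr1 s).2).continuousAt
        (continuous_circleMap 0 r).continuousAt
    have hm0 : m 0 = σ + w0 := by
      simp only [m]; congr 1
      apply Complex.ext <;> simp [hx0, hy0]
    have hr : ∀ r : ℝ, 0 < r → r < 1 → ‖H (σ + w0)‖ ≤ (2 * Real.pi)⁻¹ *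
        ∫ s in (0:ℝ)..2 * Real.pi, ‖H (m (circleMap 0 r s))‖ := by
      intro r hr hr1
      have hdc : DiffContOnCl ℂ (fun ζ => H (m ζ)) (ball 0 |r|) := by
        rw [abs_of_pos hr]
        apply DifferentiableOn.diffContOnCl
        rw [closure_ball _ hr.ne']
        intro ζ hζ
        have hζ' : ‖ζ‖ ≤ r := by simpa using hζ
        exact (hkd ζ (fun hh => by rw [hh] at hζ'; simp at hζ'; linarith)
          (hζ'.trans hr1.le)).differentiableWithinAt
      have h1 : Real.circleAverage (fun ζ => H (m ζ)) 0 r = H (m 0) := hdc.circleAverage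
      rw [hm0, Real.circleAverage_def] at h1
      rw [← h1, norm_smul, Real.norm_of_nonneg (by positivity)]
      gcongr
      exact intervalIntegral.norm_integral_le_integral_norm hpi.le
    have hmb : ∀ s ∈ Ioo 0 (2 * Real.pi), m (circleMap 0 1 s) = ⟨σ, yy s⟩ := by
      intro s hs
      simp only [m, (mob_tan hs).2, yy]
      apply Complex.ext <;> simp
    have hlim : Tendsto (fun r : ℝ => ∫ s in (0:ℝ)..2 * Real.pi, ‖H (m (circleMap 0 r s))‖) (𝓝[<] 1)
        (𝓝 (∫ s in (0:ℝ)..2 * Real.pi, ‖H ⟨σ, yy s⟩‖)) := by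
      have hev : ∀ᶠ r : ℝ in 𝓝[<] 1, 0 < r ∧ r < 1 := Ioo_mem_nhdsLT one_pos
      apply intervalIntegral.tendsto_integral_filter_of_dominated_convergence (fun _ => C)
      · filter_upwards [hev] with r hr
        exact (hkc r hr.1 hr.2).norm.aestronglyMeasurable
      · filter_upwards [hev] with r hr
        refine Eventually.of_forall (fun s _ => ?_)
        rw [norm_norm]
        exact hC _ (hσ.trans_le (hmre _ (hne1 r hr.1 hr.2 s).1 (hne1 r hr.1 hr.2 s).2))
      · exact intervalIntegrable_const
      · have hnull : ∀ᵐ s : ℝ, s ≠ 2 * Real.pi := by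
          rw [ae_iff]; simp
        filter_upwards [hnull] with s hs2 hs
        rw [uIoc_of_le hpi.le] at hs
        have hs' : s ∈ Ioo 0 (2 * Real.pi) := ⟨hs.1, lt_of_le_of_ne hs.2 hs2⟩
        rw [← hmb s hs']
        have hcz : ContinuousAt (fun ζ => H (m ζ)) (circleMap 0 1 s) :=
          (hkd _ (mob_tan hs').1 (by simp [circleMap])).continuousAt
        have hcr : Tendsto (fun r : ℝ => circleMap 0 r s) (𝓝[<] 1) (𝓝 (circleMap 0 1 s)) := by
          have : Continuous (fun r : ℝ => circleMap 0 r s) := by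
            simp only [circleMap]; fun_prop
          exact (this.tendsto 1).mono_left nhdsWithin_le_nhds
        exact (hcz.tendsto.comp hcr).norm
    refine ge_of_tendsto (hlim.const_mul _) ?_
    filter_upwards [Ioo_mem_nhdsLT one_pos] with r hr'
    exact hr r hr'.1 hr'.2
  have hyc : ContinuousOn yy (Ioo 0 (2 * Real.pi)) := by
    intro s hs
    have hcos : Real.cos ((Real.pi - s) / 2) ≠ 0 :=
      (Real.cos_pos_of_mem_Ioo ⟨by linarith [hs.2], by linarith [hs.1]⟩).ne'
    have h1 : ContinuousAt Real.tan ((Real.pi - s) / 2) := Real.continuousAt_tan.2 hcos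
    have h2 : ContinuousAt (fun s : ℝ => Real.tan ((Real.pi - s) / 2)) s :=
      ContinuousAt.comp (g := Real.tan) (f := fun s : ℝ => (Real.pi - s) / 2) h1 (by fun_prop)
    exact (continuousAt_const.add (continuousAt_const.mul h2)).continuousWithinAt
  have hmeas : ∀ σ : ℝ, 0 < σ → AEStronglyMeasurable (fun s => ‖H ⟨σ, yy s⟩‖)
      (volume.restrict (uIoc 0 (2 * Real.pi))) := by
    intro σ hσ
    rw [uIoc_of_le hpi.le, ← Measure.restrict_congr_set Ioo_ae_eq_Ioc]
    apply ContinuousOn.aestronglyMeasurable _ measurableSet_Ioo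
    refine ContinuousOn.norm ?_
    refine hH.continuousOn.comp (f := fun s => (⟨σ, yy s⟩ : ℂ)) ?_ (fun s hs => hσ)
    simp only [Complex.mk_eq_add_mul_I]
    exact continuousOn_const.add ((Complex.continuous_ofReal.comp_continuousOn hyc).mul
      continuousOn_const)
  have hlim2 : Tendsto (fun σ : ℝ => ∫ s in (0:ℝ)..2 * Real.pi, max ‖H ⟨σ, yy s⟩‖ M0) (𝓝[>] 0)
      (𝓝 (∫ s in (0:ℝ)..2 * Real.pi, M0)) := by
    have hpos : ∀ᶠ σ : ℝ in 𝓝[>] 0, 0 < σ := self_mem_nhdsWithin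
    apply intervalIntegral.tendsto_integral_filter_of_dominated_convergence (fun _ => max C M0)
    · filter_upwards [hpos] with σ hσ
      exact (hmeas σ hσ).sup aestronglyMeasurable_const
    · filter_upwards [hpos] with σ hσ
      refine Eventually.of_forall (fun s _ => ?_)
      rw [Real.norm_of_nonneg (le_max_of_le_right hM0)]
      exact max_le_max (hC _ hσ) le_rfl
    · exact intervalIntegrable_const
    · have hnull : ∀ᵐ s : ℝ, s ≠ 2 * Real.pi := by
        rw [ae_iff]; simp
      filter_upwards [hnull, hgood] with s hs2 hg hs
      rw [uIoc_of_le hpi.le] at hs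
      refine tendsto_const_nhds.congr' ?_
      filter_upwards [hg ⟨hs.1, lt_of_le_of_ne hs.2 hs2⟩] with x hx
      exact (max_eq_right hx).symm
  have hle : ∀ᶠ σ : ℝ in 𝓝[>] 0, ‖H (σ + w0)‖ ≤ (2 * Real.pi)⁻¹ *
      ∫ s in (0:ℝ)..2 * Real.pi, max ‖H ⟨σ, yy s⟩‖ M0 := by
    have hpos : ∀ᶠ σ : ℝ in 𝓝[>] 0, 0 < σ := self_mem_nhdsWithin
    filter_upwards [hpos] with σ hσ
    refine (hpoi σ hσ).trans ?_
    gcongr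
    have hcI : ∀ c : ℝ, Integrable (fun _ : ℝ => c) (volume.restrict (uIoc 0 (2 * Real.pi))) :=
      fun c => intervalIntegrable_iff.1 intervalIntegrable_const
    apply intervalIntegral.integral_mono hpi.le
    · refine intervalIntegrable_iff.2 (Integrable.mono' (hcI C) (hmeas σ hσ)
        (Eventually.of_forall (fun s => ?_)))
      rw [norm_norm]; exact hC _ hσ
    · refine intervalIntegrable_iff.2 (Integrable.mono' (hcI (max C M0))
        ((hmeas σ hσ).sup aestronglyMeasurable_const) (Eventually.of_forall (fun s => ?_)))
      rw [Real.norm_of_nonneg (le_max_of_le_right hM0)]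
      exact max_le_max (hC _ hσ) le_rfl
    · exact fun s => le_max_left _ _
  have hHc : Tendsto (fun σ : ℝ => ‖H (σ + w0)‖) (𝓝[>] 0) (𝓝 ‖H w0‖) := by
    have h1 : ContinuousAt H w0 := (hH.differentiableAt (isOpen_rh.mem_nhds hw0)).continuousAt
    have h2 : Tendsto (fun σ : ℝ => (σ:ℂ) + w0) (𝓝[>] 0) (𝓝 w0) := by
      have : Continuous (fun σ : ℝ => (σ:ℂ) + w0) := by fun_prop
      have h3 := this.tendsto 0
      simp only [Complex.ofReal_zero, zero_add] at h3
      exact h3.mono_left nhdsWithin_le_nhds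
    exact (h1.tendsto.comp h2).norm
  have hfin := le_of_tendsto_of_tendsto hHc (hlim2.const_mul _) hle
  rw [intervalIntegral.integral_const, sub_zero, smul_eq_mul, ← mul_assoc,
    inv_mul_cancel₀ hpi.ne', one_mul] at hfin
  exact hfin


theorem slit_of_near {u : ℂ} (h : ‖u - 1‖ < 1) : 0 < u.re := by
  have h1 := Complex.abs_re_le_norm (u - 1)
  have h2 := (abs_lt.1 (h1.trans_lt h)).1
  simp only [Complex.sub_re, Complex.one_re] at h2
  linarith

/-- a disc centred in `V` missing `E` lies in `V`. -/
theorem disc_sub {K : Set ℂ} (hK : IsCompact K) {z0 : ℂ} {d : ℝ} (hd : 0 < d)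
    (hz0 : Complex.exp z0 ∈ unbddComp K) (hE : ∀ e, Complex.exp e ∈ K → d ≤ ‖z0 - e‖) :
    ∀ z, ‖z - z0‖ < d → Complex.exp z ∈ unbddComp K := by
  have hV : IsOpen {z | Complex.exp z ∈ unbddComp K} :=
    (isOpen_unbddComp hK).preimage Complex.continuous_exp
  have hsub : ball z0 d ⊆ {z | Complex.exp z ∈ unbddComp K} := by
    refine (convex_ball z0 d).isPreconnected.subset_of_closure_inter_subset hV
      ⟨z0, mem_ball_self hd, hz0⟩ ?_
    rintro z ⟨hz, hzb⟩
    have h1 : Complex.exp z ∈ closure (unbddComp K) :=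
      closure_mono (image_preimage_subset Complex.exp _)
        (image_closure_subset_closure_image Complex.continuous_exp ⟨z, hz, rfl⟩)
    rcases closure_unbddComp hK h1 with h2 | h2
    · exact h2
    · exfalso
      have := hE z h2
      rw [mem_ball, dist_comm, dist_eq_norm] at hzb
      linarith
  intro z hz
  exact hsub (by rwa [mem_ball, dist_eq_norm])

/-- the koebe type estimate `|f| ≤ 50`, and decay. -/
theorem ff_bound {s s0 : ℂ} (hs0 : s0 ≠ 0) (hl : 2 / 5 * ‖s0‖ ≤ ‖s + s0‖) :
    ‖4 * s * s0 / (s + s0) ^ 2‖ ≤ 50 ∧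
      ∀ M : ℝ, 2 ≤ M → M * ‖s0‖ ≤ ‖s‖ → ‖4 * s * s0 / (s + s0) ^ 2‖ ≤ 16 / M := by
  have h0 : 0 < ‖s0‖ := norm_pos_iff.2 hs0
  have hp : 0 < ‖s + s0‖ := by linarith
  have hn : ‖4 * s * s0 / (s + s0) ^ 2‖ = 4 * ‖s‖ * ‖s0‖ / ‖s + s0‖ ^ 2 := by
    rw [norm_div, norm_mul, norm_mul, norm_pow]; simp
  have h2 : ∀ M : ℝ, 2 ≤ M → M * ‖s0‖ ≤ ‖s‖ → ‖4 * s * s0 / (s + s0) ^ 2‖ ≤ 16 / M := by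
    intro M hM hMs
    have h3 : ‖s‖ / 2 ≤ ‖s + s0‖ := by
      have h4 : ‖s‖ - ‖s0‖ ≤ ‖s + s0‖ := by
        have := norm_sub_norm_le s (-s0)
        rw [norm_neg, sub_neg_eq_add] at this
        exact this
      nlinarith
    rw [hn, div_le_div_iff₀ (by positivity) (by linarith)]
    have h5 : ‖s‖ ^ 2 / 4 ≤ ‖s + s0‖ ^ 2 := by nlinarith [norm_nonneg s]
    nlinarith [norm_nonneg s]
  refine ⟨?_, h2⟩
  rcases le_total (2 * ‖s0‖) ‖s‖ with hc | hc
  · exact (h2 2 le_rfl hc).trans (by norm_num)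
  · rw [hn, div_le_iff₀ (by positivity)]
    have : (2 / 5 * ‖s0‖) ^ 2 ≤ ‖s + s0‖ ^ 2 := by gcongr
    nlinarith [norm_nonneg s]

theorem ke {K : Set ℂ} {G : ℂ → ℂ} {J : ℂ → ℂ → ℂ} (hK : IsCompact K) (h : Rie (unbddComp K) G)
    (hJ : IsJ G J) {w0 a : ℂ} {η : ℝ} (hw0 : 0 < w0.re) (ha : Complex.exp a ∈ K)
    (hnear : ∀ e, Complex.exp e ∈ K → ‖psi G w0 - a‖ ≤ ‖psi G w0 - e‖) (hη : 0 < η)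
    (hd : ‖psi G w0 - a‖ < η / 10 ^ 7)
    (hae : ∀ᵐ y : ℝ, (∃ b, Lands G y b ∧ η ≤ ‖a - b‖) ∨
      (∃ b, Lands G (2 * w0.im - y) b ∧ η ≤ ‖a - b‖)) : False := by
  have haV : ∀ w : ℂ, 0 < w.re → psi G w ≠ a := fun w hw he =>
    (psi_mem h hw).1 (by rw [he]; exact ha)
  have hoff : ∀ w : ℂ, 0 < w.re → OffR G (a, w) := fun w hw => ⟨hw, fun r hr =>
    haV _ (by simp only [Complex.add_re, Complex.ofReal_re]; linarith)⟩
  set d := ‖psi G w0 - a‖ with hdd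
  have hne0 : psi G w0 - a ≠ 0 := sub_ne_zero.2 (haV w0 hw0)
  have hd0 : 0 < d := norm_pos_iff.2 hne0
  have hdisc := disc_sub hK hd0 (psi_mem h hw0) hnear
  have hJc : ContinuousOn (J a) {w : ℂ | 0 < w.re} :=
    hJ.cont.comp (f := fun w => (a, w)) (by fun_prop) (fun w hw => hoff w hw)
  have hJe : ∀ w : ℂ, 0 < w.re → Complex.exp (J a w) = psi G w - a := fun w hw =>
    hJ.exp a w (hoff w hw)
  have hJd : DifferentiableOn ℂ (J a) {w : ℂ | 0 < w.re} :=
    log_differentiable isOpen_rh ((psi_diff h).sub_const a) hJc hJe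
  set s : ℂ → ℂ := fun w => Complex.exp (J a w / 2) with hs
  have hsd : DifferentiableOn ℂ s {w : ℂ | 0 < w.re} := (hJd.div_const 2).cexp
  have hs2 : ∀ w : ℂ, 0 < w.re → s w ^ 2 = psi G w - a := by
    intro w hw
    rw [hs, ← hJe w hw, ← Complex.exp_nat_mul]; congr 1; push_cast; ring
  have hsn : ∀ w : ℂ, 0 < w.re → ‖s w‖ ^ 2 = ‖psi G w - a‖ := by
    intro w hw; rw [← norm_pow, hs2 w hw]
  set s0 := s w0 with hs0d
  have hs0 : s0 ≠ 0 := Complex.exp_ne_zero _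
  have hs0n : ‖s0‖ ^ 2 = d := hsn w0 hw0
  have hinj : InjOn (psi G) {w : ℂ | 0 < w.re} := fun w hw w' hw' he => psi_inj h hw hw' he
  obtain ⟨-, hivd, -⟩ := univ_inv isOpen_rh (psi_diff h) hinj
  set iv := Function.invFunOn (psi G) {w : ℂ | 0 < w.re} with hiv
  have hivl : ∀ w : ℂ, 0 < w.re → iv (psi G w) = w := fun w hw => hinj.leftInvOn_invFunOn hw
  have hDim : ball (psi G w0) d ⊆ psi G '' {w : ℂ | 0 < w.re} := by
    intro z hz
    rw [mem_ball, dist_eq_norm] at hz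
    obtain ⟨w, hw, hwz⟩ := psi_surj h (hdisc z hz)
    exact ⟨w, hw, hwz⟩
  have hratio : ∀ z, ‖z - psi G w0‖ < d → 0 < ((z - a) / (psi G w0 - a)).re := by
    intro z hz
    apply slit_of_near
    have : (z - a) / (psi G w0 - a) - 1 = (z - psi G w0) / (psi G w0 - a) := by
      field_simp; ring
    rw [this, norm_div, div_lt_one hd0]
    exact hz
  have hbr : ∀ w : ℂ, 0 < w.re → ‖psi G w - psi G w0‖ < d →
      J a w = J a w0 + Complex.log ((psi G w - a) / (psi G w0 - a)) := by
    intro w hw hwd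
    have hu := log_unique (S := ball (psi G w0) d) (convex_ball _ _).isPreconnected
      (g1 := fun z => J a (iv z))
      (g2 := fun z => J a w0 + Complex.log ((z - a) / (psi G w0 - a))) (z0 := psi G w0)
      (hJc.comp (hivd.continuousOn.mono hDim) (fun z hz => by
        obtain ⟨w, hw, rfl⟩ := hDim hz
        rw [hivl w hw]; exact hw))
      (continuousOn_const.add (ContinuousOn.clog (by fun_prop) (fun z hz => Or.inl (hratio z (by
        rwa [mem_ball, dist_eq_norm] at hz)))))
      (fun z hz => by
        have hz' : ‖z - psi G w0‖ < d := by rwa [mem_ball, dist_eq_norm] at hz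
        have hr := hratio z hz'
        obtain ⟨w, hw, rfl⟩ := hDim hz
        have hrne : (psi G w - a) / (psi G w0 - a) ≠ 0 := fun hh => by rw [hh] at hr; simp at hr
        rw [hivl w hw, Complex.exp_add, hJe w hw, hJe w0 hw0, Complex.exp_log hrne]
        field_simp)
      (mem_ball_self hd0) (by
        simp only [hivl w0 hw0, div_self hne0, Complex.log_one, add_zero])
    have := hu (psi G w) (by rwa [mem_ball, dist_eq_norm])
    simpa only [hivl w hw] using this
  have hlow : ∀ w : ℂ, 0 < w.re → 2 / 5 * ‖s0‖ ≤ ‖s w + s0‖ := by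
    intro w hw
    by_contra hcon
    push Not at hcon
    have hs0p : 0 < ‖s0‖ := norm_pos_iff.2 hs0
    have h1 : ‖s w - s0‖ ≤ ‖s w + s0‖ + 2 * ‖s0‖ := by
      have : s w - s0 = (s w + s0) - 2 * s0 := by ring
      rw [this]
      refine (norm_sub_le _ _).trans ?_
      simp
    have h2 : ‖psi G w - psi G w0‖ < d := by
      have : psi G w - psi G w0 = (s w + s0) * (s w - s0) := by
        have e1 := hs2 w hw
        have e2 := hs2 w0 hw0
        rw [← hs0d] at e2
        linear_combination e2 - e1
      rw [this, norm_mul, ← hs0n]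
      have h3 : ‖s w - s0‖ ≤ 12 / 5 * ‖s0‖ := by linarith
      calc ‖s w + s0‖ * ‖s w - s0‖ ≤ (2 / 5 * ‖s0‖) * (12 / 5 * ‖s0‖) :=
            mul_le_mul hcon.le h3 (norm_nonneg _) (by positivity)
        _ < ‖s0‖ ^ 2 := by nlinarith
    have h3 := hbr w hw h2
    have h4 : s w = s0 * Complex.exp (Complex.log ((psi G w - a) / (psi G w0 - a)) / 2) := by
      simp only [hs0d, hs]; rw [h3, ← Complex.exp_add]; congr 1; ring
    set e := Complex.exp (Complex.log ((psi G w - a) / (psi G w0 - a)) / 2) with he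
    have h5 : 0 < e.re := by
      rw [he, Complex.exp_re]
      apply mul_pos (Real.exp_pos _)
      apply Real.cos_pos_of_mem_Ioo
      have h6 : (Complex.log ((psi G w - a) / (psi G w0 - a)) / 2).im =
          (Complex.log ((psi G w - a) / (psi G w0 - a))).im / 2 := by simp
      rw [h6, Complex.log_im]
      have := Complex.abs_arg_lt_pi_div_two_iff.2 (Or.inl (hratio _ h2))
      rw [abs_lt] at this
      constructor <;> linarith [Real.pi_pos]
    have h7 : s w + s0 = s0 * (e + 1) := by rw [h4]; ring
    rw [h7, norm_mul] at hcon
    have h8 : 1 < ‖e + 1‖ := by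
      have := Complex.re_le_norm (e + 1)
      simp only [Complex.add_re, Complex.one_re] at this
      linarith
    nlinarith
  set f : ℂ → ℂ := fun w => 4 * s w * s0 / (s w + s0) ^ 2 with hf
  have hden : ∀ w : ℂ, 0 < w.re → s w + s0 ≠ 0 := by
    intro w hw hh
    have := hlow w hw
    rw [hh, norm_zero] at this
    have := norm_pos_iff.2 hs0
    linarith
  have hfd : DifferentiableOn ℂ f {w : ℂ | 0 < w.re} := by
    intro w hw
    exact ((((hsd w hw).const_mul 4).mul_const s0).div (((hsd w hw).add_const s0).pow 2)
      (pow_ne_zero 2 (hden w hw)))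
  have hfC : ∀ w : ℂ, 0 < w.re → ‖f w‖ ≤ 50 := fun w hw => (ff_bound hs0 (hlow w hw)).1
  have hf0 : f w0 = 1 := by
    simp only [hf]; rw [← hs0d]; field_simp; norm_num
  have hfs : ∀ y b, Lands G y b → η ≤ ‖a - b‖ → ∀ᶠ x : ℝ in 𝓝[>] 0, ‖f ⟨x, y⟩‖ ≤ 16 / 1000 := by
    intro y b hl hab
    have h1 : Tendsto (fun x : ℝ => ‖psi G ⟨x, y⟩ - a‖) (𝓝[>] 0) (𝓝 ‖b - a‖) :=
      (hl.sub_const a).norm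
    have h2 : η / 4 < ‖b - a‖ := by rw [norm_sub_rev]; linarith
    have hpos : ∀ᶠ x : ℝ in 𝓝[>] 0, 0 < x := self_mem_nhdsWithin
    filter_upwards [h1.eventually (lt_mem_nhds h2), hpos] with x hx hx0
    refine (ff_bound hs0 (hlow ⟨x, y⟩ hx0)).2 1000 (by norm_num) ?_
    refine (sq_le_sq₀ (by positivity) (norm_nonneg _)).1 ?_
    rw [mul_pow, hs0n, hsn ⟨x, y⟩ hx0]
    norm_num at hd ⊢
    linarith
  set rf : ℂ → ℂ := fun w => (starRingEnd ℂ) w + 2 * w0.im * Complex.I with hrf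
  have hrfre : ∀ w, (rf w).re = w.re := fun w => by simp [hrf]
  have hrfmk : ∀ x y : ℝ, rf ⟨x, y⟩ = ⟨x, 2 * w0.im - y⟩ := fun x y => by
    apply Complex.ext <;> simp [hrf]; ring
  have hrf0 : rf w0 = w0 := by
    have := hrfmk w0.re w0.im
    rw [Complex.eta] at this
    rw [this]
    apply Complex.ext <;> simp; ring
  set H : ℂ → ℂ := fun w => f w * (starRingEnd ℂ) (f (rf w)) with hH
  have hHd : DifferentiableOn ℂ H {w : ℂ | 0 < w.re} := by
    intro w hw
    refine (hfd w hw).mul (DifferentiableAt.differentiableWithinAt ?_)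
    have h1 : DifferentiableAt ℂ (fun v => f (v + 2 * w0.im * Complex.I)) ((starRingEnd ℂ) w) := by
      have h2 : DifferentiableAt ℂ f ((starRingEnd ℂ) w + 2 * w0.im * Complex.I) :=
        hfd.differentiableAt (isOpen_rh.mem_nhds (by
          have := hrfre w
          simp only [hrf] at this
          rw [mem_ofPred_eq, this]; exact hw))
      exact DifferentiableAt.comp (f := fun v : ℂ => v + 2 * w0.im * Complex.I)
        ((starRingEnd ℂ) w) h2 (by fun_prop)
    have h3 := h1.conj_conj
    rw [Complex.conj_conj] at h3
    exact h3
  have hHC : ∀ w : ℂ, 0 < w.re → ‖H w‖ ≤ 2500 := by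
    intro w hw
    simp only [hH, norm_mul, RCLike.norm_conj]
    have h1 := hfC w hw
    have h2 := hfC (rf w) (by rw [hrfre]; exact hw)
    nlinarith [norm_nonneg (f w), norm_nonneg (f (rf w))]
  have hHb : ∀ᵐ y : ℝ, ∀ᶠ x : ℝ in 𝓝[>] 0, ‖H ⟨x, y⟩‖ ≤ 4 / 5 := by
    filter_upwards [hae] with y hy
    have hpos : ∀ᶠ x : ℝ in 𝓝[>] 0, 0 < x := self_mem_nhdsWithin
    rcases hy with ⟨b, hb, hab⟩ | ⟨b, hb, hab⟩
    · filter_upwards [hfs y b hb hab, hpos] with x hx hx0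
      simp only [hH, norm_mul, RCLike.norm_conj]
      have h2 := hfC (rf ⟨x, y⟩) (by rw [hrfre]; exact hx0)
      nlinarith [norm_nonneg (f ⟨x, y⟩), norm_nonneg (f (rf ⟨x, y⟩))]
    · filter_upwards [hfs _ b hb hab, hpos] with x hx hx0
      simp only [hH, norm_mul, RCLike.norm_conj]
      rw [← hrfmk] at hx
      have h2 := hfC ⟨x, y⟩ hx0
      nlinarith [norm_nonneg (f ⟨x, y⟩), norm_nonneg (f (rf ⟨x, y⟩))]
  have := maxp hHd hHC hHb hw0
  simp only [hH, hrf0, hf0] at this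
  norm_num at this


theorem re_ratio {u v p : ℂ} (hp : p ≠ 0) (hu : ‖u - p‖ ≤ ‖p‖ / 4) (hv : ‖v - p‖ ≤ ‖p‖ / 4) :
    0 < (u / v).re := by
  have h0 : 0 < ‖p‖ := norm_pos_iff.2 hp
  have h1 : 3 / 4 * ‖p‖ ≤ ‖v‖ := by
    have := norm_sub_norm_le p v
    rw [norm_sub_rev] at this
    linarith
  have hv0 : v ≠ 0 := norm_pos_iff.1 (by linarith)
  apply slit_of_near
  have h2 : u / v - 1 = (u - v) / v := by field_simp
  rw [h2, norm_div, div_lt_one (by linarith)]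
  have h3 : ‖u - v‖ ≤ ‖u - p‖ + ‖v - p‖ := by
    have : u - v = (u - p) - (v - p) := by ring
    rw [this]; exact norm_sub_le _ _
  linarith

theorem im_log_lt {u : ℂ} (hu : 0 < u.re) : |(Complex.log u).im| < Real.pi / 2 := by
  rw [Complex.log_im]; exact Complex.abs_arg_lt_pi_div_two_iff.2 (Or.inl hu)

theorem ne_zero_of_re {u : ℂ} (hu : 0 < u.re) : u ≠ 0 := fun h => by rw [h] at hu; simp at hu

theorem four_log {a b z z' : ℂ} (hab : a ≠ b) (hz : ‖z - a‖ ≤ ‖a - b‖ / 8)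
    (hz' : ‖z' - b‖ ≤ ‖a - b‖ / 8) :
    Complex.log ((z - b) / (z - z')) + Complex.log ((a - b) / (z - b)) =
      Complex.log ((z' - a) / (z' - z)) + Complex.log ((b - a) / (z' - a)) := by
  have hp : a - b ≠ 0 := sub_ne_zero.2 hab
  have hp0 : 0 < ‖a - b‖ := norm_pos_iff.2 hp
  have h1 : ‖(z - b) - (a - b)‖ ≤ ‖a - b‖ / 4 := by
    rw [sub_sub_sub_cancel_right]; linarith
  have h2 : ‖(z - z') - (a - b)‖ ≤ ‖a - b‖ / 4 := by
    have : (z - z') - (a - b) = (z - a) - (z' - b) := by ring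
    rw [this]; exact (norm_sub_le _ _).trans (by linarith)
  have h3 : ‖(a - z') - (a - b)‖ ≤ ‖a - b‖ / 4 := by
    rw [sub_sub_sub_cancel_left, norm_sub_rev]; linarith
  have h0 : ‖(a - b) - (a - b)‖ ≤ ‖a - b‖ / 4 := by rw [sub_self, norm_zero]; positivity
  have r1 := re_ratio hp h1 h2
  have r2 := re_ratio hp h0 h1
  have r3 : 0 < ((z' - a) / (z' - z)).re := by
    have := re_ratio hp h3 h2
    rwa [← neg_sub z' a, ← neg_sub z' z, neg_div_neg_eq] at this
  have r4 : 0 < ((b - a) / (z' - a)).re := by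
    have := re_ratio hp h0 h3
    rwa [← neg_sub z' a, ← neg_sub b a, neg_div_neg_eq] at this
  have n1 : z - b ≠ 0 := fun h => by rw [h] at r1; simp at r1
  have n2 : z - z' ≠ 0 := fun h => by rw [h] at r1; simp at r1
  have n3 : z' - a ≠ 0 := fun h => by rw [h] at r3; simp at r3
  have n4 : z' - z ≠ 0 := fun h => by rw [h] at r3; simp at r3
  apply exp_inj_close
  · rw [Complex.exp_add, Complex.exp_add, Complex.exp_log (ne_zero_of_re r1),
      Complex.exp_log (ne_zero_of_re r2), Complex.exp_log (ne_zero_of_re r3),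
      Complex.exp_log (ne_zero_of_re r4)]
    field_simp
    ring
  · have i1 := abs_lt.1 (im_log_lt r1)
    have i2 := abs_lt.1 (im_log_lt r2)
    have i3 := abs_lt.1 (im_log_lt r3)
    have i4 := abs_lt.1 (im_log_lt r4)
    rw [Complex.add_im, Complex.add_im, abs_lt]
    constructor <;> linarith [i1.1, i1.2, i2.1, i2.2, i3.1, i3.2, i4.1, i4.2]

/-- two logarithms on `K \ 0` agreeing near `0` agree. -/
theorem conn_log {P : Set ℂ} (hP : IsPreconnected P) (h0 : (0:ℂ) ∈ P) {f g : ℂ → ℂ}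
    (hf : ContinuousOn f (P \ {0})) (hg : ContinuousOn g (P \ {0}))
    (he : ∀ x ∈ P \ {0}, Complex.exp (f x) = Complex.exp (g x)) {δ : ℝ} (hδ : 0 < δ)
    (hn : ∀ x ∈ P \ {0}, ‖x‖ < δ → f x = g x) : ∀ x ∈ P \ {0}, f x = g x := by
  have hconst : ∀ x ∈ P, ∀ᶠ y in 𝓝[P] x, ((y = 0 ∨ f y = g y) ↔ (x = 0 ∨ f x = g x)) := by
    intro x hx
    by_cases hx0 : x = 0
    · subst hx0
      have : ∀ᶠ y in 𝓝[P] (0:ℂ), y ∈ P ∧ ‖y‖ < δ := by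
        refine Filter.Eventually.and self_mem_nhdsWithin ?_
        apply mem_nhdsWithin_of_mem_nhds
        filter_upwards [ball_mem_nhds (0:ℂ) hδ] with y hy
        simpa using hy
      filter_upwards [this] with y hy
      by_cases hy0 : y = 0
      · simp [hy0]
      · simp [hn y ⟨hy.1, hy0⟩ hy.2]
    · have h1 := log_diff_loc hf hg he (z0 := x) ⟨hx, hx0⟩
      have h2 : 𝓝[P \ {0}] x = 𝓝[P] x := by
        rw [sdiff_eq, nhdsWithin_inter_of_mem']
        exact mem_nhdsWithin_of_mem_nhds (isOpen_compl_singleton.mem_nhds hx0)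
      rw [h2] at h1
      have h3 : ∀ᶠ y in 𝓝[P] x, y ≠ 0 :=
        mem_nhdsWithin_of_mem_nhds (isOpen_compl_singleton.mem_nhds hx0)
      filter_upwards [h1, h3] with y hy hy0
      simp only [hx0, hy0, false_or]
      rw [← sub_eq_zero, hy, sub_eq_zero]
  have hcl : ∀ x ∈ P, (x = 0 ∨ f x = g x) := by
    intro x hx
    have := hP.induction₂ (fun x y => (y = 0 ∨ f y = g y) ↔ (x = 0 ∨ f x = g x)) hconst
      (fun x y z _ _ _ h1 h2 => h2.trans h1) (fun x y _ _ h1 => h1.symm) hx h0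
    exact this.1 (Or.inl rfl)
  intro x hx
  exact (hcl x hx.1).resolve_left hx.2

section
variable {U : Set ℂ} {G : ℂ → ℂ} {J : ℂ → ℂ → ℂ}

theorem psi_bd (h : Rie U G) {x0 : ℝ} (hx0 : 0 < x0) :
    ∃ C : ℝ, ∀ w : ℂ, x0 ≤ w.re → ‖psi G w - w‖ ≤ C := by
  have hsub : closedBall (0:ℂ) (Real.exp (-x0)) ⊆ ball 0 1 := by
    apply closedBall_subset_ball
    rw [← Real.exp_zero]; exact Real.exp_lt_exp.2 (by linarith)
  obtain ⟨C, hC⟩ := (isCompact_closedBall (0:ℂ) (Real.exp (-x0))).exists_bound_of_continuousOn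
    (h.diff.continuousOn.mono hsub)
  refine ⟨C, fun w hw => ?_⟩
  rw [psi, add_sub_cancel_left]
  apply hC
  rw [mem_closedBall_zero_iff, Complex.norm_exp, Complex.neg_re]
  exact Real.exp_le_exp.2 (by linarith)

theorem ray_re (h : Rie U G) {w : ℂ} (hw : 0 < w.re) :
    ∃ M : ℝ, ∀ r : ℝ, 0 ≤ r → M ≤ (psi G (w + r)).re := by
  obtain ⟨C, hC⟩ := psi_bd h hw
  refine ⟨-C, fun r hr => ?_⟩
  have h1 : (w + (r:ℂ)).re = w.re + r := by simp
  have h2 := (Complex.abs_re_le_norm _).trans (hC (w + r) (by rw [h1]; linarith))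
  rw [Complex.sub_re, h1] at h2
  linarith [(abs_le.1 h2).1]

theorem ray_far (h : Rie U G) {w b : ℂ} (hw : 0 < w.re) (hb : ∀ r : ℝ, 0 ≤ r → psi G (w + r) ≠ b) :
    ∃ ε : ℝ, 0 < ε ∧ ∀ r : ℝ, 0 ≤ r → ε ≤ ‖psi G (w + r) - b‖ := by
  obtain ⟨C, hC⟩ := psi_bd h hw
  have hc : ContinuousOn (fun r : ℝ => ‖psi G (w + r) - b‖) (Icc 0 (|C| + ‖b‖ + 1)) :=
    (((psi_contr h hw).mono Icc_subset_Ici_self).sub continuousOn_const).norm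
  obtain ⟨r1, hr1, hmin⟩ := isCompact_Icc.exists_isMinOn
    ⟨0, by constructor <;> positivity⟩ hc
  refine ⟨min 1 ‖psi G (w + r1) - b‖, lt_min one_pos
    (norm_pos_iff.2 (sub_ne_zero.2 (hb r1 hr1.1))), fun r hr => ?_⟩
  rcases le_total r (|C| + ‖b‖ + 1) with hle | hle
  · exact (min_le_right _ _).trans (hmin ⟨hr, hle⟩)
  · refine (min_le_left _ _).trans ?_
    have h1 : (w + (r:ℂ)).re = w.re + r := by simp
    have h2 := (Complex.abs_re_le_norm _).trans (hC (w + r) (by rw [h1]; linarith))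
    rw [Complex.sub_re, h1] at h2
    have h3 := Complex.re_le_norm (psi G (w + r) - b)
    rw [Complex.sub_re] at h3
    have h4 := Complex.re_le_norm b
    linarith [(abs_le.1 h2).1, le_abs_self C]

theorem off_of_nU (h : Rie U G) {w b : ℂ} (hw : 0 < w.re) (hb : Complex.exp b ∉ U) :
    OffR G (b, w) := ⟨hw, fun r hr (he : psi G (w + r) = b) => hb (by
      rw [← he]
      exact psi_mem h (by simp only [Complex.add_re, Complex.ofReal_re]; linarith))⟩

/-- generic identification of a logarithm of `c - q x`. -/
theorem gen_log (h : Rie U G) (hJ : IsJ G J) {P : Set ℂ} (hP : IsPreconnected P) (h0 : (0:ℂ) ∈ P)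
    {c : ℂ} {y η : ℝ} (hl : Lands G y c) (hη : 0 < η) {q M : ℂ → ℂ}
    (hq : ContinuousOn q (P \ {0})) (hqU : ∀ x ∈ P \ {0}, Complex.exp (q x) ∉ U)
    (hqη : ∀ x ∈ P \ {0}, η ≤ ‖c - q x‖)
    (hqre : ∀ m : ℝ, ∃ δ : ℝ, 0 < δ ∧ ∀ x ∈ P \ {0}, ‖x‖ < δ → (q x).re < m)
    (hM : ContinuousOn M (P \ {0})) (hMe : ∀ x ∈ P \ {0}, Complex.exp (M x) = c - q x)
    (hMn : ∃ δ : ℝ, 0 < δ ∧ ∀ x ∈ P \ {0}, ‖x‖ < δ → |(M x).im| < Real.pi / 2) :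
    ∀ᶠ s : ℝ in 𝓝[>] 0, ∀ x ∈ P \ {0},
      M x = J (q x) ⟨s, y⟩ + Complex.log ((c - q x) / (psi G ⟨s, y⟩ - q x)) := by
  have hpos : ∀ᶠ s : ℝ in 𝓝[>] 0, 0 < s := self_mem_nhdsWithin
  filter_upwards [hl (closedBall_mem_nhds c (by positivity : 0 < η / 4)), hpos] with s hs hs0
  rw [mem_preimage, mem_closedBall, dist_eq_norm] at hs
  set w : ℂ := ⟨s, y⟩ with hw
  have hwre : 0 < w.re := hs0
  have hr : ∀ x ∈ P \ {0}, 0 < ((c - q x) / (psi G w - q x)).re := by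
    intro x hx
    have h1 := hqη x hx
    apply re_ratio (p := c - q x) (norm_pos_iff.1 (hη.trans_le h1)) (by
      rw [sub_self, norm_zero]; positivity)
    rw [sub_sub_sub_cancel_right]; linarith
  have hoff : ∀ x ∈ P \ {0}, OffR G (q x, w) := fun x hx => off_of_nU h hwre (hqU x hx)
  obtain ⟨δ1, hδ1, hn1⟩ := hMn
  obtain ⟨m, hm⟩ := ray_re h hwre
  obtain ⟨δ2, hδ2, hn2⟩ := hqre m
  have hexp : ∀ x ∈ P \ {0}, Complex.exp (M x) =
      Complex.exp (J (q x) w + Complex.log ((c - q x) / (psi G w - q x))) := by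
    intro x hx
    rw [hMe x hx, Complex.exp_add, Complex.exp_log (ne_zero_of_re (hr x hx)),
      hJ.exp _ _ (hoff x hx)]
    have : psi G w - q x ≠ 0 := fun hh => by have := hr x hx; rw [hh] at this; simp at this
    field_simp
  refine conn_log hP h0 hM ?_ hexp (lt_min hδ1 hδ2) ?_
  · refine (hJ.cont.comp (f := fun x => (q x, w)) (hq.prodMk continuousOn_const)
      (fun x hx => hoff x hx)).add (ContinuousOn.clog ?_ (fun x hx => Or.inl (hr x hx)))
    refine (continuousOn_const.sub hq).div (continuousOn_const.sub hq) (fun x hx hh => ?_)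
    have := hr x hx; rw [hh] at this; simp at this
  · intro x hx hxn
    apply exp_inj_close (hexp x hx)
    have i1 := abs_lt.1 (hn1 x hx (hxn.trans_le (min_le_left _ _)))
    have i2 := abs_lt.1 (im_log_lt (hr x hx))
    have i3 := abs_lt.1 (hJ.im_lt h (ζ := q x) hwre (fun r hr => by
      have h1 := hm r hr
      have h2 := hn2 x hx (hxn.trans_le (min_le_right _ _))
      rw [Complex.sub_re]; linarith))
    rw [Complex.add_im, abs_lt]
    constructor <;> linarith [i1.1, i1.2, i2.1, i2.2, i3.1, i3.2]

/-- link between two landing lines. -/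
theorem link (h : Rie U G) (hJ : IsJ G J) {a b : ℂ} {y y' : ℝ} (hab : a ≠ b) (hy : y ≠ y')
    (hl : Lands G y a) (hl' : Lands G y' b) (hb : Complex.exp b ∉ U) :
    ∃ s0 : ℝ, 0 < s0 ∧ ∀ s ∈ Ioo 0 s0, ∀ s' ∈ Ioo 0 s0,
      J b ⟨s, y⟩ = J (psi G ⟨s', y'⟩) ⟨s, y⟩ +
        Complex.log ((psi G ⟨s, y⟩ - b) / (psi G ⟨s, y⟩ - psi G ⟨s', y'⟩)) := by
  have hε : 0 < ‖a - b‖ / 8 := div_pos (norm_pos_iff.2 (sub_ne_zero.2 hab)) (by norm_num)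
  obtain ⟨s1, hs1, h1⟩ := mem_nhdsGT_iff_exists_Ioo_subset.1 (hl (closedBall_mem_nhds a hε))
  obtain ⟨s2, hs2, h2⟩ := mem_nhdsGT_iff_exists_Ioo_subset.1 (hl' (closedBall_mem_nhds b hε))
  have hs1' : 0 < s1 := hs1
  have hs2' : 0 < s2 := hs2
  set s0 := min s1 s2 with hs0
  have hs0p : 0 < s0 := lt_min hs1' hs2'
  have hz : ∀ s ∈ Ioo 0 s0, ‖psi G ⟨s, y⟩ - a‖ ≤ ‖a - b‖ / 8 := fun s hs => by
    have := h1 ⟨hs.1, hs.2.trans_le (min_le_left _ _)⟩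
    rwa [mem_preimage, mem_closedBall, dist_eq_norm] at this
  have hz' : ∀ s ∈ Ioo 0 s0, ‖psi G ⟨s, y'⟩ - b‖ ≤ ‖a - b‖ / 8 := fun s hs => by
    have := h2 ⟨hs.1, hs.2.trans_le (min_le_right _ _)⟩
    rwa [mem_preimage, mem_closedBall, dist_eq_norm] at this
  have hr : ∀ s ∈ Ioo 0 s0, ∀ s' ∈ Ioo 0 s0,
      0 < ((psi G ⟨s, y⟩ - b) / (psi G ⟨s, y⟩ - psi G ⟨s', y'⟩)).re := by
    intro s hs s' hs'
    apply re_ratio (p := a - b) (sub_ne_zero.2 hab)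
    · rw [sub_sub_sub_cancel_right]; linarith [hz s hs]
    · have : (psi G ⟨s, y⟩ - psi G ⟨s', y'⟩) - (a - b) =
        (psi G ⟨s, y⟩ - a) - (psi G ⟨s', y'⟩ - b) := by ring
      rw [this]; exact (norm_sub_le _ _).trans (by linarith [hz s hs, hz' s' hs'])
  refine ⟨s0, hs0p, ?_⟩
  set σ := s0 / 2 with hσ
  have hσm : σ ∈ Ioo 0 s0 := ⟨by rw [hσ]; linarith, by rw [hσ]; linarith⟩
  have hoffb : ∀ s : ℝ, 0 < s → OffR G (b, ⟨s, y⟩) := fun s hs => off_of_nU h hs hb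
  obtain ⟨ε, hεp, hfar⟩ := ray_far h (w := ⟨σ, y⟩) hσm.1 (hoffb σ hσm.1).2
  obtain ⟨σ', hσ'm, hσ'b⟩ : ∃ σ' ∈ Ioo 0 s0, ‖psi G ⟨σ', y'⟩ - b‖ < ε := by
    have e1 : ∀ᶠ x : ℝ in 𝓝[>] 0, psi G ⟨x, y'⟩ ∈ ball b ε := hl' (ball_mem_nhds b hεp)
    have e2 : ∀ᶠ x : ℝ in 𝓝[>] 0, x ∈ Ioo 0 s0 := Ioo_mem_nhdsGT hs0p
    obtain ⟨σ', h3, h4⟩ := (e1.and e2).exists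
    exact ⟨σ', h4, by rwa [mem_ball, dist_eq_norm] at h3⟩
  have hql := hJ.ql h (ζ1 := b) (ζ2 := psi G ⟨σ', y'⟩) (w := ⟨σ, y⟩) hσm.1 (fun r hr hm => by
    have hsub : segment ℝ b (psi G ⟨σ', y'⟩) ⊆ ball b ε :=
      (convex_ball b ε).segment_subset (mem_ball_self hεp) (by rwa [mem_ball, dist_eq_norm])
    have := hsub hm
    rw [mem_ball, dist_eq_norm] at this
    linarith [hfar r hr])
  have hmk : ∀ {v : ℝ} (f : ℝ × ℝ → ℝ), Continuous f → Continuous (fun p => (⟨f p, v⟩ : ℂ)) := by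
    intro v f hf
    simp only [Complex.mk_eq_add_mul_I]
    fun_prop
  have hc1 : ContinuousOn (fun p : ℝ × ℝ => psi G ⟨p.1, y⟩) (Ioo 0 s0 ×ˢ Ioo 0 s0) :=
    (psi_diff h).continuousOn.comp (hmk _ continuous_fst).continuousOn (fun p hp => hp.1.1)
  have hc2 : ContinuousOn (fun p : ℝ × ℝ => psi G ⟨p.2, y'⟩) (Ioo 0 s0 ×ˢ Ioo 0 s0) :=
    (psi_diff h).continuousOn.comp (hmk _ continuous_snd).continuousOn (fun p hp => hp.2.1)
  have hne : ∀ p ∈ Ioo 0 s0 ×ˢ Ioo 0 s0, psi G ⟨p.1, y⟩ - psi G ⟨p.2, y'⟩ ≠ 0 := by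
    intro p hp hh
    have := hr p.1 hp.1 p.2 hp.2
    rw [hh] at this; simp at this
  have hoff : ∀ p ∈ Ioo 0 s0 ×ˢ Ioo 0 s0, OffR G (psi G ⟨p.2, y'⟩, ⟨p.1, y⟩) := fun p hp =>
    offR_psi h hp.1.1 hp.2.1 hy
  have hu := log_unique (S := Ioo 0 s0 ×ˢ Ioo 0 s0) (isPreconnected_Ioo.prod isPreconnected_Ioo)
    (g1 := fun p : ℝ × ℝ => J b ⟨p.1, y⟩)
    (g2 := fun p : ℝ × ℝ => J (psi G ⟨p.2, y'⟩) ⟨p.1, y⟩ +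
        Complex.log ((psi G ⟨p.1, y⟩ - b) / (psi G ⟨p.1, y⟩ - psi G ⟨p.2, y'⟩)))
    (hJ.cont.comp (f := fun p : ℝ × ℝ => (b, (⟨p.1, y⟩ : ℂ)))
      (continuousOn_const.prodMk (hmk _ continuous_fst).continuousOn) (fun p hp => hoffb _ hp.1.1))
    ((hJ.cont.comp (f := fun p : ℝ × ℝ => (psi G ⟨p.2, y'⟩, (⟨p.1, y⟩ : ℂ)))
      (hc2.prodMk (hmk _ continuous_fst).continuousOn) (fun p hp => hoff p hp)).add
      (((hc1.sub continuousOn_const).div (hc1.sub hc2) hne).clog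
        (fun p hp => Or.inl (hr p.1 hp.1 p.2 hp.2))))
    (fun p hp => by
      rw [hJ.exp _ _ (hoffb _ hp.1.1), Complex.exp_add, hJ.exp _ _ (hoff p hp),
        Complex.exp_log (ne_zero_of_re (hr p.1 hp.1 p.2 hp.2))]
      have := hne p hp
      field_simp)
    (z0 := (σ, σ')) ⟨hσm, hσ'm⟩ hql
  intro s hs s' hs'
  exact hu (s, s') ⟨hs, hs'⟩

end


/-- combinatorial data at a single time. -/
structure Tim (P U : Set ℂ) (G l : ℂ → ℂ) (LL : ℤ → ℂ → ℂ → ℂ) : Prop where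
  rie : Rie U G
  conn : IsPreconnected P
  zero : (0:ℂ) ∈ P
  lc : ContinuousOn l (P \ {0})
  nU : ∀ x ∈ P \ {0}, Complex.exp (l x) ∉ U
  re : ∀ m : ℝ, ∃ δ : ℝ, 0 < δ ∧ ∀ x ∈ P \ {0}, ‖x‖ < δ → (l x).re < m
  sep : ∀ x ∈ P \ {0}, ∃ η : ℝ, 0 < η ∧ ∀ x' ∈ P \ {0}, ∀ k : ℤ, 1 ≤ k →
    η ≤ ‖l x - l x' + k * (2 * Real.pi * Complex.I)‖ ∧ η ≤ ‖l x' - l x + k * (2 * Real.pi * Complex.I)‖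
  Lc1 : ∀ k : ℤ, 1 ≤ k → ∀ x ∈ P \ {0}, ContinuousOn (fun x' => LL k x x') (P \ {0})
  Lc2 : ∀ k : ℤ, 1 ≤ k → ∀ x' ∈ P \ {0}, ContinuousOn (fun x => LL k x x') (P \ {0})
  Le : ∀ k : ℤ, 1 ≤ k → ∀ x ∈ P \ {0}, ∀ x' ∈ P \ {0},
    Complex.exp (LL k x x') = l x - l x' + k * (2 * Real.pi * Complex.I)
  N1 : ∀ k : ℤ, 1 ≤ k → ∀ x ∈ P \ {0}, ∃ δ : ℝ, 0 < δ ∧ ∀ x' ∈ P \ {0}, ‖x'‖ < δ →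
    |(LL k x x').im| < Real.pi / 2
  N2 : ∀ k : ℤ, 1 ≤ k → ∀ x' ∈ P \ {0}, ∃ δ : ℝ, 0 < δ ∧ ∀ x ∈ P \ {0}, ‖x‖ < δ →
    |(LL k x x').im - Real.pi| < Real.pi / 2

theorem exp_per (a : ℂ) (k : ℤ) : Complex.exp (a + k * (2 * Real.pi * Complex.I)) = Complex.exp a := by
  rw [Complex.exp_eq_exp_iff_exists_int]; exact ⟨k, rfl⟩

theorem exp_per_sub (a : ℂ) (k : ℤ) : Complex.exp (a - k * (2 * Real.pi * Complex.I)) = Complex.exp a := by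
  rw [Complex.exp_eq_exp_iff_exists_int]; exact ⟨-k, by push_cast; ring⟩

theorem Tim.ord {P U : Set ℂ} {G l : ℂ → ℂ} {LL : ℤ → ℂ → ℂ → ℂ} (T : Tim P U G l LL)
    {x x' : ℂ} (hx : x ∈ P \ {0}) (hx' : x' ∈ P \ {0}) {k : ℤ} (hk : 1 ≤ k) {y y' : ℝ}
    (hl : Lands G y (l x)) (hl' : Lands G y' (l x' - k * (2 * Real.pi * Complex.I))) : y' < y := by
  obtain ⟨J, hJ⟩ := exists_J T.rie
  have h := T.rie
  by_contra hcon
  push Not at hcon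
  set b := l x' - k * (2 * Real.pi * Complex.I) with hb
  obtain ⟨η, hη, hs1⟩ := T.sep x hx
  obtain ⟨η', hη', hs2⟩ := T.sep x' hx'
  have hab : l x ≠ b := by
    intro hh
    have := (hs1 x' hx' k hk).1
    have h2 : l x - l x' + k * (2 * Real.pi * Complex.I) = 0 := by rw [hh, hb]; ring
    rw [h2, norm_zero] at this
    linarith
  have hyy : y ≠ y' := by
    rintro rfl
    exact hab (tendsto_nhds_unique hl hl')
  have hlt : y < y' := lt_of_le_of_ne hcon hyy
  have hUa : Complex.exp (l x) ∉ U := T.nU x hx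
  have hUb : Complex.exp b ∉ U := by rw [hb, exp_per_sub]; exact T.nU x' hx'
  have g1 := gen_log h hJ T.conn T.zero hl hη (q := fun x' => l x' - k * (2 * Real.pi * Complex.I))
    (M := fun x' => LL k x x') (T.lc.sub continuousOn_const)
    (fun x' hx' => by rw [exp_per_sub]; exact T.nU x' hx')
    (fun x' hx' => by
      have := (hs1 x' hx' k hk).1
      rwa [show l x - (l x' - k * (2 * Real.pi * Complex.I)) = l x - l x' + k * (2 * Real.pi * Complex.I) by ring])
    (fun m => by
      obtain ⟨δ, hδ, hh⟩ := T.re m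
      refine ⟨δ, hδ, fun x' hx' hn => ?_⟩
      have := hh x' hx' hn
      simpa using this)
    (T.Lc1 k hk x hx) (fun x' hx' => by rw [T.Le k hk x hx x' hx']; ring) (T.N1 k hk x hx)
  have g2 := gen_log h hJ T.conn T.zero hl' hη' (q := l)
    (M := fun x => LL k x x' - Real.pi * Complex.I) T.lc T.nU
    (fun x hx => by
      have := (hs2 x hx k hk).2
      rw [hb, ← norm_neg]
      rwa [show -(l x' - k * (2 * Real.pi * Complex.I) - l x) = l x - l x' + k * (2 * Real.pi * Complex.I) by ring])
    T.re ((T.Lc2 k hk x' hx').sub continuousOn_const)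
    (fun x hx => by
      rw [Complex.exp_sub, T.Le k hk x hx x' hx', Complex.exp_pi_mul_I, hb]; ring)
    (by
      obtain ⟨δ, hδ, hh⟩ := T.N2 k hk x' hx'
      exact ⟨δ, hδ, fun x hx hn => by simpa using hh x hx hn⟩)
  obtain ⟨σ1, hσ1, k1⟩ := link h hJ hab hyy hl hl' hUb
  obtain ⟨σ2, hσ2, k2⟩ := link h hJ hab.symm hyy.symm hl' hl hUa
  have hε : 0 < ‖l x - b‖ / 8 := div_pos (norm_pos_iff.2 (sub_ne_zero.2 hab)) (by norm_num)
  have c1 : ∀ᶠ s : ℝ in 𝓝[>] 0, psi G ⟨s, y⟩ ∈ closedBall (l x) (‖l x - b‖ / 8) :=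
    hl (closedBall_mem_nhds _ hε)
  have c2 : ∀ᶠ s : ℝ in 𝓝[>] 0, psi G ⟨s, y'⟩ ∈ closedBall b (‖l x - b‖ / 8) :=
    hl' (closedBall_mem_nhds _ hε)
  have e1 : ∀ᶠ s : ℝ in 𝓝[>] 0, s ∈ Ioo 0 σ1 := Ioo_mem_nhdsGT hσ1
  have e2 : ∀ᶠ s : ℝ in 𝓝[>] 0, s ∈ Ioo 0 σ2 := Ioo_mem_nhdsGT hσ2
  obtain ⟨s, ⟨⟨⟨⟨⟨f1, f2⟩, f3⟩, f4⟩, f5⟩, f6⟩⟩ :=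
    (((((g1.and g2).and c1).and c2).and e1).and e2).exists
  have q1 := f1 x' hx'
  have q2 := f2 x hx
  rw [← hb] at q1
  have q3 := k1 s f5 s f5
  have q4 := k2 s f6 s f6
  rw [mem_closedBall, dist_eq_norm] at f3 f4
  have q5 := four_log hab f3 f4
  have q6 := hJ.swap h (w := ⟨s, y'⟩) (w' := ⟨s, y⟩) f5.1 f5.1 hlt
  have hfin : (2 * (Real.pi * Complex.I) : ℂ) = 0 := by
    linear_combination q1 - q2 + q3 - q4 - q6 + q5
  have := congrArg Complex.im hfin
  simp at this

/-- membership data: everything landing. -/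
theorem lands_shift {G : ℂ → ℂ} {y : ℝ} {a : ℂ} (hl : Lands G y a) (n : ℤ) :
    Lands G (y + n * (2 * Real.pi)) (a + n * (2 * Real.pi * Complex.I)) := by
  have : (fun x : ℝ => psi G ⟨x, y + n * (2 * Real.pi)⟩) = fun x : ℝ => psi G ⟨x, y⟩ + n * (2 * Real.pi * Complex.I) := by
    funext x
    rw [← psi_per]
    congr 1
    apply Complex.ext <;> simp
  unfold Lands
  rw [this]
  exact hl.add_const _

theorem Tim.ord' {P U : Set ℂ} {G l : ℂ → ℂ} {LL : ℤ → ℂ → ℂ → ℂ} (T : Tim P U G l LL)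
    {x x' : ℂ} (hx : x ∈ P \ {0}) (hx' : x' ∈ P \ {0}) {n n' : ℤ} (hn : 0 ≤ n) (hn' : n' < 0)
    {y y' : ℝ} (hl : Lands G y (l x + n * (2 * Real.pi * Complex.I))) (hl' : Lands G y' (l x' + n' * (2 * Real.pi * Complex.I))) : y' < y := by
  have h1 := lands_shift hl (-n)
  have h2 := lands_shift hl' (-n)
  have h3 := T.ord hx hx' (k := n - n') (by omega) (y := y + (-n : ℤ) * (2 * Real.pi))
    (y' := y' + (-n : ℤ) * (2 * Real.pi))
    (by convert h1 using 1; push_cast; ring) (by convert h2 using 1; push_cast; ring)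
  linarith


/-- the initial data. -/
structure T0 (K : Set ℂ) (G : ℂ → ℂ) (y0 : ℝ) : Prop where
  cpt : IsCompact K
  rie : Rie (unbddComp K) G
  fr : K ⊆ closure (unbddComp K)
  lim : Tendsto (fun x : ℝ => (psi G ⟨x, y0⟩).re) (𝓝[>] 0) atBot

/-- the upper part. -/
def clA (G : ℂ → ℂ) (y0 : ℝ) : Set ℂ := closure (psi G '' {w | 0 < w.re ∧ y0 < w.im})
/-- the lower part. -/
def clB (G : ℂ → ℂ) (y0 : ℝ) : Set ℂ := closure (psi G '' {w | 0 < w.re ∧ w.im < y0})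

/-- admissible radius. -/
def Rad (G : ℂ → ℂ) (y0 : ℝ) (a : ℂ) (ρ : ℝ) : Prop :=
  0 < ρ ∧ ∀ x : ℝ, 0 < x → ρ ≤ ‖psi G ⟨x, y0⟩ - a‖

namespace T0
variable {K : Set ℂ} {G : ℂ → ℂ} {y0 : ℝ}

theorem bdL (T : T0 K G y0) (M : ℝ) : ∃ c B : ℝ, 0 < c ∧ (∀ x : ℝ, 0 < x → x < c → (psi G ⟨x, y0⟩).re < M) ∧
    ∀ x : ℝ, 0 < x → M ≤ (psi G ⟨x, y0⟩).re → |(psi G ⟨x, y0⟩).im| ≤ B := by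
  have e : ∀ᶠ x : ℝ in 𝓝[>] 0, (psi G ⟨x, y0⟩).re < M := T.lim (Iio_mem_atBot M)
  obtain ⟨c, hc, hh⟩ := mem_nhdsGT_iff_exists_Ioo_subset.1 e
  have hc' : (0:ℝ) < c := hc
  obtain ⟨C, hC⟩ := psi_bd T.rie hc'
  refine ⟨c, |y0| + C, hc', fun x h1 h2 => hh ⟨h1, h2⟩, fun x hx hM => ?_⟩
  have hcx : c ≤ x := by
    by_contra hlt
    push Not at hlt
    have : (psi G ⟨x, y0⟩).re < M := hh ⟨hx, hlt⟩
    linarith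
  have h1 := (Complex.abs_im_le_norm _).trans (hC ⟨x, y0⟩ hcx)
  rw [Complex.sub_im] at h1
  have h2 := abs_add_le ((psi G ⟨x, y0⟩).im - y0) y0
  rw [sub_add_cancel] at h2
  simp only at h1
  linarith

theorem rho (T : T0 K G y0) {a : ℂ} (ha : Complex.exp a ∉ unbddComp K) : ∃ ρ, Rad G y0 a ρ := by
  obtain ⟨c, B, hc, h1, -⟩ := T.bdL (a.re - 1)
  have hcr : 0 < (⟨c, y0⟩ : ℂ).re := hc
  obtain ⟨ε, hε, h2⟩ := ray_far T.rie hcr (off_of_nU T.rie hcr ha).2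
  refine ⟨min 1 ε, lt_min one_pos hε, fun x hx => ?_⟩
  rcases lt_or_ge x c with hlt | hge
  · have := h1 x hx hlt
    refine (min_le_left _ _).trans ?_
    have h3 := Complex.abs_re_le_norm (psi G ⟨x, y0⟩ - a)
    rw [Complex.sub_re] at h3
    have h4 := neg_le_abs ((psi G ⟨x, y0⟩).re - a.re)
    linarith
  · refine (min_le_right _ _).trans ?_
    have := h2 (x - c) (by linarith)
    have he : (⟨c, y0⟩ : ℂ) + ((x - c : ℝ) : ℂ) = ⟨x, y0⟩ := by
      apply Complex.ext <;> simp
    rwa [he] at this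

theorem sep (T : T0 K G y0) {C : Set ℂ} (hC : Convex ℝ C)
    (hL : ∀ x : ℝ, 0 < x → psi G ⟨x, y0⟩ ∉ C) {w1 w2 : ℂ} (h1 : 0 < w1.re) (h2 : 0 < w2.re)
    (i1 : y0 < w1.im) (i2 : w2.im < y0) (m1 : psi G w1 ∈ C) (m2 : psi G w2 ∈ C) : False := by
  obtain ⟨J, hJ⟩ := exists_J T.rie
  obtain ⟨M1, hM1⟩ := ray_re T.rie h1
  obtain ⟨M2, hM2⟩ := ray_re T.rie h2
  obtain ⟨c, B, hc, hcc, -⟩ := T.bdL (min M1 M2)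
  have hx : 0 < c / 2 := by linarith
  have hlt := hcc (c / 2) hx (by linarith)
  rw [lt_min_iff] at hlt
  set w : ℂ := ⟨c / 2, y0⟩ with hw
  have hwr : 0 < w.re := hx
  have hseg : ∀ r : ℝ, 0 ≤ r → psi G (w + r) ∉ segment ℝ (psi G w1) (psi G w2) := by
    intro r hr hm
    have he : w + (r : ℂ) = ⟨c / 2 + r, y0⟩ := by apply Complex.ext <;> simp [hw]
    rw [he] at hm
    exact hL _ (by linarith) (hC.segment_subset m1 m2 hm)
  have q1 := hJ.ql T.rie hwr hseg
  have q2 := hJ.swap T.rie h1 hwr i1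
  have q3 := hJ.swap T.rie hwr h2 i2
  have b1 := hJ.im_lt T.rie (ζ := psi G w) h1 (fun r hr => by
    rw [Complex.sub_re]; linarith [hM1 r hr])
  have b2 := hJ.im_lt T.rie (ζ := psi G w) h2 (fun r hr => by
    rw [Complex.sub_re]; linarith [hM2 r hr])
  have b3 := Complex.neg_pi_lt_log_im ((psi G w - psi G w1) / (psi G w - psi G w2))
  have q4 : (J (psi G w) w1).im = (J (psi G w) w2).im + 2 * Real.pi +
      (Complex.log ((psi G w - psi G w1) / (psi G w - psi G w2))).im := by
    have : J (psi G w) w1 = J (psi G w) w2 + (2 * Real.pi : ℝ) * Complex.I +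
      (Complex.log ((psi G w - psi G w1) / (psi G w - psi G w2))) := by
      push_cast
      linear_combination q2 + q1 + q3
    rw [this]
    simp
  rw [abs_lt] at b1 b2
  linarith [b1.2, b2.1]

theorem same (T : T0 K G y0) {C : Set ℂ} (hC : Convex ℝ C) (hCo : IsOpen C)
    (hL : ∀ x : ℝ, 0 < x → psi G ⟨x, y0⟩ ∉ C) {a b : ℂ} (ha : a ∈ C) (hb : b ∈ C)
    (hA : a ∈ clA G y0) (hB : b ∈ clB G y0) : False := by
  obtain ⟨_, ⟨h1, ⟨w1, ⟨r1, i1⟩, rfl⟩⟩⟩ := mem_closure_iff.1 hA C hCo ha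
  obtain ⟨_, ⟨h2, ⟨w2, ⟨r2, i2⟩, rfl⟩⟩⟩ := mem_closure_iff.1 hB C hCo hb
  exact T.sep hC hL r1 r2 i1 i2 h1 h2

theorem same_ball (T : T0 K G y0) {c : ℂ} {ρ : ℝ} (hr : Rad G y0 c ρ) {a b : ℂ} (ha : ‖a - c‖ < ρ)
    (hb : ‖b - c‖ < ρ) (hA : a ∈ clA G y0) (hB : b ∈ clB G y0) : False := by
  refine T.same (convex_ball c ρ) isOpen_ball (fun x hx hm => ?_) (a := a) (b := b) ?_ ?_ hA hB
  · rw [mem_ball, dist_eq_norm] at hm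
    linarith [hr.2 x hx]
  · rwa [mem_ball, dist_eq_norm]
  · rwa [mem_ball, dist_eq_norm]

theorem near (T : T0 K G y0) {a : ℂ} (ha : Complex.exp a ∈ K) {ε : ℝ} (hε : 0 < ε) :
    ∃ w : ℂ, 0 < w.re ∧ ‖psi G w - a‖ < ε := by
  have h1 : a ∈ closure (Complex.exp ⁻¹' (unbddComp K)) := by
    have ho : IsOpenMap Complex.exp := Complex.isOpenMap_exp
    rw [← ho.preimage_closure_eq_closure_preimage Complex.continuous_exp]
    exact T.fr ha
  obtain ⟨b, hb, hd⟩ := Metric.mem_closure_iff.1 h1 ε hε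
  obtain ⟨w, hw, rfl⟩ := psi_surj T.rie hb
  refine ⟨w, hw, ?_⟩
  rwa [dist_comm, dist_eq_norm] at hd

theorem nU (T : T0 K G y0) {a : ℂ} (ha : Complex.exp a ∈ K) : Complex.exp a ∉ unbddComp K :=
  fun h => h.1 ha

theorem cases (T : T0 K G y0) {a : ℂ} (ha : Complex.exp a ∈ K) : a ∈ clA G y0 ∨ a ∈ clB G y0 := by
  obtain ⟨ρ, hρ⟩ := T.rho (T.nU ha)
  by_contra hc
  push Not at hc
  have hA : ∃ ε > 0, ball a ε ⊆ (clA G y0)ᶜ :=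
    Metric.isOpen_iff.1 isClosed_closure.isOpen_compl a hc.1
  have hB : ∃ ε > 0, ball a ε ⊆ (clB G y0)ᶜ :=
    Metric.isOpen_iff.1 isClosed_closure.isOpen_compl a hc.2
  obtain ⟨e1, he1, h1⟩ := hA
  obtain ⟨e2, he2, h2⟩ := hB
  obtain ⟨w, hw, hn⟩ := T.near ha (ε := min ρ (min e1 e2)) (lt_min hρ.1 (lt_min he1 he2))
  rw [lt_min_iff, lt_min_iff] at hn
  have m1 : psi G w ∈ ball a e1 := by rw [mem_ball, dist_eq_norm]; exact hn.2.1
  have m2 : psi G w ∈ ball a e2 := by rw [mem_ball, dist_eq_norm]; exact hn.2.2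
  rcases lt_trichotomy w.im y0 with hi | hi | hi
  · exact h2 m2 (subset_closure ⟨w, ⟨hw, hi⟩, rfl⟩)
  · have := hρ.2 w.re hw
    rw [← hi] at this
    linarith [hn.1]
  · exact h1 m1 (subset_closure ⟨w, ⟨hw, hi⟩, rfl⟩)

theorem disj (T : T0 K G y0) {a : ℂ} (ha : Complex.exp a ∈ K) (hA : a ∈ clA G y0) (hB : a ∈ clB G y0) :
    False := by
  obtain ⟨ρ, hρ⟩ := T.rho (T.nU ha)
  exact T.same_ball hρ (by simpa using hρ.1) (by simpa using hρ.1) hA hB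

theorem nearA (T : T0 K G y0) {a : ℂ} (hA : a ∈ clA G y0) {ε : ℝ} (hε : 0 < ε) :
    ∃ w : ℂ, 0 < w.re ∧ y0 < w.im ∧ ‖psi G w - a‖ < ε := by
  obtain ⟨_, ⟨w, hw, rfl⟩, hd⟩ := Metric.mem_closure_iff.1 hA ε hε
  exact ⟨w, hw.1, hw.2, by rwa [dist_comm, dist_eq_norm] at hd⟩

theorem nearB (T : T0 K G y0) {a : ℂ} (hA : a ∈ clB G y0) {ε : ℝ} (hε : 0 < ε) :
    ∃ w : ℂ, 0 < w.re ∧ w.im < y0 ∧ ‖psi G w - a‖ < ε := by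
  obtain ⟨_, ⟨w, hw, rfl⟩, hd⟩ := Metric.mem_closure_iff.1 hA ε hε
  exact ⟨w, hw.1, hw.2, by rwa [dist_comm, dist_eq_norm] at hd⟩

theorem shiftA (T : T0 K G y0) {a : ℂ} (hA : a ∈ clA G y0) {n : ℤ} (hn : 0 ≤ n) :
    a + n * (2 * Real.pi * Complex.I) ∈ clA G y0 := by
  refine Metric.mem_closure_iff.2 (fun ε hε => ?_)
  obtain ⟨w, hw, hi, hd⟩ := T.nearA hA hε
  refine ⟨_, ⟨w + n * (2 * Real.pi * Complex.I), ⟨by simpa using hw, ?_⟩, rfl⟩, ?_⟩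
  · have : (w + n * (2 * Real.pi * Complex.I)).im = w.im + n * (2 * Real.pi) := by simp
    have hn' : (0:ℝ) ≤ n := by exact_mod_cast hn
    show y0 < (w + n * (2 * Real.pi * Complex.I)).im
    rw [this]
    have := Real.pi_pos
    nlinarith [mul_nonneg hn' this.le]
  · rw [psi_per, dist_comm, dist_eq_norm]
    simpa using hd

theorem shiftB (T : T0 K G y0) {a : ℂ} (hA : a ∈ clB G y0) {n : ℤ} (hn : n ≤ 0) :
    a + n * (2 * Real.pi * Complex.I) ∈ clB G y0 := by
  refine Metric.mem_closure_iff.2 (fun ε hε => ?_)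
  obtain ⟨w, hw, hi, hd⟩ := T.nearB hA hε
  refine ⟨_, ⟨w + n * (2 * Real.pi * Complex.I), ⟨by simpa using hw, ?_⟩, rfl⟩, ?_⟩
  · have : (w + n * (2 * Real.pi * Complex.I)).im = w.im + n * (2 * Real.pi) := by simp
    have hn' : (0:ℝ) ≤ -n := by
      have : (n:ℝ) ≤ 0 := by exact_mod_cast hn
      linarith
    show (w + n * (2 * Real.pi * Complex.I)).im < y0
    rw [this]
    have := Real.pi_pos
    nlinarith [mul_nonneg hn' this.le]
  · rw [psi_per, dist_comm, dist_eq_norm]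
    simpa using hd

theorem large (T : T0 K G y0) {a : ℂ} (ha : Complex.exp a ∈ K) :
    ∃ N : ℤ, 0 ≤ N ∧ (a + N * (2 * Real.pi * Complex.I) ∈ clA G y0) ∧ (a + (-N : ℤ) * (2 * Real.pi * Complex.I) ∈ clB G y0) := by
  obtain ⟨c, B, hc, -, hB⟩ := T.bdL (a.re - 1)
  obtain ⟨w, hw, hn⟩ := T.near ha one_pos
  obtain ⟨N, hN⟩ := exists_nat_gt (|B| + 1 + |a.im| + |w.im| + |y0|)
  have hpi := Real.pi_gt_three
  have a1 := abs_le.1 (le_refl |a.im|)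
  have a2 := abs_le.1 (le_refl |w.im|)
  have a3 := abs_le.1 (le_refl |y0|)
  have a4 := le_abs_self B
  have a5 := abs_nonneg B
  have hN0 : (0:ℝ) ≤ N := Nat.cast_nonneg N
  have key : ∀ n : ℤ, (N:ℝ) ≤ |(n:ℝ)| → ∀ x : ℝ, 0 < x → psi G ⟨x, y0⟩ ∉ ball (a + n * (2 * Real.pi * Complex.I)) 1 := by
    intro n hn x hx hm
    rw [mem_ball, dist_eq_norm] at hm
    have e1 := (Complex.abs_re_le_norm _).trans_lt hm
    have e2 := (Complex.abs_im_le_norm _).trans_lt hm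
    have r1 : (psi G ⟨x, y0⟩ - (a + n * (2 * Real.pi * Complex.I))).re = (psi G ⟨x, y0⟩).re - a.re := by simp
    have r2 : (psi G ⟨x, y0⟩ - (a + n * (2 * Real.pi * Complex.I))).im = (psi G ⟨x, y0⟩).im - (a.im + n * (2 * Real.pi)) := by
      simp
    rw [r1, abs_lt] at e1
    rw [r2, abs_lt] at e2
    have e3 := abs_le.1 (hB x hx (by linarith [e1.1]))
    rcases abs_cases (n:ℝ) with ⟨h1, h2⟩ | ⟨h1, h2⟩
    · nlinarith
    · nlinarith
  have hwr : ∀ n : ℤ, 0 < (w + n * (2 * Real.pi * Complex.I)).re := fun n => by simpa using hw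
  have hwi : ∀ n : ℤ, (w + n * (2 * Real.pi * Complex.I)).im = w.im + n * (2 * Real.pi) := fun n => by simp
  have hmem : ∀ n : ℤ, psi G (w + n * (2 * Real.pi * Complex.I)) ∈ ball (a + n * (2 * Real.pi * Complex.I)) 1 := fun n => by
    rw [mem_ball, dist_eq_norm, psi_per]; simpa using hn
  refine ⟨N, by positivity, ?_, ?_⟩
  · rcases T.cases (a := a + (N:ℤ) * (2 * Real.pi * Complex.I)) (by rwa [exp_per]) with h | h
    · exact h
    · exfalso
      refine T.same (convex_ball _ 1) isOpen_ball (key N (by simp)) (hmem N) (mem_ball_self one_pos)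
        (subset_closure ⟨_, ⟨hwr N, ?_⟩, rfl⟩) h
      show y0 < (w + (N:ℤ) * (2 * Real.pi * Complex.I)).im
      rw [hwi]
      push_cast
      nlinarith
  · rcases T.cases (a := a + (-N:ℤ) * (2 * Real.pi * Complex.I)) (by rwa [exp_per]) with h | h
    · exfalso
      refine T.same (convex_ball _ 1) isOpen_ball (key (-N) (by simp)) (mem_ball_self one_pos)
        (hmem (-N)) h (subset_closure ⟨_, ⟨hwr (-N), ?_⟩, rfl⟩)
      show (w + (-N:ℤ) * (2 * Real.pi * Complex.I)).im < y0
      rw [hwi]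
      push_cast
      nlinarith
    · exact h

theorem ex_l (T : T0 K G y0) : ∃ l : ℂ → ℂ, ∀ x ∈ K \ {0}, Complex.exp (l x) = x ∧
    l x ∈ clA G y0 ∧ l x + (-1 : ℤ) * (2 * Real.pi * Complex.I) ∈ clB G y0 := by
  have : ∀ x : ℂ, ∃ v : ℂ, x ∈ K \ {0} → Complex.exp v = x ∧ v ∈ clA G y0 ∧
      v + (-1 : ℤ) * (2 * Real.pi * Complex.I) ∈ clB G y0 := by
    intro x
    by_cases hx : x ∈ K \ {0}
    · have hlog : Complex.exp (Complex.log x) = x := Complex.exp_log hx.2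
      have hlK : Complex.exp (Complex.log x) ∈ K := by rw [hlog]; exact hx.1
      obtain ⟨N, hN0, hN, hN'⟩ := T.large hlK
      obtain ⟨n, hn, hleast⟩ := Int.exists_least_of_bdd
        (P := fun n : ℤ => Complex.log x + n * (2 * Real.pi * Complex.I) ∈ clA G y0) ⟨-N, fun z hz => by
          by_contra hlt
          push Not at hlt
          have := T.shiftB hN' (n := z + N) (by omega)
          refine T.disj (a := Complex.log x + z * (2 * Real.pi * Complex.I)) (by rwa [exp_per]) hz ?_
          convert this using 1
          push_cast; ring⟩ ⟨N, hN⟩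
      refine ⟨Complex.log x + n * (2 * Real.pi * Complex.I), fun _ => ⟨by rw [exp_per, hlog], hn, ?_⟩⟩
      have he : Complex.log x + n * (2 * Real.pi * Complex.I) + (-1 : ℤ) * (2 * Real.pi * Complex.I) = Complex.log x + (n - 1 : ℤ) * (2 * Real.pi * Complex.I) := by
        push_cast; ring
      rw [he]
      rcases T.cases (a := Complex.log x + (n - 1 : ℤ) * (2 * Real.pi * Complex.I)) (by rwa [exp_per]) with h | h
      · have := hleast _ h
        omega
      · exact h
    · exact ⟨0, fun h => absurd h hx⟩
  choose l hl using this
  exact ⟨l, hl⟩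

theorem l_cont (T : T0 K G y0) {l : ℂ → ℂ} (hl : ∀ x ∈ K \ {0}, Complex.exp (l x) = x ∧
    l x ∈ clA G y0 ∧ l x + (-1 : ℤ) * (2 * Real.pi * Complex.I) ∈ clB G y0) : ContinuousOn l (K \ {0}) := by
  intro x0 hx0
  obtain ⟨e0, eA, eB⟩ := hl x0 hx0
  have hx00 : x0 ≠ 0 := hx0.2
  obtain ⟨ρ1, h1⟩ := T.rho (a := l x0) (T.nU (by rw [e0]; exact hx0.1))
  obtain ⟨ρ2, h2⟩ := T.rho (a := l x0 + (-1 : ℤ) * (2 * Real.pi * Complex.I)) (T.nU (by rw [exp_per, e0]; exact hx0.1))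
  have hv : ContinuousAt (fun x => l x0 + Complex.log (x / x0)) x0 := by
    refine continuousAt_const.add (ContinuousAt.clog (by fun_prop) ?_)
    rw [div_self hx00]; exact Complex.one_mem_slitPlane
  have hv0 : l x0 + Complex.log (x0 / x0) = l x0 := by rw [div_self hx00]; simp
  have hn : ∀ᶠ x in 𝓝 x0, l x0 + Complex.log (x / x0) ∈ ball (l x0) (min ρ1 ρ2) :=
    hv.tendsto (by rw [hv0]; exact ball_mem_nhds _ (lt_min h1.1 h2.1))
  have heq : l =ᶠ[𝓝[K \ {0}] x0] fun x => l x0 + Complex.log (x / x0) := by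
    filter_upwards [nhdsWithin_le_nhds hn, self_mem_nhdsWithin] with x hx hxK
    rw [mem_ball, dist_eq_norm, lt_min_iff] at hx
    obtain ⟨f0, fA, fB⟩ := hl x hxK
    set v := l x0 + Complex.log (x / x0) with hvd
    have hev : Complex.exp v = x := by
      rw [hvd, Complex.exp_add, e0, Complex.exp_log (div_ne_zero hxK.2 hx00)]
      field_simp
    have vK : Complex.exp v ∈ K := by rw [hev]; exact hxK.1
    have vA : v ∈ clA G y0 := by
      rcases T.cases vK with h | h
      · exact h
      · exact (T.same_ball h1 (by simpa using h1.1) hx.1 eA h).elim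
    have vB : v + (-1 : ℤ) * (2 * Real.pi * Complex.I) ∈ clB G y0 := by
      rcases T.cases (a := v + (-1 : ℤ) * (2 * Real.pi * Complex.I)) (by rwa [exp_per]) with h | h
      · exact (T.same_ball h2 (by simpa using hx.2) (by simpa using h2.1) h eB).elim
      · exact h
    obtain ⟨m, hm⟩ := Complex.exp_eq_exp_iff_exists_int.1 (f0.trans hev.symm)
    have lK : Complex.exp (l x) ∈ K := by rw [f0]; exact hxK.1
    rcases lt_trichotomy m 0 with hm0 | hm0 | hm0
    · exfalso
      have := T.shiftB vB (n := m + 1) (by omega)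
      refine T.disj lK fA ?_
      rw [hm]
      convert this using 1
      push_cast; ring
    · rw [hm, hm0]; simp
    · exfalso
      have := T.shiftA vA (n := m - 1) (by omega)
      refine T.disj (a := l x + (-1 : ℤ) * (2 * Real.pi * Complex.I)) (by rwa [exp_per]) ?_ fB
      rw [hm]
      convert this using 1
      push_cast; ring
  have := hv.continuousWithinAt (s := K \ {0})
  refine this.congr_of_eventuallyEq heq hv0.symm

end T0


namespace T0
variable {K : Set ℂ} {G : ℂ → ℂ} {y0 : ℝ} {J : ℂ → ℂ → ℂ}

theorem far (T : T0 K G y0) {a b : ℂ} {ρ : ℝ} (hr : Rad G y0 a ρ)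
    (hA : a ∈ clA G y0) (hB : b ∈ clB G y0) : ρ ≤ ‖a - b‖ := by
  by_contra hlt
  push Not at hlt
  exact T.same_ball hr (by simpa using hr.1) (by rwa [norm_sub_rev]) hA hB

theorem far' (T : T0 K G y0) {a b : ℂ} {ρ : ℝ} (hr : Rad G y0 b ρ)
    (hA : a ∈ clA G y0) (hB : b ∈ clB G y0) : ρ ≤ ‖a - b‖ := by
  by_contra hlt
  push Not at hlt
  exact T.same_ball hr hlt (by simpa using hr.1) hA hB

theorem lam_eq (T : T0 K G y0) (hJ : IsJ G J) {a b w w' : ℂ} {ρ ρ' : ℝ}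
    (hA : a ∈ clA G y0) (hB : b ∈ clB G y0) (hr : Rad G y0 a ρ) (hr' : Rad G y0 b ρ')
    (hw : 0 < w.re) (hwi : y0 < w.im) (hwd : ‖psi G w - a‖ < ρ / 8)
    (hw' : 0 < w'.re) (hwi' : w'.im < y0) (hwd' : ‖psi G w' - b‖ < ρ' / 8) :
    J b w + Complex.log ((a - b) / (psi G w - b)) =
      J a w' + Real.pi * Complex.I + Complex.log ((b - a) / (psi G w' - a)) := by
  have f1 := T.far hr hA hB
  have f2 := T.far' hr' hA hB
  have hab : a ≠ b := by
    rintro rfl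
    rw [sub_self, norm_zero] at f1
    linarith [hr.1]
  have ad : ∀ (u : ℂ) (r : ℝ), (u + (r:ℂ)).re = u.re + r ∧ (u + (r:ℂ)).im = u.im := fun u r => by simp
  have q1 := hJ.ql T.rie (ζ1 := b) (ζ2 := psi G w') hw (fun r hr0 hm => by
    have hin : psi G (w + r) ∈ ball b ρ' := (convex_ball b ρ').segment_subset
      (mem_ball_self hr'.1) (by rw [mem_ball, dist_eq_norm]; linarith [hr'.1]) hm
    rw [mem_ball, dist_eq_norm] at hin
    refine T.same_ball hr' hin (by simpa using hr'.1) (subset_closure ⟨_, ⟨?_, ?_⟩, rfl⟩) hB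
    · rw [(ad w r).1]; linarith
    · rw [(ad w r).2]; exact hwi)
  have q2 := hJ.ql T.rie (ζ1 := a) (ζ2 := psi G w) hw' (fun r hr0 hm => by
    have hin : psi G (w' + r) ∈ ball a ρ := (convex_ball a ρ).segment_subset
      (mem_ball_self hr.1) (by rw [mem_ball, dist_eq_norm]; linarith [hr.1]) hm
    rw [mem_ball, dist_eq_norm] at hin
    refine T.same_ball hr (by simpa using hr.1) hin hA (subset_closure ⟨_, ⟨?_, ?_⟩, rfl⟩)
    · rw [(ad w' r).1]; linarith
    · rw [(ad w' r).2]; exact hwi')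
  have q3 := hJ.swap T.rie hw hw' (by linarith)
  have q4 := four_log hab (z := psi G w) (z' := psi G w') (by linarith) (by linarith)
  linear_combination q1 - q2 + q3 + q4

/-- the function `Λ`. -/
theorem ex_lam (T : T0 K G y0) (hJ : IsJ G J) : ∃ L : ℂ → ℂ → ℂ, ∀ a b : ℂ, Complex.exp a ∈ K →
    Complex.exp b ∈ K → a ∈ clA G y0 → b ∈ clB G y0 →
    (∀ ρ w, Rad G y0 a ρ → 0 < w.re → y0 < w.im → ‖psi G w - a‖ < ρ / 8 →
      L a b = J b w + Complex.log ((a - b) / (psi G w - b))) ∧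
    (∀ ρ w, Rad G y0 b ρ → 0 < w.re → w.im < y0 → ‖psi G w - b‖ < ρ / 8 →
      L a b = J a w + Real.pi * Complex.I + Complex.log ((b - a) / (psi G w - a))) := by
  have : ∀ a b : ℂ, ∃ v : ℂ, Complex.exp a ∈ K →
    Complex.exp b ∈ K → a ∈ clA G y0 → b ∈ clB G y0 →
    (∀ ρ w, Rad G y0 a ρ → 0 < w.re → y0 < w.im → ‖psi G w - a‖ < ρ / 8 →
      v = J b w + Complex.log ((a - b) / (psi G w - b))) ∧
    (∀ ρ w, Rad G y0 b ρ → 0 < w.re → w.im < y0 → ‖psi G w - b‖ < ρ / 8 →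
      v = J a w + Real.pi * Complex.I + Complex.log ((b - a) / (psi G w - a))) := by
    intro a b
    by_cases hh : Complex.exp a ∈ K ∧ Complex.exp b ∈ K ∧ a ∈ clA G y0 ∧ b ∈ clB G y0
    · obtain ⟨ha, hb, hA, hB⟩ := hh
      obtain ⟨ρ, hρ⟩ := T.rho (T.nU ha)
      obtain ⟨ρ', hρ'⟩ := T.rho (T.nU hb)
      obtain ⟨w, w1, w2, w3⟩ := T.nearA hA (ε := ρ / 8) (by linarith [hρ.1])
      obtain ⟨w', w1', w2', w3'⟩ := T.nearB hB (ε := ρ' / 8) (by linarith [hρ'.1])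
      refine ⟨J b w + Complex.log ((a - b) / (psi G w - b)), fun _ _ _ _ =>
        ⟨fun σ u hσ u1 u2 u3 => ?_, fun σ u hσ u1 u2 u3 => ?_⟩⟩
      · rw [T.lam_eq hJ hA hB hρ hρ' w1 w2 w3 w1' w2' w3', T.lam_eq hJ hA hB hσ hρ' u1 u2 u3 w1' w2' w3']
      · rw [T.lam_eq hJ hA hB hρ hσ w1 w2 w3 u1 u2 u3]
    · exact ⟨0, fun a1 a2 a3 a4 => absurd ⟨a1, a2, a3, a4⟩ hh⟩
  choose L hL using this
  exact ⟨L, hL⟩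

theorem main (T : T0 K G y0) : ∃ (l : ℂ → ℂ) (LL : ℤ → ℂ → ℂ → ℂ), ContinuousOn l (K \ {0}) ∧
    (∀ x ∈ K \ {0}, Complex.exp (l x) = x) ∧
    (∀ k : ℤ, 1 ≤ k → ContinuousOn (fun p : ℂ × ℂ => LL k p.1 p.2) ((K \ {0}) ×ˢ (K \ {0}))) ∧
    (∀ k : ℤ, 1 ≤ k → ∀ x ∈ K \ {0}, ∀ x' ∈ K \ {0},
      Complex.exp (LL k x x') = l x - l x' + k * (2 * Real.pi * Complex.I)) ∧
    (∀ k : ℤ, 1 ≤ k → ∀ x ∈ K \ {0}, ∃ δ : ℝ, 0 < δ ∧ ∀ x' ∈ K \ {0}, ‖x'‖ < δ →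
      |(LL k x x').im| < 3 * Real.pi / 2) ∧
    (∀ k : ℤ, 1 ≤ k → ∀ x' ∈ K \ {0}, ∃ δ : ℝ, 0 < δ ∧ ∀ x ∈ K \ {0}, ‖x‖ < δ →
      |(LL k x x').im - Real.pi| < 3 * Real.pi / 2) ∧
    (∀ x ∈ K \ {0}, ∀ n : ℤ, 0 ≤ n → ∀ y, Lands G y (l x + n * (2 * Real.pi * Complex.I)) → y0 < y) ∧
    (∀ x ∈ K \ {0}, ∀ n : ℤ, n < 0 → ∀ y, Lands G y (l x + n * (2 * Real.pi * Complex.I)) → y < y0) := by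
  obtain ⟨l, hl⟩ := T.ex_l
  have hlc := T.l_cont hl
  obtain ⟨J, hJ⟩ := exists_J T.rie
  obtain ⟨L, hL⟩ := T.ex_lam hJ
  have hA : ∀ x ∈ K \ {0}, ∀ n : ℤ, 0 ≤ n → l x + n * (2 * Real.pi * Complex.I) ∈ clA G y0 := fun x hx n hn =>
    T.shiftA (hl x hx).2.1 hn
  have hB : ∀ x ∈ K \ {0}, ∀ n : ℤ, n < 0 → l x + n * (2 * Real.pi * Complex.I) ∈ clB G y0 := fun x hx n hn => by
    have := T.shiftB (hl x hx).2.2 (n := n + 1) (by omega)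
    convert this using 1
    push_cast; ring
  have hE : ∀ x ∈ K \ {0}, ∀ n : ℤ, Complex.exp (l x + n * (2 * Real.pi * Complex.I)) ∈ K := fun x hx n => by
    rw [exp_per, (hl x hx).1]; exact hx.1
  have hlre : ∀ x ∈ K \ {0}, (l x).re = Real.log ‖x‖ := fun x hx => by
    conv_rhs => rw [← (hl x hx).1, Complex.norm_exp, Real.log_exp]
  have hsm : ∀ M : ℝ, ∀ x ∈ K \ {0}, ‖x‖ < Real.exp M → (l x).re < M := fun M x hx hn => by
    rw [hlre x hx]
    exact (Real.log_lt_iff_lt_exp (norm_pos_iff.2 hx.2)).2 hn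
  have nre : ∀ (a : ℂ) (n : ℤ), (a + n * (2 * Real.pi * Complex.I)).re = a.re := fun a n => by simp
  have rat : ∀ {a b ρ w}, Rad G y0 a ρ → a ∈ clA G y0 → b ∈ clB G y0 → ‖psi G w - a‖ < ρ / 8 →
      0 < ((a - b) / (psi G w - b)).re ∧ a - b ≠ 0 ∧ psi G w - b ≠ 0 := by
    intro a b ρ w hr ha hb hd
    have f := T.far hr ha hb
    have h0 : a - b ≠ 0 := norm_pos_iff.1 (lt_of_lt_of_le hr.1 f)
    have h1 := re_ratio h0 (u := a - b) (v := psi G w - b) (by simp; positivity)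
      (by rw [sub_sub_sub_cancel_right]; linarith [hr.1])
    refine ⟨h1, h0, fun h => ?_⟩
    rw [h, div_zero] at h1
    simp at h1
  have rat' : ∀ {a b ρ w}, Rad G y0 b ρ → a ∈ clA G y0 → b ∈ clB G y0 → ‖psi G w - b‖ < ρ / 8 →
      0 < ((b - a) / (psi G w - a)).re := by
    intro a b ρ w hr ha hb hd
    have f := T.far' hr ha hb
    rw [norm_sub_rev] at f
    have h0 : b - a ≠ 0 := norm_pos_iff.1 (lt_of_lt_of_le hr.1 f)
    exact re_ratio h0 (u := b - a) (v := psi G w - a) (by simp; positivity)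
      (by rw [sub_sub_sub_cancel_right]; linarith [hr.1])
  refine ⟨l, fun k x x' => L (l x + (k - 1 : ℤ) * (2 * Real.pi * Complex.I)) (l x' + (-1 : ℤ) * (2 * Real.pi * Complex.I)), hlc,
    fun x hx => (hl x hx).1, ?_, ?_, ?_, ?_, ?_, ?_⟩
  · intro k hk
    have hLc : ContinuousOn (fun p : ℂ × ℂ => L p.1 p.2)
        {p | (Complex.exp p.1 ∈ K ∧ p.1 ∈ clA G y0) ∧ Complex.exp p.2 ∈ K ∧ p.2 ∈ clB G y0} := by
      rintro ⟨a0, b0⟩ ⟨⟨ea, ca⟩, eb, cb⟩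
      simp only at ea ca eb cb
      obtain ⟨ρ, hρ⟩ := T.rho (T.nU ea)
      obtain ⟨w, w1, w2, w3⟩ := T.nearA ca (ε := ρ / 32) (by linarith [hρ.1])
      have r0 := rat hρ ca cb (w := w) (by linarith [hρ.1])
      have c1 : ContinuousWithinAt (fun p : ℂ × ℂ => J p.2 w)
          {p | (Complex.exp p.1 ∈ K ∧ p.1 ∈ clA G y0) ∧ Complex.exp p.2 ∈ K ∧ p.2 ∈ clB G y0} (a0, b0) :=
        ContinuousWithinAt.comp (g := fun p : ℂ × ℂ => J p.1 p.2) (f := fun p : ℂ × ℂ => (p.2, w))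
          (t := {p | OffR G p}) (hJ.cont _ (off_of_nU T.rie w1 (T.nU eb)))
          (by fun_prop) (fun p hp => off_of_nU T.rie w1 (T.nU hp.2.1))
      have c2 : ContinuousAt (fun p : ℂ × ℂ => Complex.log ((p.1 - p.2) / (psi G w - p.2))) (a0, b0) := by
        refine ContinuousAt.clog (ContinuousAt.div (by fun_prop) (by fun_prop) r0.2.2) (Or.inl r0.1)
      refine (c1.add c2.continuousWithinAt).congr_of_eventuallyEq ?_ ?_
      · have hn : ∀ᶠ p : ℂ × ℂ in 𝓝 (a0, b0), p.1 ∈ ball a0 (ρ / 32) :=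
          (continuous_fst.tendsto (a0, b0)) (ball_mem_nhds a0 (by linarith [hρ.1]))
        filter_upwards [nhdsWithin_le_nhds hn, self_mem_nhdsWithin] with p hp hpm
        rw [mem_ball, dist_eq_norm] at hp
        refine (hL p.1 p.2 hpm.1.1 hpm.2.1 hpm.1.2 hpm.2.2).1 (ρ / 2) w
          ⟨by linarith [hρ.1], fun x hx => ?_⟩ w1 w2 ?_
        · have h1 := hρ.2 x hx
          have h2 := norm_sub_le_norm_sub_add_norm_sub (psi G ⟨x, y0⟩) p.1 a0
          linarith [hρ.1]
        · have h2 := norm_sub_le_norm_sub_add_norm_sub (psi G w) a0 p.1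
          rw [norm_sub_rev a0] at h2
          linarith [hρ.1]
      · exact (hL a0 b0 ea eb ca cb).1 ρ w hρ w1 w2 (by linarith [hρ.1])
    refine hLc.comp (f := fun p : ℂ × ℂ => (l p.1 + (k - 1 : ℤ) * (2 * Real.pi * Complex.I), l p.2 + (-1 : ℤ) * (2 * Real.pi * Complex.I))) ?_ ?_
    · exact ((hlc.comp continuousOn_fst (fun p hp => hp.1)).add continuousOn_const).prodMk
        ((hlc.comp continuousOn_snd (fun p hp => hp.2)).add continuousOn_const)
    · intro p hp
      exact ⟨⟨hE _ hp.1 _, hA _ hp.1 _ (by omega)⟩, hE _ hp.2 _, hB _ hp.2 _ (by omega)⟩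
  · intro k hk x hx x' hx'
    have ca := hA x hx (k - 1) (by omega)
    have cb := hB x' hx' (-1) (by omega)
    have ea := hE x hx (k - 1)
    have eb := hE x' hx' (-1)
    obtain ⟨ρ, hρ⟩ := T.rho (T.nU ea)
    obtain ⟨w, w1, w2, w3⟩ := T.nearA ca (ε := ρ / 8) (by linarith [hρ.1])
    have r0 := rat hρ ca cb w3
    simp only
    rw [(hL _ _ ea eb ca cb).1 ρ w hρ w1 w2 w3, Complex.exp_add, hJ.exp _ _ (off_of_nU T.rie w1 (T.nU eb)),
      Complex.exp_log (div_ne_zero r0.2.1 r0.2.2), mul_div_cancel₀ _ r0.2.2]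
    push_cast; ring
  · intro k hk x hx
    have ca := hA x hx (k - 1) (by omega)
    have ea := hE x hx (k - 1)
    obtain ⟨ρ, hρ⟩ := T.rho (T.nU ea)
    obtain ⟨w, w1, w2, w3⟩ := T.nearA ca (ε := ρ / 8) (by linarith [hρ.1])
    obtain ⟨M, hM⟩ := ray_re T.rie w1
    refine ⟨Real.exp M, Real.exp_pos _, fun x' hx' hn => ?_⟩
    have cb := hB x' hx' (-1) (by omega)
    have eb := hE x' hx' (-1)
    have r0 := rat hρ ca cb w3
    simp only
    rw [(hL _ _ ea eb ca cb).1 ρ w hρ w1 w2 w3, Complex.add_im]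
    have b1 := abs_lt.1 (im_log_lt r0.1)
    have b2 := abs_lt.1 (hJ.im_lt T.rie (ζ := l x' + (-1 : ℤ) * (2 * Real.pi * Complex.I)) w1 (fun r hr => by
      rw [Complex.sub_re, nre]; linarith [hM r hr, hsm M x' hx' hn]))
    rw [abs_lt]
    have := Real.pi_pos
    constructor <;> linarith [b1.1, b1.2, b2.1, b2.2]
  · intro k hk x' hx'
    have cb := hB x' hx' (-1) (by omega)
    have eb := hE x' hx' (-1)
    obtain ⟨ρ, hρ⟩ := T.rho (T.nU eb)
    obtain ⟨w, w1, w2, w3⟩ := T.nearB cb (ε := ρ / 8) (by linarith [hρ.1])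
    obtain ⟨M, hM⟩ := ray_re T.rie w1
    refine ⟨Real.exp M, Real.exp_pos _, fun x hx hn => ?_⟩
    have ca := hA x hx (k - 1) (by omega)
    have ea := hE x hx (k - 1)
    have r0 := rat' hρ ca cb w3
    simp only
    rw [(hL _ _ ea eb ca cb).2 ρ w hρ w1 w2 w3]
    have b1 := abs_lt.1 (im_log_lt r0)
    have b2 := abs_lt.1 (hJ.im_lt T.rie (ζ := l x + (k - 1 : ℤ) * (2 * Real.pi * Complex.I)) w1 (fun r hr => by
      rw [Complex.sub_re, nre]; linarith [hM r hr, hsm M x hx hn]))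
    have h3 : ((Real.pi : ℂ) * Complex.I).im = Real.pi := by simp
    rw [Complex.add_im, Complex.add_im, h3, abs_lt]
    have := Real.pi_pos
    constructor <;> linarith [b1.1, b1.2, b2.1, b2.2]
  · intro x hx n hn y hy
    have ca := hA x hx n hn
    rcases lt_trichotomy y y0 with hlt | rfl | hlt
    · exfalso
      refine T.disj (hE x hx n) ca (mem_closure_of_tendsto hy ?_)
      filter_upwards [self_mem_nhdsWithin] with s hs
      exact ⟨⟨s, y⟩, ⟨hs, hlt⟩, rfl⟩
    · exfalso
      have h1 : Tendsto (fun s : ℝ => (psi G ⟨s, y⟩).re) (𝓝[>] 0) (𝓝 (l x + n * (2 * Real.pi * Complex.I)).re) :=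
        (Complex.continuous_re.tendsto _).comp hy
      exact not_tendsto_nhds_of_tendsto_atBot T.lim _ h1
    · exact hlt
  · intro x hx n hn y hy
    have cb := hB x hx n hn
    rcases lt_trichotomy y y0 with hlt | rfl | hlt
    · exact hlt
    · exfalso
      have h1 : Tendsto (fun s : ℝ => (psi G ⟨s, y⟩).re) (𝓝[>] 0) (𝓝 (l x + n * (2 * Real.pi * Complex.I)).re) :=
        (Complex.continuous_re.tendsto _).comp hy
      exact not_tendsto_nhds_of_tendsto_atBot T.lim _ h1
    · exfalso
      refine T.disj (hE x hx n) (mem_closure_of_tendsto hy ?_) cb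
      filter_upwards [self_mem_nhdsWithin] with s hs
      exact ⟨⟨s, y⟩, ⟨hs, hlt⟩, rfl⟩

end T0


/-- lifted data over the whole time interval. -/
structure Lif (K : Set ℂ) (h : ℂ → ℝ → ℂ) (G : ℝ → ℂ → ℂ) (y0 : ℝ) (l : ℂ → ℝ → ℂ)
    (LL : ℤ → ℂ × ℂ → ℝ → ℂ) : Prop where
  fam : Fam K h G
  lc : ContinuousOn (fun p : ℂ × ℝ => l p.1 p.2) ((K \ {0}) ×ˢ Icc 0 1)
  le : ∀ x ∈ K \ {0}, ∀ t ∈ Icc (0:ℝ) 1, Complex.exp (l x t) = h x t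
  Lc : ∀ k : ℤ, 1 ≤ k → ContinuousOn (fun p : (ℂ × ℂ) × ℝ => LL k p.1 p.2)
    (((K \ {0}) ×ˢ (K \ {0})) ×ˢ Icc 0 1)
  Le : ∀ k : ℤ, 1 ≤ k → ∀ x ∈ K \ {0}, ∀ x' ∈ K \ {0}, ∀ t ∈ Icc (0:ℝ) 1,
      Complex.exp (LL k (x, x') t) = l x t - l x' t + k * (2 * Real.pi * Complex.I)
  N1 : ∀ k : ℤ, 1 ≤ k → ∀ x ∈ K \ {0}, ∃ δ : ℝ, 0 < δ ∧ ∀ x' ∈ K \ {0}, ‖x'‖ < δ →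
      |(LL k (x, x') 0).im| < 3 * Real.pi / 2
  N2 : ∀ k : ℤ, 1 ≤ k → ∀ x' ∈ K \ {0}, ∃ δ : ℝ, 0 < δ ∧ ∀ x ∈ K \ {0}, ‖x‖ < δ →
      |(LL k (x, x') 0).im - Real.pi| < 3 * Real.pi / 2
  lA : ∀ x ∈ K \ {0}, ∀ n : ℤ, 0 ≤ n → ∀ y, Lands (G 0) y (l x 0 + n * (2 * Real.pi * Complex.I)) → y0 < y
  lB : ∀ x ∈ K \ {0}, ∀ n : ℤ, n < 0 → ∀ y, Lands (G 0) y (l x 0 + n * (2 * Real.pi * Complex.I)) → y < y0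

theorem int_tp_ne {k : ℤ} (hk : 1 ≤ k) : (k : ℂ) * (2 * Real.pi * Complex.I) ≠ 0 := by
  have : (k : ℂ) ≠ 0 := by exact_mod_cast (by omega : k ≠ 0)
  have h2 : (2 * Real.pi * Complex.I) ≠ 0 := Complex.two_pi_I_ne_zero
  exact mul_ne_zero this h2

theorem Fam.lne {K : Set ℂ} {h : ℂ → ℝ → ℂ} {G : ℝ → ℂ → ℂ} (F : Fam K h G) {l : ℂ → ℝ → ℂ}
    (le : ∀ x ∈ K \ {0}, ∀ t ∈ Icc (0:ℝ) 1, Complex.exp (l x t) = h x t)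
    {x x' : ℂ} (hx : x ∈ K \ {0}) (hx' : x' ∈ K \ {0}) {t : ℝ} (ht : t ∈ Icc (0:ℝ) 1) {k : ℤ}
    (hk : 1 ≤ k) : l x t - l x' t + k * (2 * Real.pi * Complex.I) ≠ 0 := by
  intro h0
  have h1 : l x' t = l x t + k * (2 * Real.pi * Complex.I) := by linear_combination -h0
  have h2 : h x' t = h x t := by rw [← le x hx t ht, ← le x' hx' t ht, h1, exp_per]
  have h3 : x' = x := F.inj t ht hx'.1 hx.1 h2
  rw [h3, sub_self, zero_add] at h0
  exact int_tp_ne hk h0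

theorem Fam.img0 {K : Set ℂ} {h : ℂ → ℝ → ℂ} {G : ℝ → ℂ → ℂ} (F : Fam K h G) :
    (fun z => h z 0) '' K = K := by
  ext z
  constructor
  · rintro ⟨x, hx, rfl⟩
    simpa [F.hid x hx] using hx
  · exact fun hz => ⟨z, hz, F.hid z hz⟩

theorem Fam.ex_lif {K : Set ℂ} {h : ℂ → ℝ → ℂ} {G : ℝ → ℂ → ℂ} (F : Fam K h G) {y0 : ℝ}
    (hlim : Tendsto (fun x : ℝ => (psi (G 0) ⟨x, y0⟩).re) (𝓝[>] 0) atBot) :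
    ∃ l LL, Lif K h G y0 l LL := by
  have h01 : (0:ℝ) ∈ Icc (0:ℝ) 1 := by simp
  have T : T0 K (G 0) y0 := by
    refine ⟨F.cpt, ?_, F.fr, hlim⟩
    have := F.rie 0 h01
    rwa [F.img0] at this
  obtain ⟨l0, L0, a1, a2, a3, a4, a5, a6, a7, a8⟩ := T.main
  obtain ⟨l, b1, b2, b3⟩ := hl_lift (K \ {0}) h
    (F.cont.mono (prod_mono sdiff_subset Subset.rfl)) (fun z hz t ht => F.ne0 ht hz.1 hz.2) l0 a1
    (fun z hz => by rw [a2 z hz, F.hid z hz.1])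
  have : ∀ k : ℤ, ∃ g : ℂ × ℂ → ℝ → ℂ, 1 ≤ k →
      ContinuousOn (fun p : (ℂ × ℂ) × ℝ => g p.1 p.2) (((K \ {0}) ×ˢ (K \ {0})) ×ˢ Icc 0 1) ∧
      (∀ z ∈ (K \ {0}) ×ˢ (K \ {0}), ∀ t ∈ Icc (0:ℝ) 1,
        Complex.exp (g z t) = l z.1 t - l z.2 t + k * (2 * Real.pi * Complex.I)) ∧
      ∀ z ∈ (K \ {0}) ×ˢ (K \ {0}), g z 0 = L0 k z.1 z.2 := by
    intro k
    by_cases hk : 1 ≤ k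
    · obtain ⟨g, hg⟩ := hl_lift ((K \ {0}) ×ˢ (K \ {0})) (fun z t => l z.1 t - l z.2 t + k * (2 * Real.pi * Complex.I)) (by
          refine ContinuousOn.add (ContinuousOn.sub ?_ ?_) continuousOn_const
          · exact b1.comp (f := fun p : (ℂ × ℂ) × ℝ => (p.1.1, p.2)) (by fun_prop)
              (fun p hp => ⟨hp.1.1, hp.2⟩)
          · exact b1.comp (f := fun p : (ℂ × ℂ) × ℝ => (p.1.2, p.2)) (by fun_prop)
              (fun p hp => ⟨hp.1.2, hp.2⟩))
        (fun z hz t ht => F.lne b2 hz.1 hz.2 ht hk) (fun z => L0 k z.1 z.2) (a3 k hk)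
        (fun z hz => by rw [a4 k hk _ hz.1 _ hz.2, b3 _ hz.1, b3 _ hz.2])
      exact ⟨g, fun _ => hg⟩
    · exact ⟨fun _ _ => 0, fun h => absurd h hk⟩
  choose LL hLL using this
  refine ⟨l, LL, F, b1, b2, fun k hk => (hLL k hk).1,
    fun k hk x hx x' hx' t ht => (hLL k hk).2.1 (x, x') ⟨hx, hx'⟩ t ht, ?_, ?_, ?_, ?_⟩
  · intro k hk x hx
    obtain ⟨δ, hδ, hh⟩ := a5 k hk x hx
    exact ⟨δ, hδ, fun x' hx' hn => by rw [(hLL k hk).2.2 (x, x') ⟨hx, hx'⟩]; exact hh x' hx' hn⟩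
  · intro k hk x' hx'
    obtain ⟨δ, hδ, hh⟩ := a6 k hk x' hx'
    exact ⟨δ, hδ, fun x hx hn => by rw [(hLL k hk).2.2 (x, x') ⟨hx, hx'⟩]; exact hh x hx hn⟩
  · intro x hx n hn y hy
    rw [b3 x hx] at hy
    exact a7 x hx n hn y hy
  · intro x hx n hn y hy
    rw [b3 x hx] at hy
    exact a8 x hx n hn y hy

theorem cos_stay {f : ℝ → ℝ} (hf : ContinuousOn f (Icc 0 1)) (hc : ∀ t ∈ Icc (0:ℝ) 1, 0 < Real.cos (f t))
    (h0 : |f 0| < 3 * Real.pi / 2) {t : ℝ} (ht : t ∈ Icc (0:ℝ) 1) : |f t| < Real.pi / 2 := by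
  have hpi := Real.pi_pos
  have h01 : (0:ℝ) ∈ Icc (0:ℝ) 1 := by simp
  have h1 : |f 0| < Real.pi / 2 := by
    by_contra hlt
    push Not at hlt
    have := Real.cos_nonpos_of_pi_div_two_le_of_le hlt (by linarith)
    rw [Real.cos_abs] at this
    linarith [hc 0 h01]
  by_contra hge
  push Not at hge
  have hsub : Icc (0:ℝ) t ⊆ Icc 0 1 := Icc_subset_Icc le_rfl ht.2
  obtain ⟨s, hs, hse⟩ := intermediate_value_Icc ht.1 (hf.mono hsub).abs ⟨h1.le, hge⟩
  have h2 := hc s (hsub hs)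
  have h3 : |f s| = Real.pi / 2 := hse
  rw [← Real.cos_abs, h3, Real.cos_pi_div_two] at h2
  exact lt_irrefl _ h2

namespace Lif
variable {K : Set ℂ} {h : ℂ → ℝ → ℂ} {G : ℝ → ℂ → ℂ} {y0 : ℝ} {l : ℂ → ℝ → ℂ}
    {LL : ℤ → ℂ × ℂ → ℝ → ℂ}

theorem lre (L : Lif K h G y0 l LL) {x : ℂ} (hx : x ∈ K \ {0}) {t : ℝ} (ht : t ∈ Icc (0:ℝ) 1) :
    (l x t).re = Real.log ‖h x t‖ := by
  conv_rhs => rw [← L.le x hx t ht, Complex.norm_exp, Real.log_exp]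

theorem small (L : Lif K h G y0 l LL) {ε : ℝ} (hε : 0 < ε) : ∃ δ : ℝ, 0 < δ ∧ ∀ x ∈ K, ‖x‖ < δ →
    ∀ t ∈ Icc (0:ℝ) 1, ‖h x t‖ < ε := by
  have huc := (L.fam.cpt.prod (isCompact_Icc (a := (0:ℝ)) (b := 1))).uniformContinuousOn_of_continuous
    L.fam.cont
  obtain ⟨δ, hδ, hb⟩ := Metric.uniformContinuousOn_iff.1 huc ε hε
  refine ⟨δ, hδ, fun x hx hn t ht => ?_⟩
  have := hb (x, t) ⟨hx, ht⟩ (0, t) ⟨L.fam.zero, ht⟩ (by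
    rw [Prod.dist_eq]; simpa [hδ] using hn)
  simpa [L.fam.fix t ht] using this

theorem lower (L : Lif K h G y0 l LL) {x : ℂ} (hx : x ∈ K \ {0}) :
    ∃ m : ℝ, 0 < m ∧ ∀ t ∈ Icc (0:ℝ) 1, m ≤ ‖h x t‖ := by
  have hc : ContinuousOn (fun t => ‖h x t‖) (Icc 0 1) :=
    (L.fam.cont.comp (f := fun t => (x, t)) (by fun_prop) (fun t ht => ⟨hx.1, ht⟩)).norm
  obtain ⟨t1, ht1, hmin⟩ := (isCompact_Icc (a := (0:ℝ)) (b := 1)).exists_isMinOn ⟨0, by simp⟩ hc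
  exact ⟨_, norm_pos_iff.2 (L.fam.ne0 ht1 hx.1 hx.2), fun t ht => hmin ht⟩

theorem sepu (L : Lif K h G y0 l LL) {ε : ℝ} (hε : 0 < ε) : ∃ η : ℝ, 0 < η ∧ ∀ t ∈ Icc (0:ℝ) 1,
    ∀ x ∈ K \ {0}, ∀ x' ∈ K \ {0}, ∀ k : ℤ, 1 ≤ k → (ε ≤ ‖h x t‖ ∨ ε ≤ ‖h x' t‖) →
    η ≤ ‖l x t - l x' t + k * (2 * Real.pi * Complex.I)‖ := by
  obtain ⟨c, hc, hsm⟩ := L.small (ε := ε / 3) (by linarith)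
  set Kc : Set ℂ := K ∩ {x | c ≤ ‖x‖} with hKc
  have hKcc : IsCompact Kc := L.fam.cpt.inter_right (isClosed_le continuous_const continuous_norm)
  have hKs : Kc ⊆ K \ {0} := fun x hx => ⟨hx.1, fun h0 => by
    have h1 : c ≤ ‖x‖ := hx.2
    rw [h0, norm_zero] at h1
    linarith⟩
  have hlc : ContinuousOn (fun p : ℂ × ℝ => l p.1 p.2) (Kc ×ˢ Icc 0 1) :=
    L.lc.mono (prod_mono hKs Subset.rfl)
  obtain ⟨B, hB⟩ := (hKcc.prod (isCompact_Icc (a := (0:ℝ)) (b := 1))).exists_bound_of_continuousOn hlc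
  obtain ⟨N, hN⟩ := exists_nat_gt (2 * B + 1)
  have hfin : ∀ k ∈ Finset.Icc (1:ℤ) N, ∀ᶠ η : ℝ in 𝓝[>] 0, ∀ x ∈ Kc, ∀ x' ∈ Kc, ∀ t ∈ Icc (0:ℝ) 1,
      η ≤ ‖l x t - l x' t + k * (2 * Real.pi * Complex.I)‖ := by
    intro k hk
    have hk1 : 1 ≤ k := (Finset.mem_Icc.1 hk).1
    have hcc : ContinuousOn (fun p : (ℂ × ℂ) × ℝ => ‖l p.1.1 p.2 - l p.1.2 p.2 + k * (2 * Real.pi * Complex.I)‖)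
        ((Kc ×ˢ Kc) ×ˢ Icc 0 1) := by
      refine (ContinuousOn.add (ContinuousOn.sub ?_ ?_) continuousOn_const).norm
      · exact hlc.comp (f := fun p : (ℂ × ℂ) × ℝ => (p.1.1, p.2)) (by fun_prop)
          (fun p hp => ⟨hp.1.1, hp.2⟩)
      · exact hlc.comp (f := fun p : (ℂ × ℂ) × ℝ => (p.1.2, p.2)) (by fun_prop)
          (fun p hp => ⟨hp.1.2, hp.2⟩)
    have hcp : IsCompact ((Kc ×ˢ Kc) ×ˢ Icc (0:ℝ) 1) := (hKcc.prod hKcc).prod isCompact_Icc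
    rcases ((Kc ×ˢ Kc) ×ˢ Icc (0:ℝ) 1).eq_empty_or_nonempty with he | hne
    · refine Eventually.of_forall (fun η x hx x' hx' t ht => ?_)
      have : ((x, x'), t) ∈ ((Kc ×ˢ Kc) ×ˢ Icc (0:ℝ) 1) := ⟨⟨hx, hx'⟩, ht⟩
      rw [he] at this
      exact this.elim
    · obtain ⟨p, hp, hmin⟩ := hcp.exists_isMinOn hne hcc
      have hpos : 0 < ‖l p.1.1 p.2 - l p.1.2 p.2 + k * (2 * Real.pi * Complex.I)‖ :=
        norm_pos_iff.2 (L.fam.lne L.le (hKs hp.1.1) (hKs hp.1.2) hp.2 hk1)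
      filter_upwards [Ioo_mem_nhdsGT hpos] with η hη x hx x' hx' t ht
      exact hη.2.le.trans (hmin (a := ((x, x'), t)) ⟨⟨hx, hx'⟩, ht⟩)
  have hall := (eventually_all_finset (Finset.Icc (1:ℤ) N)).2 hfin
  have e1 : ∀ᶠ η : ℝ in 𝓝[>] 0, η ∈ Ioo (0:ℝ) 1 := Ioo_mem_nhdsGT one_pos
  obtain ⟨η, hη, hη1⟩ := (hall.and e1).exists
  refine ⟨η, hη1.1, fun t ht x hx x' hx' k hk hor => ?_⟩
  by_contra hlt
  push Not at hlt
  have hre : (l x t - l x' t + k * (2 * Real.pi * Complex.I)).re = (l x t).re - (l x' t).re := by simp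
  have h1 := ((Complex.abs_re_le_norm _).trans_lt hlt).trans hη1.2
  rw [hre, abs_lt] at h1
  have px := norm_pos_iff.2 (L.fam.ne0 ht hx.1 hx.2)
  have px' := norm_pos_iff.2 (L.fam.ne0 ht hx'.1 hx'.2)
  have ex : ‖h x t‖ = Real.exp (l x t).re := by rw [← L.le x hx t ht, Complex.norm_exp]
  have ex' : ‖h x' t‖ = Real.exp (l x' t).re := by rw [← L.le x' hx' t ht, Complex.norm_exp]
  have he := Real.exp_one_lt_d9
  have u1 : ‖h x t‖ ≤ 3 * ‖h x' t‖ := by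
    rw [ex, ex']
    calc Real.exp (l x t).re ≤ Real.exp (1 + (l x' t).re) := Real.exp_le_exp.2 (by linarith [h1.2])
      _ = Real.exp 1 * Real.exp (l x' t).re := Real.exp_add _ _
      _ ≤ _ := by gcongr; linarith
  have u2 : ‖h x' t‖ ≤ 3 * ‖h x t‖ := by
    rw [ex, ex']
    calc Real.exp (l x' t).re ≤ Real.exp (1 + (l x t).re) := Real.exp_le_exp.2 (by linarith [h1.1])
      _ = Real.exp 1 * Real.exp (l x t).re := Real.exp_add _ _
      _ ≤ _ := by gcongr; linarith
  have v1 : ε / 3 ≤ ‖h x t‖ := by rcases hor with h | h <;> linarith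
  have v2 : ε / 3 ≤ ‖h x' t‖ := by rcases hor with h | h <;> linarith
  have m1 : x ∈ Kc := ⟨hx.1, by
    by_contra hh
    have hh' : ¬ c ≤ ‖x‖ := hh
    push Not at hh'
    linarith [hsm x hx.1 hh' t ht]⟩
  have m2 : x' ∈ Kc := ⟨hx'.1, by
    by_contra hh
    have hh' : ¬ c ≤ ‖x'‖ := hh
    push Not at hh'
    linarith [hsm x' hx'.1 hh' t ht]⟩
  by_cases hkN : k ≤ N
  · linarith [hη k (Finset.mem_Icc.2 ⟨hk, hkN⟩) x m1 x' m2 t ht]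
  · push Not at hkN
    have hkN' : (N:ℝ) < k := by exact_mod_cast hkN
    have b1 := hB (x, t) ⟨m1, ht⟩
    have b2 := hB (x', t) ⟨m2, ht⟩
    simp only at b1 b2
    have n1 : ‖(k : ℂ) * (2 * Real.pi * Complex.I)‖ = k * (2 * Real.pi) := by
      have hk0 : (0:ℝ) < k := lt_of_le_of_lt (Nat.cast_nonneg N) hkN'
      have hpi := Real.pi_pos
      simp [abs_of_pos hk0, abs_of_pos hpi]
    have n2 : ‖(k : ℂ) * (2 * Real.pi * Complex.I)‖ ≤ ‖l x t - l x' t + k * (2 * Real.pi * Complex.I)‖ + ‖l x t‖ + ‖l x' t‖ := by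
      calc ‖(k : ℂ) * (2 * Real.pi * Complex.I)‖ = ‖(l x t - l x' t + k * (2 * Real.pi * Complex.I)) - l x t + l x' t‖ := by congr 1; ring
        _ ≤ _ := (norm_add_le _ _).trans (by gcongr; exact norm_sub_le _ _)
    rw [n1] at n2
    have := Real.pi_gt_three
    have hB0 : 0 ≤ B := (norm_nonneg _).trans b1
    nlinarith [hη1.2]

theorem tim (L : Lif K h G y0 l LL) {t : ℝ} (ht : t ∈ Icc (0:ℝ) 1) :
    Tim K (unbddComp ((fun z => h z t) '' K)) (G t) (fun x => l x t) (fun k x x' => LL k (x, x') t) where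
  rie := L.fam.rie t ht
  conn := L.fam.conn
  zero := L.fam.zero
  lc := L.lc.comp (f := fun x => (x, t)) (by fun_prop) (fun x hx => ⟨hx, ht⟩)
  nU := fun x hx hh => by
    rw [L.le x hx t ht] at hh
    exact hh.1 ⟨x, hx.1, rfl⟩
  re := fun m => by
    obtain ⟨δ, hδ, hs⟩ := L.small (Real.exp_pos m)
    refine ⟨δ, hδ, fun x hx hn => ?_⟩
    rw [L.lre hx ht]
    exact (Real.log_lt_iff_lt_exp (norm_pos_iff.2 (L.fam.ne0 ht hx.1 hx.2))).2 (hs x hx.1 hn t ht)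
  sep := fun x hx => by
    obtain ⟨η, hη, hh⟩ := L.sepu (ε := ‖h x t‖) (norm_pos_iff.2 (L.fam.ne0 ht hx.1 hx.2))
    exact ⟨η, hη, fun x' hx' k hk => ⟨hh t ht x hx x' hx' k hk (Or.inl le_rfl),
      hh t ht x' hx' x hx k hk (Or.inr le_rfl)⟩⟩
  Lc1 := fun k hk x hx => (L.Lc k hk).comp (f := fun x' => ((x, x'), t)) (by fun_prop)
    (fun x' hx' => ⟨⟨hx, hx'⟩, ht⟩)
  Lc2 := fun k hk x' hx' => (L.Lc k hk).comp (f := fun x => ((x, x'), t)) (by fun_prop)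
    (fun x hx => ⟨⟨hx, hx'⟩, ht⟩)
  Le := fun k hk x hx x' hx' => L.Le k hk x hx x' hx' t ht
  N1 := fun k hk x hx => by
    obtain ⟨m, hm, hml⟩ := L.lower hx
    obtain ⟨δ1, hδ1, hs⟩ := L.small hm
    obtain ⟨δ2, hδ2, hn⟩ := L.N1 k hk x hx
    refine ⟨min δ1 δ2, lt_min hδ1 hδ2, fun x' hx' hlt => ?_⟩
    rw [lt_min_iff] at hlt
    refine cos_stay (f := fun t => (LL k (x, x') t).im) ?_ (fun s hs' => ?_) (hn x' hx' hlt.2) ht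
    · exact Complex.continuous_im.comp_continuousOn ((L.Lc k hk).comp (f := fun t => ((x, x'), t))
        (by fun_prop) (fun s hs => ⟨⟨hx, hx'⟩, hs⟩))
    · have e := congrArg Complex.re (L.Le k hk x hx x' hx' s hs')
      rw [Complex.exp_re] at e
      have hre : (l x s - l x' s + k * (2 * Real.pi * Complex.I)).re = (l x s).re - (l x' s).re := by simp
      rw [hre, L.lre hx hs', L.lre hx' hs'] at e
      have hlog := Real.log_lt_log (norm_pos_iff.2 (L.fam.ne0 hs' hx'.1 hx'.2))
        ((hs x' hx'.1 hlt.1 s hs').trans_le (hml s hs'))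
      have hp : 0 < Real.exp (LL k (x, x') s).re * Real.cos (LL k (x, x') s).im := by rw [e]; linarith
      exact (mul_pos_iff_of_pos_left (Real.exp_pos _)).1 hp
  N2 := fun k hk x' hx' => by
    obtain ⟨m, hm, hml⟩ := L.lower hx'
    obtain ⟨δ1, hδ1, hs⟩ := L.small hm
    obtain ⟨δ2, hδ2, hn⟩ := L.N2 k hk x' hx'
    refine ⟨min δ1 δ2, lt_min hδ1 hδ2, fun x hx hlt => ?_⟩
    rw [lt_min_iff] at hlt
    refine cos_stay (f := fun t => (LL k (x, x') t).im - Real.pi) ?_ (fun s hs' => ?_) (hn x hx hlt.2) ht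
    · exact (Complex.continuous_im.comp_continuousOn ((L.Lc k hk).comp (f := fun t => ((x, x'), t))
        (by fun_prop) (fun s hs => ⟨⟨hx, hx'⟩, hs⟩))).sub continuousOn_const
    · have e := congrArg Complex.re (L.Le k hk x hx x' hx' s hs')
      rw [Complex.exp_re] at e
      have hre : (l x s - l x' s + k * (2 * Real.pi * Complex.I)).re = (l x s).re - (l x' s).re := by simp
      rw [hre, L.lre hx hs', L.lre hx' hs'] at e
      have hlog := Real.log_lt_log (norm_pos_iff.2 (L.fam.ne0 hs' hx.1 hx.2))
        ((hs x hx.1 hlt.1 s hs').trans_le (hml s hs'))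
      have hp : 0 < Real.exp (LL k (x, x') s).re * (-Real.cos (LL k (x, x') s).im) := by
        rw [mul_neg, e]; linarith
      rw [Real.cos_sub_pi]
      exact (mul_pos_iff_of_pos_left (Real.exp_pos _)).1 hp

end Lif


open MeasureTheory in
theorem ae_Ioo {P : ℝ → Prop} (hP : ∀ᵐ y : ℝ, P y) {a b : ℝ} (hab : a < b) :
    ∃ y, a < y ∧ y < b ∧ P y := by
  have h1 : Dense {y : ℝ | P y} := Measure.dense_of_ae hP
  obtain ⟨y, hy, h2⟩ := h1.exists_between hab
  exact ⟨y, h2.1, h2.2, hy⟩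

open MeasureTheory in
theorem ae_refl {P : ℝ → Prop} (hP : ∀ᵐ y : ℝ, P y) (c : ℝ) : ∀ᵐ y : ℝ, P (c - y) :=
  (Measure.measurePreserving_sub_left (volume : Measure ℝ) c).quasiMeasurePreserving.ae hP

theorem kq {K : Set ℂ} {G : ℂ → ℂ} (hK : IsCompact K) (h : Rie (unbddComp K) G)
    {Q : Set ℂ} {w0 a : ℂ} {η : ℝ} (hw0 : 0 < w0.re) (ha : Complex.exp a ∈ K) (hη : 0 < η)
    (hd : ‖psi G w0 - a‖ < η / 10 ^ 8) (hQ : ∀ b ∈ Q, η ≤ ‖a - b‖)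
    (hae : ∀ᵐ y : ℝ, (∃ b ∈ Q, Lands G y b) ∨ (∃ b ∈ Q, Lands G (2 * w0.im - y) b)) : False := by
  obtain ⟨J, hJ⟩ := exists_J h
  have hcl : IsClosed (Complex.exp ⁻¹' K) := hK.isClosed.preimage Complex.continuous_exp
  obtain ⟨e, heK, he⟩ := hcl.exists_infDist_eq_dist ⟨a, ha⟩ (psi G w0)
  have hmin : ∀ u, Complex.exp u ∈ K → ‖psi G w0 - e‖ ≤ ‖psi G w0 - u‖ := by
    intro u hu
    rw [← dist_eq_norm, ← dist_eq_norm, ← he]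
    exact infDist_le_dist_of_mem hu
  have h1 := hmin a ha
  have hQ2 : ∀ b ∈ Q, η / 2 ≤ ‖e - b‖ := by
    intro b hb
    have h2 := hQ b hb
    have h3 : ‖a - b‖ ≤ ‖psi G w0 - e‖ + ‖psi G w0 - a‖ + ‖e - b‖ := by
      calc ‖a - b‖ = ‖(psi G w0 - e) - (psi G w0 - a) + (e - b)‖ := by congr 1; ring
        _ ≤ _ := (norm_add_le _ _).trans (by gcongr; exact norm_sub_le _ _)
    norm_num at hd
    linarith
  refine ke hK h hJ hw0 heK hmin (half_pos hη) ?_ ?_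
  · norm_num at hd ⊢
    linarith
  · filter_upwards [hae] with y hy
    rcases hy with ⟨b, hb, hl⟩ | ⟨b, hb, hl⟩
    · exact Or.inl ⟨b, hl, hQ2 b hb⟩
    · exact Or.inr ⟨b, hl, hQ2 b hb⟩

/-- upper points at time `t`. -/
def Aset (K : Set ℂ) (l : ℂ → ℝ → ℂ) (t : ℝ) : Set ℂ :=
  {a | ∃ x ∈ K \ {0}, ∃ n : ℤ, 0 ≤ n ∧ a = l x t + n * (2 * Real.pi * Complex.I)}
/-- lower points at time `t`. -/
def Bset (K : Set ℂ) (l : ℂ → ℝ → ℂ) (t : ℝ) : Set ℂ :=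
  {a | ∃ x ∈ K \ {0}, ∃ n : ℤ, n < 0 ∧ a = l x t + n * (2 * Real.pi * Complex.I)}
/-- angles of lower points. -/
def YB (K : Set ℂ) (l : ℂ → ℝ → ℂ) (G : ℝ → ℂ → ℂ) (t : ℝ) : Set ℝ := {y | ∃ b ∈ Bset K l t, Lands (G t) y b}
/-- angles of upper points. -/
def YA (K : Set ℂ) (l : ℂ → ℝ → ℂ) (G : ℝ → ℂ → ℂ) (t : ℝ) : Set ℝ := {y | ∃ b ∈ Aset K l t, Lands (G t) y b}
/-- the angle at time `t`. -/
noncomputable def thet (K : Set ℂ) (l : ℂ → ℝ → ℂ) (G : ℝ → ℂ → ℂ) (t : ℝ) : ℝ := sSup (YB K l G t)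

namespace Lif
variable {K : Set ℂ} {h : ℂ → ℝ → ℂ} {G : ℝ → ℂ → ℂ} {y0 : ℝ} {l : ℂ → ℝ → ℂ}
    {LL : ℤ → ℂ × ℂ → ℝ → ℂ} {t : ℝ}

theorem cls (L : Lif K h G y0 l LL) (ht : t ∈ Icc (0:ℝ) 1) {a : ℂ}
    (ha : Complex.exp a ∈ (fun z => h z t) '' K) : a ∈ Aset K l t ∨ a ∈ Bset K l t := by
  obtain ⟨x, hx, he⟩ := ha
  have he : h x t = Complex.exp a := he
  have hx0 : x ≠ 0 := by
    rintro rfl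
    rw [L.fam.fix t ht] at he
    exact Complex.exp_ne_zero _ he.symm
  have hxm : x ∈ K \ {0} := ⟨hx, hx0⟩
  rw [← L.le x hxm t ht] at he
  obtain ⟨n, hn⟩ := Complex.exp_eq_exp_iff_exists_int.1 he.symm
  rcases le_or_gt 0 n with h0 | h0
  · exact Or.inl ⟨x, hxm, n, h0, hn⟩
  · exact Or.inr ⟨x, hxm, n, h0, hn⟩

theorem memA (L : Lif K h G y0 l LL) (ht : t ∈ Icc (0:ℝ) 1) {a : ℂ} (ha : a ∈ Aset K l t) :
    Complex.exp a ∈ (fun z => h z t) '' K := by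
  obtain ⟨x, hx, n, hn, rfl⟩ := ha
  rw [exp_per, L.le x hx t ht]
  exact ⟨x, hx.1, rfl⟩

theorem memB (L : Lif K h G y0 l LL) (ht : t ∈ Icc (0:ℝ) 1) {a : ℂ} (ha : a ∈ Bset K l t) :
    Complex.exp a ∈ (fun z => h z t) '' K := by
  obtain ⟨x, hx, n, hn, rfl⟩ := ha
  rw [exp_per, L.le x hx t ht]
  exact ⟨x, hx.1, rfl⟩

theorem aeY (L : Lif K h G y0 l LL) (ht : t ∈ Icc (0:ℝ) 1) : ∀ᵐ y : ℝ, y ∈ YA K l G t ∨ y ∈ YB K l G t := by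
  filter_upwards [ae_lands (L.fam.rie t ht)] with y hy
  obtain ⟨a, ha⟩ := hy
  rcases L.cls ht (lands_mem (L.fam.cptK ht) (L.fam.rie t ht) ha) with h1 | h1
  · exact Or.inl ⟨a, h1, ha⟩
  · exact Or.inr ⟨a, h1, ha⟩

theorem ordY (L : Lif K h G y0 l LL) (ht : t ∈ Icc (0:ℝ) 1) {y y' : ℝ} (hy : y ∈ YA K l G t)
    (hy' : y' ∈ YB K l G t) : y' < y := by
  obtain ⟨_, ⟨x, hx, n, hn, rfl⟩, hl⟩ := hy
  obtain ⟨_, ⟨x', hx', n', hn', rfl⟩, hl'⟩ := hy'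
  exact (L.tim ht).ord' hx hx' hn hn' hl hl'

theorem neY (L : Lif K h G y0 l LL) (ht : t ∈ Icc (0:ℝ) 1) :
    (YA K l G t).Nonempty ∧ (YB K l G t).Nonempty := by
  obtain ⟨y, -, -, hy⟩ := ae_Ioo (L.aeY ht) one_pos
  have : ∃ y, ∃ x ∈ K \ {0}, ∃ n : ℤ, Lands (G t) y (l x t + n * (2 * Real.pi * Complex.I)) := by
    rcases hy with ⟨_, ⟨x, hx, n, hn, rfl⟩, hl⟩ | ⟨_, ⟨x, hx, n, hn, rfl⟩, hl⟩
    · exact ⟨y, x, hx, n, hl⟩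
    · exact ⟨y, x, hx, n, hl⟩
  obtain ⟨y, x, hx, n, hl⟩ := this
  constructor
  · refine ⟨y + (-n : ℤ) * (2 * Real.pi), _, ⟨x, hx, 0, le_rfl, rfl⟩, ?_⟩
    have := lands_shift hl (-n)
    convert this using 1
    push_cast; ring
  · refine ⟨y + (-n - 1 : ℤ) * (2 * Real.pi), _, ⟨x, hx, -1, by norm_num, rfl⟩, ?_⟩
    have := lands_shift hl (-n - 1)
    convert this using 1
    push_cast; ring

theorem leY (L : Lif K h G y0 l LL) (ht : t ∈ Icc (0:ℝ) 1) {y : ℝ} (hy : y ∈ YB K l G t) :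
    y ≤ thet K l G t := by
  obtain ⟨⟨y1, hy1⟩, -⟩ := L.neY ht
  exact le_csSup ⟨y1, fun y' hy' => (L.ordY ht hy1 hy').le⟩ hy

theorem geY (L : Lif K h G y0 l LL) (ht : t ∈ Icc (0:ℝ) 1) {y : ℝ} (hy : y ∈ YA K l G t) :
    thet K l G t ≤ y :=
  csSup_le (L.neY ht).2 (fun y' hy' => (L.ordY ht hy hy').le)

theorem thet0 (L : Lif K h G y0 l LL) : thet K l G 0 = y0 := by
  have h01 : (0:ℝ) ∈ Icc (0:ℝ) 1 := by simp
  apply le_antisymm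
  · refine csSup_le (L.neY h01).2 ?_
    rintro y ⟨_, ⟨x, hx, n, hn, rfl⟩, hl⟩
    exact (L.lB x hx n hn y hl).le
  · by_contra hlt
    push Not at hlt
    obtain ⟨y, y1, y2, hy⟩ := ae_Ioo (L.aeY h01) hlt
    rcases hy with hy | hy
    · obtain ⟨_, ⟨x, hx, n, hn, rfl⟩, hl⟩ := hy
      linarith [L.lA x hx n hn y hl]
    · linarith [L.leY h01 hy]

open MeasureTheory in
theorem keA (L : Lif K h G y0 l LL) (ht : t ∈ Icc (0:ℝ) 1) {w0 a : ℂ} {η : ℝ} (hw0 : 0 < w0.re)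
    (ha : a ∈ Aset K l t) (hη : 0 < η) (hd : ‖psi (G t) w0 - a‖ < η / 10 ^ 8)
    (hB : ∀ b ∈ Bset K l t, η ≤ ‖a - b‖) : thet K l G t < w0.im := by
  by_contra hle
  push Not at hle
  refine kq (L.fam.cptK ht) (L.fam.rie t ht) hw0 (L.memA ht ha) hη hd hB ?_
  have hne : ∀ᵐ y : ℝ, y ≠ w0.im := Measure.ae_ne volume w0.im
  filter_upwards [L.aeY ht, ae_refl (L.aeY ht) (2 * w0.im), hne] with y h1 h2 h3
  rcases lt_or_gt_of_ne h3 with h4 | h4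
  · left
    rcases h1 with h1 | h1
    · linarith [L.geY ht h1]
    · exact h1
  · right
    rcases h2 with h2 | h2
    · linarith [L.geY ht h2]
    · exact h2

open MeasureTheory in
theorem keB (L : Lif K h G y0 l LL) (ht : t ∈ Icc (0:ℝ) 1) {w0 a : ℂ} {η : ℝ} (hw0 : 0 < w0.re)
    (ha : a ∈ Bset K l t) (hη : 0 < η) (hd : ‖psi (G t) w0 - a‖ < η / 10 ^ 8)
    (hB : ∀ b ∈ Aset K l t, η ≤ ‖a - b‖) : w0.im < thet K l G t := by
  by_contra hle
  push Not at hle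
  refine kq (L.fam.cptK ht) (L.fam.rie t ht) hw0 (L.memB ht ha) hη hd hB ?_
  have hne : ∀ᵐ y : ℝ, y ≠ w0.im := Measure.ae_ne volume w0.im
  filter_upwards [L.aeY ht, ae_refl (L.aeY ht) (2 * w0.im), hne] with y h1 h2 h3
  rcases lt_or_gt_of_ne h3 with h4 | h4
  · right
    rcases h2 with h2 | h2
    · exact h2
    · linarith [L.leY ht h2]
  · left
    rcases h1 with h1 | h1
    · exact h1
    · linarith [L.leY ht h1]

end Lif


namespace Lif
variable {K : Set ℂ} {h : ℂ → ℝ → ℂ} {G : ℝ → ℂ → ℂ} {y0 : ℝ} {l : ℂ → ℝ → ℂ}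
    {LL : ℤ → ℂ × ℂ → ℝ → ℂ} {t : ℝ}

theorem sepAB (L : Lif K h G y0 l LL) {ε : ℝ} (hε : 0 < ε) : ∃ η : ℝ, 0 < η ∧ ∀ t ∈ Icc (0:ℝ) 1,
    ∀ a ∈ Aset K l t, ∀ b ∈ Bset K l t, (ε ≤ ‖Complex.exp a‖ ∨ ε ≤ ‖Complex.exp b‖) →
    η ≤ ‖a - b‖ := by
  obtain ⟨η, hη, H⟩ := L.sepu hε
  refine ⟨η, hη, ?_⟩
  rintro t ht _ ⟨x, hx, n, hn, rfl⟩ _ ⟨x', hx', n', hn', rfl⟩ hor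
  rw [exp_per, exp_per, L.le x hx t ht, L.le x' hx' t ht] at hor
  have := H t ht x hx x' hx' (n - n') (by omega) hor
  have h2 : l x t + n * (2 * Real.pi * Complex.I) - (l x' t + n' * (2 * Real.pi * Complex.I)) = l x t - l x' t + ((n - n' : ℤ) : ℂ) * (2 * Real.pi * Complex.I) := by
    push_cast; ring
  rw [h2]; exact this

theorem cfar (L : Lif K h G y0 l LL) {ε : ℝ} (hε : 0 < ε) : ∃ c : ℝ, 0 < c ∧ ∀ t ∈ Icc (0:ℝ) 1,
    ∀ x : ℝ, 0 < x → ∀ a, Complex.exp a ∈ (fun z => h z t) '' K → ε ≤ ‖Complex.exp a‖ →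
    c ≤ ‖psi (G t) ⟨x, thet K l G t⟩ - a‖ := by
  obtain ⟨η, hη, H⟩ := L.sepAB hε
  refine ⟨η / 10 ^ 8, by positivity, ?_⟩
  intro t ht x hx a ha hea
  by_contra hlt
  push Not at hlt
  rcases L.cls ht ha with hA | hB
  · have := L.keA ht (w0 := ⟨x, thet K l G t⟩) hx hA hη hlt (fun b hb => H t ht a hA b hb (Or.inl hea))
    exact lt_irrefl _ this
  · have := L.keB ht (w0 := ⟨x, thet K l G t⟩) hx hB hη hlt (fun b hb => by
      rw [norm_sub_rev]; exact H t ht b hb a hB (Or.inr hea))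
    exact lt_irrefl _ this

theorem kfar (L : Lif K h G y0 l LL) {ε : ℝ} (hε : 0 < ε) : ∃ δ : ℝ, 0 < δ ∧ ∀ t ∈ Icc (0:ℝ) 1,
    ∀ x : ℝ, 0 < x → ε ≤ ‖Complex.exp (psi (G t) ⟨x, thet K l G t⟩)‖ → ∀ z ∈ K,
    δ ≤ ‖Complex.exp (psi (G t) ⟨x, thet K l G t⟩) - h z t‖ := by
  obtain ⟨c, hc, H⟩ := L.cfar (half_pos hε)
  refine ⟨ε * min (1 / 2) (c / 2), by positivity, ?_⟩
  intro t ht x hx he z hz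
  by_contra hlt
  push Not at hlt
  set p := psi (G t) ⟨x, thet K l G t⟩ with hp
  set ζ := Complex.exp p with hζ
  have hζ0 : ζ ≠ 0 := Complex.exp_ne_zero _
  have hζn : 0 < ‖ζ‖ := norm_pos_iff.2 hζ0
  have hm1 : min (1 / 2) (c / 2) ≤ 1 / 2 := min_le_left _ _
  have hm2 : min (1 / 2) (c / 2) ≤ c / 2 := min_le_right _ _
  have hmp : 0 < min (1 / 2) (c / 2) := by positivity
  set u := (h z t - ζ) / ζ with hu
  have hun : ‖u‖ < min (1 / 2) (c / 2) := by
    rw [hu, norm_div, div_lt_iff₀ hζn, norm_sub_rev]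
    calc _ < ε * min (1 / 2) (c / 2) := hlt
      _ ≤ _ := by rw [mul_comm]; gcongr
  have h1u : 1 + u = h z t / ζ := by rw [hu]; field_simp; ring
  have h1u0 : 1 + u ≠ 0 := by
    intro h0
    have : u = -1 := by linear_combination h0
    rw [this] at hun
    norm_num at hun
  have hexp : Complex.exp (p + Complex.log (1 + u)) = h z t := by
    rw [Complex.exp_add, Complex.exp_log h1u0, h1u, ← hζ]; field_simp
  have h3 := H t ht x hx (p + Complex.log (1 + u)) (by rw [hexp]; exact ⟨z, hz, rfl⟩) (by
    rw [hexp]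
    have : ‖ζ‖ ≤ ‖ζ - h z t‖ + ‖h z t‖ := by
      calc ‖ζ‖ = ‖(ζ - h z t) + h z t‖ := by congr 1; ring
        _ ≤ _ := norm_add_le _ _
    nlinarith)
  have h4 : p - (p + Complex.log (1 + u)) = - Complex.log (1 + u) := by ring
  rw [← hp, h4, norm_neg] at h3
  have h5 := Complex.norm_log_one_add_half_le_self (z := u) (by linarith)
  linarith

theorem uland (L : Lif K h G y0 l LL) {t0 : ℝ} (ht0 : t0 ∈ Icc (0:ℝ) 1) {ε : ℝ} (hε : 0 < ε) :
    ∃ xb : ℝ, 0 < xb ∧ ∃ τ : ℝ, 0 < τ ∧ ∀ t ∈ Icc (0:ℝ) 1, |t - t0| < τ → ∀ x : ℝ, 0 < x → x < xb →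
    ‖Complex.exp (psi (G t) ⟨x, thet K l G t⟩)‖ < ε := by
  obtain ⟨δ, hδ, hfar⟩ := L.kfar hε
  have F := L.fam
  set K0 := (fun z => h z t0) '' K with hK0
  set Q : Set ℂ := (closedBall 0 (Real.exp 1) ∩ {ζ | ∀ κ ∈ K0, δ / 2 ≤ ‖ζ - κ‖}) ∩
    closure (unbddComp K0) with hQ
  have hQc : IsCompact Q := by
    refine IsCompact.inter_right (IsCompact.inter_right (isCompact_closedBall _ _) ?_) isClosed_closure
    have : {ζ : ℂ | ∀ κ ∈ K0, δ / 2 ≤ ‖ζ - κ‖} = ⋂ κ ∈ K0, {ζ : ℂ | δ / 2 ≤ ‖ζ - κ‖} := by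
      ext ζ; simp
    rw [this]
    refine isClosed_biInter fun κ _ => isClosed_le (by fun_prop) (by fun_prop)
  have hQU : Q ⊆ unbddComp K0 := by
    rintro ζ ⟨⟨-, h1⟩, h2⟩
    rcases closure_unbddComp (F.cptK ht0) h2 with h3 | h3
    · exact h3
    · have := h1 ζ h3
      simp at this
      linarith
  obtain ⟨ρ, hρ0, hρ1, hρ⟩ := (F.rie t0 ht0).compact_pre hQc hQU
  have hs0 : 0 < (1 + ρ) / 2 := by linarith
  have hs1 : (1 + ρ) / 2 < 1 := by linarith
  obtain ⟨τ1, hτ1, hst⟩ := F.stay hs0 hs1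
  obtain ⟨τ2, hτ2, hun⟩ := F.unif (half_pos hδ)
  have hlog : 0 < Real.log ((1 + ρ) / 2 / ρ) := Real.log_pos (by rw [one_lt_div hρ0]; linarith)
  refine ⟨min 1 (Real.log ((1 + ρ) / 2 / ρ)), lt_min one_pos hlog, min τ1 τ2, lt_min hτ1 hτ2, ?_⟩
  intro t ht htt x hx hxb
  by_contra hge
  push Not at hge
  have hfar := hfar t ht x hx hge
  have hw0 : 0 < (⟨x, thet K l G t⟩ : ℂ).re := hx
  set w : ℂ := ⟨x, thet K l G t⟩ with hw
  set ζ := Complex.exp (psi (G t) w) with hζ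
  have hun := hun t ht t0 ht0 (htt.trans_le (min_le_right _ _))
  have hUt : ζ ∈ unbddComp ((fun z => h z t) '' K) := psi_mem (F.rie t ht) hw0
  have hU0 : ζ ∈ unbddComp K0 := by
    refine bor F.cpt (F.ht ht) (F.ht ht0) (F.inj t0 ht0) ?_ hUt
    intro z hz
    have h1 := hun z hz
    have h2 := hfar z hz
    rw [norm_sub_rev] at h2
    linarith
  have hζQ : ζ ∈ Q := by
    refine ⟨⟨?_, ?_⟩, subset_closure hU0⟩
    · rw [mem_closedBall_zero_iff, hζ, Complex.norm_exp, Real.exp_le_exp]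
      have h1 := psi_re_le (F.rie t ht) hw0
      have h2 : w.re = x := rfl
      have := hxb.le.trans (min_le_left _ _)
      linarith
    · rintro _ ⟨z, hz, rfl⟩
      have h1 := hun z hz
      have h2 := hfar z hz
      have h3 : ‖ζ - h z t‖ ≤ ‖ζ - h z t0‖ + ‖h z t - h z t0‖ := by
        calc ‖ζ - h z t‖ = ‖(ζ - h z t0) - (h z t - h z t0)‖ := by congr 1; ring
          _ ≤ _ := norm_sub_le _ _
      simp only
      linarith
  obtain ⟨z, hz1, hz0, hze⟩ := (F.rie t0 ht0).exists_pre hU0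
  have hzρ := hρ z hz1 hz0 (by rw [hze]; exact hζQ)
  have hwb := exp_neg_ball hw0
  have hpb := (F.rie t0 ht0).pre_bound (F.rie t ht) hs0 hs1
    (fun z hz hzs => hst t0 ht0 t ht (by rw [abs_sub_comm]; exact htt.trans_le (min_le_left _ _)) z hz hzs.le)
    (z := z) (w := Complex.exp (-w)) (by linarith) (by simpa using hwb.1)
    (by rw [hze, hζ, psi_exp])
  rw [Complex.norm_exp] at hpb
  have h6 : (-w).re = -x := rfl
  rw [h6] at hpb
  have h7 : Real.exp (-x) ≤ ρ / ((1 + ρ) / 2) := hpb.trans (by gcongr)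
  have h8 : x < Real.log ((1 + ρ) / 2 / ρ) := hxb.trans_le (min_le_right _ _)
  have h9 : Real.exp x < (1 + ρ) / 2 / ρ := (Real.lt_log_iff_exp_lt (by positivity)).1 h8
  have h10 : Real.exp x * Real.exp (-x) = 1 := by rw [← Real.exp_add]; simp
  have h11 : Real.exp x * Real.exp (-x) < (1 + ρ) / 2 / ρ * (ρ / ((1 + ρ) / 2)) :=
    mul_lt_mul h9 h7 (Real.exp_pos _) (by positivity)
  rw [h10] at h11
  have h12 : (1 + ρ) / 2 / ρ * (ρ / ((1 + ρ) / 2)) = 1 := by field_simp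
  linarith

theorem psic (L : Lif K h G y0 l LL) :
    ContinuousOn (fun p : ℝ × ℂ => psi (G p.1) p.2) (Icc (0:ℝ) 1 ×ˢ {w : ℂ | 0 < w.re}) := by
  have h1 := L.fam.jcont.comp (f := fun p : ℝ × ℂ => (p.1, Complex.exp (-p.2)))
    (s := Icc (0:ℝ) 1 ×ˢ {w : ℂ | 0 < w.re}) (by fun_prop)
    (fun p hp => ⟨hp.1, (exp_neg_ball hp.2).1⟩)
  exact continuousOn_snd.add h1

/-- common part of both directions of continuity of `thet`. -/
theorem nearc (L : Lif K h G y0 l LL) {t0 : ℝ} (ht0 : t0 ∈ Icc (0:ℝ) 1) {x : ℂ} (hx : x ∈ K \ {0})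
    {n : ℤ} {y c : ℝ} (hc : 0 < c) (hl : Lands (G t0) y (l x t0 + n * (2 * Real.pi * Complex.I))) :
    ∃ x1 : ℝ, 0 < x1 ∧ ∀ᶠ t in 𝓝[Icc 0 1] t0, ‖psi (G t) ⟨x1, y⟩ - (l x t + n * (2 * Real.pi * Complex.I))‖ < c := by
  have e1 : ∀ᶠ r : ℝ in 𝓝[>] 0, psi (G t0) ⟨r, y⟩ ∈ ball (l x t0 + n * (2 * Real.pi * Complex.I)) c :=
    hl (ball_mem_nhds _ hc)
  have e2 : ∀ᶠ r : ℝ in 𝓝[>] 0, 0 < r := self_mem_nhdsWithin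
  obtain ⟨x1, h1, hx1⟩ := (e1.and e2).exists
  refine ⟨x1, hx1, ?_⟩
  have c1 : ContinuousOn (fun t => psi (G t) ⟨x1, y⟩) (Icc 0 1) :=
    L.psic.comp (f := fun t => (t, (⟨x1, y⟩ : ℂ))) (by fun_prop) (fun t ht => ⟨ht, hx1⟩)
  have c2 : ContinuousOn (fun t => l x t) (Icc 0 1) :=
    L.lc.comp (f := fun t => (x, t)) (by fun_prop) (fun t ht => ⟨hx, ht⟩)
  have c3 : ContinuousOn (fun t => ‖psi (G t) ⟨x1, y⟩ - (l x t + n * (2 * Real.pi * Complex.I))‖) (Icc 0 1) :=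
    (c1.sub (c2.add continuousOn_const)).norm
  refine (c3 t0 ht0).eventually_lt continuousWithinAt_const ?_
  simpa [dist_eq_norm] using h1

theorem thetc (L : Lif K h G y0 l LL) : ContinuousOn (thet K l G) (Icc 0 1) := by
  intro t0 ht0
  have hin : ∀ᶠ t in 𝓝[Icc 0 1] t0, t ∈ Icc (0:ℝ) 1 := self_mem_nhdsWithin
  refine tendsto_order.2 ⟨fun y1 hy1 => ?_, fun y1 hy1 => ?_⟩
  · obtain ⟨y, h1, h2, hy⟩ := ae_Ioo (L.aeY ht0) hy1
    rcases hy with hy | ⟨_, ⟨x, hx, n, hn, rfl⟩, hl⟩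
    · linarith [L.geY ht0 hy]
    obtain ⟨m, hm, hlow⟩ := L.lower hx
    obtain ⟨η, hη, H⟩ := L.sepAB hm
    obtain ⟨x1, hx1, hev⟩ := L.nearc ht0 hx (c := η / 10 ^ 8) (by positivity) hl
    filter_upwards [hin, hev] with t ht hlt
    have hB : l x t + n * (2 * Real.pi * Complex.I) ∈ Bset K l t := ⟨x, hx, n, hn, rfl⟩
    have := L.keB ht (w0 := ⟨x1, y⟩) hx1 hB hη hlt (fun b hb => by
      rw [norm_sub_rev]; exact H t ht b hb _ hB (Or.inr (by
        rw [exp_per, L.le x hx t ht]; exact hlow t ht)))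
    exact h1.trans this
  · obtain ⟨y, h1, h2, hy⟩ := ae_Ioo (L.aeY ht0) hy1
    rcases hy with ⟨_, ⟨x, hx, n, hn, rfl⟩, hl⟩ | hy
    swap
    · linarith [L.leY ht0 hy]
    obtain ⟨m, hm, hlow⟩ := L.lower hx
    obtain ⟨η, hη, H⟩ := L.sepAB hm
    obtain ⟨x1, hx1, hev⟩ := L.nearc ht0 hx (c := η / 10 ^ 8) (by positivity) hl
    filter_upwards [hin, hev] with t ht hlt
    have hA : l x t + n * (2 * Real.pi * Complex.I) ∈ Aset K l t := ⟨x, hx, n, hn, rfl⟩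
    have := L.keA ht (w0 := ⟨x1, y⟩) hx1 hA hη hlt (fun b hb =>
      H t ht _ hA b hb (Or.inl (by
        rw [exp_per, L.le x hx t ht]; exact hlow t ht)))
    exact this.trans h2

end Lif


theorem rie_not_punct {G : ℂ → ℂ} (h : Rie (unbddComp {(0:ℂ)}) G) : False := by
  have hU : ∀ u : ℂ, u ≠ 0 → u ∈ unbddComp {(0:ℂ)} := by
    intro u hu
    refine ⟨hu, ?_⟩
    have hc : IsConnected ({(0:ℂ)}ᶜ : Set ℂ) :=
      isConnected_compl_singleton_of_one_lt_rank (by rw [Complex.rank_real_complex]; norm_num) 0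
    rw [hc.isPreconnected.connectedComponentIn hu]
    intro hb
    obtain ⟨R, hR⟩ := hb.subset_closedBall 0
    have h1 : ((|R| + 1 : ℝ) : ℂ) ∈ ({(0:ℂ)}ᶜ : Set ℂ) := by
      have : |R| + 1 ≠ 0 := by positivity
      exact Complex.ofReal_ne_zero.2 this
    have h2 := hR h1
    rw [mem_closedBall_zero_iff, Complex.norm_real, Real.norm_eq_abs, abs_of_pos (by positivity)] at h2
    linarith [le_abs_self R]
  set f := fun z => z * Complex.exp (- G z) with hf
  have himg : f '' ball 0 1 = univ := by
    apply eq_univ_of_forall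
    intro v
    by_cases hv : v = 0
    · exact ⟨0, by simp, by simp [hf, hv]⟩
    · exact h.F_img (hU _ (inv_ne_zero hv))
  obtain ⟨-, hd, -⟩ := univ_inv isOpen_ball h.F_diff h.F_inj
  rw [← hf, himg] at hd
  have hd' : Differentiable ℂ (Function.invFunOn f (ball 0 1)) := differentiableOn_univ.1 hd
  have hmem : ∀ v, Function.invFunOn f (ball 0 1) v ∈ ball (0:ℂ) 1 := by
    intro v
    exact Function.invFunOn_mem (by
      have : v ∈ f '' ball 0 1 := by rw [himg]; trivial
      exact this)
  have heq : ∀ v, f (Function.invFunOn f (ball 0 1) v) = v := by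
    intro v
    exact Function.invFunOn_eq (by
      have : v ∈ f '' ball 0 1 := by rw [himg]; trivial
      exact this)
  have hb : Bornology.IsBounded (range (Function.invFunOn f (ball 0 1))) :=
    isBounded_ball.subset (by rintro _ ⟨v, rfl⟩; exact hmem v)
  have := hd'.apply_eq_apply_of_bounded hb 0 1
  have h2 := congrArg f this
  rw [heq, heq] at h2
  exact zero_ne_one h2

/-- the moving ray. -/
noncomputable def gam (K : Set ℂ) (l : ℂ → ℝ → ℂ) (G : ℝ → ℂ → ℂ) (t x : ℝ) : ℂ :=
  Complex.exp (psi (G t) ⟨x, thet K l G t⟩)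

namespace Lif
variable {K : Set ℂ} {h : ℂ → ℝ → ℂ} {G : ℝ → ℂ → ℂ} {y0 : ℝ} {l : ℂ → ℝ → ℂ}
    {LL : ℤ → ℂ × ℂ → ℝ → ℂ} {t : ℝ}

theorem gam_mem (L : Lif K h G y0 l LL) (ht : t ∈ Icc (0:ℝ) 1) {x : ℝ} (hx : 0 < x) :
    gam K l G t x ∈ unbddComp ((fun z => h z t) '' K) :=
  psi_mem (L.fam.rie t ht) (w := ⟨x, thet K l G t⟩) hx

theorem gam_inj (L : Lif K h G y0 l LL) (ht : t ∈ Icc (0:ℝ) 1) : InjOn (gam K l G t) (Ioi 0) := by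
  intro x hx x' hx' he
  simp only [gam, psi_exp] at he
  have := (L.fam.rie t ht).inj (exp_neg_ball (w := ⟨x, thet K l G t⟩) hx)
    (exp_neg_ball (w := ⟨x', thet K l G t⟩) hx') he
  have h2 := congrArg norm this
  rw [Complex.norm_exp, Complex.norm_exp, Real.exp_eq_exp] at h2
  simpa using h2

theorem exists_param (L : Lif K h G y0 l LL) : ∃ Xf : ℂ → ℝ, ContinuousOn Xf (unbddComp K) ∧
    ∀ x : ℝ, 0 < x → Xf (gam K l G 0 x) = x := by
  have h01 : (0:ℝ) ∈ Icc (0:ℝ) 1 := by simp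
  have hR := L.fam.rie 0 h01
  rw [L.fam.img0] at hR
  set f := fun z => Complex.exp (G 0 z) / z with hf
  set S : Set ℂ := ball 0 1 \ {0} with hS
  have hSo : IsOpen S := isOpen_ball.sdiff isClosed_singleton
  have hfd : DifferentiableOn ℂ f S :=
    (hR.diff.mono sdiff_subset).cexp.div differentiableOn_id (fun z hz => hz.2)
  obtain ⟨-, hd, -⟩ := univ_inv hSo hfd hR.inj
  have himg : f '' S = unbddComp K := hR.img
  rw [himg] at hd
  refine ⟨fun z => - Real.log ‖Function.invFunOn f S z‖, ?_, ?_⟩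
  · refine ContinuousOn.neg (ContinuousOn.log hd.continuousOn.norm ?_)
    intro u hu
    rw [← himg] at hu
    have : Function.invFunOn f S u ∈ S := Function.invFunOn_mem hu
    exact norm_ne_zero_iff.2 this.2
  · intro x hx
    have hmem := exp_neg_ball (w := ⟨x, thet K l G 0⟩) hx
    have h1 : Function.invFunOn f S (gam K l G 0 x) = Complex.exp (-⟨x, thet K l G 0⟩) := by
      rw [gam, psi_exp]
      exact hR.inj.leftInvOn_invFunOn hmem
    simp only [h1, Complex.norm_exp, Real.log_exp]
    simp

theorem core (L : Lif K h G y0 l LL) : ∃ H : ℂ → ℝ → ℂ,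
    ContinuousOn (fun p : ℂ × ℝ => H p.1 p.2) ((K ∪ gam K l G 0 '' Ioi 0) ×ˢ Icc 0 1) ∧
    (∀ z ∈ K ∪ gam K l G 0 '' Ioi 0, H z 0 = z) ∧
    (∀ z ∈ K, ∀ t ∈ Icc (0:ℝ) 1, H z t = h z t) ∧
    (∀ t ∈ Icc (0:ℝ) 1, InjOn (fun z => H z t) (K ∪ gam K l G 0 '' Ioi 0)) ∧
    (∀ t ∈ Icc (0:ℝ) 1, (fun z => H z t) '' (gam K l G 0 '' Ioi 0) = gam K l G t '' Ioi 0) := by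
  classical
  have h01 : (0:ℝ) ∈ Icc (0:ℝ) 1 := by simp
  have F := L.fam
  obtain ⟨Xf, hXc, hXe⟩ := L.exists_param
  set R : Set ℂ := gam K l G 0 '' Ioi 0 with hR
  have hRU : R ⊆ unbddComp K := by
    rintro _ ⟨x, hx, rfl⟩
    have := L.gam_mem h01 hx
    rwa [F.img0] at this
  have hRK : ∀ z ∈ R, z ∉ K := fun z hz => (hRU hz).1
  have hXp : ∀ z ∈ R, 0 < Xf z := by
    rintro _ ⟨x, hx, rfl⟩
    rw [hXe x hx]; exact hx
  set H : ℂ → ℝ → ℂ := fun z t => if z ∈ K then h z t else gam K l G t (Xf z) with hH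
  have HK : ∀ z ∈ K, ∀ t, H z t = h z t := fun z hz t => by simp [hH, hz]
  have HR : ∀ z ∈ R, ∀ t, H z t = gam K l G t (Xf z) := fun z hz t => by simp [hH, hRK z hz]
  refine ⟨H, ?_, ?_, fun z hz t _ => HK z hz t, ?_, ?_⟩
  · rintro ⟨z0, t0⟩ ⟨hz0, ht0⟩
    simp only at hz0 ht0
    by_cases hzK : z0 ∈ K
    · by_cases hz : z0 = 0
      · subst hz
        rw [Metric.continuousWithinAt_iff]
        intro ε hε
        obtain ⟨δ1, hδ1, hs⟩ := L.small hε
        obtain ⟨xb, hxb, τ, hτ, hu⟩ := L.uland ht0 hε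
        obtain ⟨δ2, hδ2, hd⟩ := F.distb (s := Real.exp (-xb)) (Real.exp_pos _)
          (by rw [← Real.exp_zero]; exact Real.exp_lt_exp.2 (by linarith))
        refine ⟨min τ (min δ1 δ2), by positivity, ?_⟩
        rintro ⟨z, t⟩ ⟨hz, ht⟩ hdist
        simp only at hz ht
        rw [Prod.dist_eq, max_lt_iff, lt_min_iff, lt_min_iff] at hdist
        obtain ⟨⟨-, hz1, hz2⟩, ht2, -⟩ := hdist.1, (lt_min_iff.1 hdist.2)
        simp only [dist_zero_right] at hz1 hz2
        show dist (H z t) (H 0 t0) < ε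
        rw [HK 0 hzK, F.fix t0 ht0, dist_zero_right]
        rcases hz with hz | hz
        · rw [HK z hz]
          exact hs z hz hz1 t ht
        · rw [HR z hz]
          refine hu t ht (by simpa [Real.dist_eq] using ht2) _ (hXp z hz) ?_
          obtain ⟨x, hx, rfl⟩ := hz
          rw [hXe x hx]
          by_contra hle
          push Not at hle
          have h1 := hd 0 h01 0 F.zero (Complex.exp (-⟨x, thet K l G 0⟩)) (Complex.exp_ne_zero _) (by
            rw [Complex.norm_exp, Real.exp_le_exp]
            simpa using hle)
          rw [← psi_exp, F.fix 0 h01, sub_zero] at h1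
          rw [gam] at hz2
          linarith
      · have hzn : 0 < ‖z0‖ := norm_pos_iff.2 hz
        obtain ⟨δ, hδ, hf⟩ := L.kfar (half_pos hzn)
        have hKc : ContinuousWithinAt (fun p : ℂ × ℝ => H p.1 p.2) (K ×ˢ Icc 0 1) (z0, t0) := by
          refine (F.cont (z0, t0) ⟨hzK, ht0⟩).congr ?_ ?_
          · rintro ⟨z, t⟩ ⟨hz, ht⟩
            exact HK z hz t
          · exact HK z0 hzK t0
        refine hKc.mono_of_mem_nhdsWithin ?_
        rw [mem_nhdsWithin]
        refine ⟨ball z0 (min δ (‖z0‖ / 2)) ×ˢ univ, isOpen_ball.prod isOpen_univ,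
          ⟨mem_ball_self (by positivity), trivial⟩, ?_⟩
        rintro ⟨z, t⟩ ⟨⟨hzb, -⟩, hz, ht⟩
        refine ⟨?_, ht⟩
        rcases hz with hz | hz
        · exact hz
        · exfalso
          obtain ⟨x, hx, rfl⟩ := hz
          simp only [mem_ball, lt_min_iff, dist_eq_norm] at hzb
          have h1 : ‖z0‖ / 2 ≤ ‖gam K l G 0 x‖ := by
            have : ‖z0‖ ≤ ‖gam K l G 0 x‖ + ‖gam K l G 0 x - z0‖ := by
              calc ‖z0‖ = ‖gam K l G 0 x - (gam K l G 0 x - z0)‖ := by congr 1; ring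
                _ ≤ _ := norm_sub_le _ _
            linarith [hzb.2]
          have h2 := hf 0 h01 x hx h1 z0 hzK
          rw [F.hid z0 hzK] at h2
          have := hzb.1
          rw [gam] at this
          linarith
    · have hzR : z0 ∈ R := hz0.resolve_left hzK
      have hRc : ContinuousOn (fun p : ℂ × ℝ => gam K l G p.2 (Xf p.1)) (R ×ˢ Icc 0 1) := by
        have c1 : ContinuousOn (fun p : ℂ × ℝ => Xf p.1) (R ×ˢ Icc (0:ℝ) 1) :=
          hXc.comp continuousOn_fst (fun p hp => hRU hp.1)
        have c2 : ContinuousOn (fun p : ℂ × ℝ => thet K l G p.2) (R ×ˢ Icc (0:ℝ) 1) :=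
          L.thetc.comp continuousOn_snd (fun p hp => hp.2)
        have c3 : ContinuousOn (fun p : ℂ × ℝ => (⟨Xf p.1, thet K l G p.2⟩ : ℂ)) (R ×ˢ Icc (0:ℝ) 1) := by
          simp only [Complex.mk_eq_add_mul_I]
          exact (Complex.continuous_ofReal.comp_continuousOn c1).add
            ((Complex.continuous_ofReal.comp_continuousOn c2).mul continuousOn_const)
        exact (L.psic.comp (f := fun p : ℂ × ℝ => (p.2, (⟨Xf p.1, thet K l G p.2⟩ : ℂ)))
          (continuousOn_snd.prodMk c3) (fun p hp => ⟨hp.2, hXp _ hp.1⟩)).cexp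
      have hRc' : ContinuousWithinAt (fun p : ℂ × ℝ => H p.1 p.2) (R ×ˢ Icc 0 1) (z0, t0) := by
        refine (hRc (z0, t0) ⟨hzR, ht0⟩).congr ?_ ?_
        · rintro ⟨z, t⟩ ⟨hz, ht⟩
          exact HR z hz t
        · exact HR z0 hzR t0
      refine hRc'.mono_of_mem_nhdsWithin ?_
      rw [mem_nhdsWithin]
      refine ⟨unbddComp K ×ˢ univ, (isOpen_unbddComp F.cpt).prod isOpen_univ,
        ⟨hRU hzR, trivial⟩, ?_⟩
      rintro ⟨z, t⟩ ⟨⟨hzb, -⟩, hz, ht⟩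
      exact ⟨hz.resolve_left hzb.1, ht⟩
  · rintro z (hz | hz)
    · rw [HK z hz, F.hid z hz]
    · rw [HR z hz]
      obtain ⟨x, hx, rfl⟩ := hz
      rw [hXe x hx]
  · intro t ht z hz z' hz' he
    simp only at he
    have hdis : ∀ z ∈ K, ∀ z' ∈ R, H z t ≠ H z' t := by
      intro z hz z' hz' he
      rw [HK z hz, HR z' hz'] at he
      exact (L.gam_mem ht (hXp z' hz')).1 ⟨z, hz, he⟩
    rcases hz with hz | hz <;> rcases hz' with hz' | hz'
    · rw [HK z hz, HK z' hz'] at he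
      exact F.inj t ht hz hz' he
    · exact absurd he (hdis z hz z' hz')
    · exact absurd he.symm (hdis z' hz' z hz)
    · rw [HR z hz, HR z' hz'] at he
      have h1 := L.gam_inj ht (hXp z hz) (hXp z' hz') he
      obtain ⟨x, hx, rfl⟩ := hz
      obtain ⟨x', hx', rfl⟩ := hz'
      rw [hXe x hx, hXe x' hx'] at h1
      rw [h1]
  · intro t ht
    rw [image_image]
    refine image_congr ?_
    intro x hx
    rw [HR _ ⟨x, hx, rfl⟩, hXe x hx]

end Lif

theorem exp_neg_mk (x y : ℝ) : Complex.exp (-(⟨x, y⟩ : ℂ)) =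
    ((Real.exp (-x) : ℝ) : ℂ) * Complex.exp (((-y : ℝ) : ℂ) * Complex.I) := by
  rw [Complex.ofReal_exp, ← Complex.exp_add]
  congr 1
  rw [Complex.mk_eq_add_mul_I]
  push_cast; ring

theorem ray_image {f : ℂ → ℂ} {G : ℂ → ℂ}
    (hf : ∀ z : ℂ, ‖z‖ < 1 → z ≠ 0 → f z = Complex.exp (G z) / z) (y : ℝ) {r : ℝ}
    (hr : r ∈ Ioo (0:ℝ) 1) :
    f ((r : ℂ) * Complex.exp (((-y : ℝ) : ℂ) * Complex.I)) =
      Complex.exp (psi G ⟨-Real.log r, y⟩) := by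
  have h1 : (0:ℝ) < -Real.log r := by
    have := Real.log_neg hr.1 hr.2
    linarith
  have h2 := exp_neg_ball (w := ⟨-Real.log r, y⟩) h1
  rw [psi_exp, ← hf _ (by simpa using h2.1) h2.2, exp_neg_mk, neg_neg, Real.exp_log hr.1]

theorem extend_aux
    (X : Set ℂ) (hXcpt : IsCompact X)
    (hXns : IsConnected Xᶜ) (h0 : (0:ℂ) ∈ frontier X)
    (h : ℂ → ℝ → ℂ)
    (hcont : ContinuousOn (fun p : ℂ × ℝ => h p.1 p.2) (frontier X ×ˢ Set.Icc 0 1))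
    (hinj : ∀ t ∈ Set.Icc (0:ℝ) 1, Set.InjOn (fun z => h z t) (frontier X))
    (hid : ∀ z ∈ frontier X, h z 0 = z)
    (hfix : ∀ t ∈ Set.Icc (0:ℝ) 1, h 0 t = 0)
    (hXtb : ∀ t ∈ Set.Icc (0:ℝ) 1, XtSet h X t ⊆ Metric.ball 0 1)
    (φ : ℝ → ℂ → ℂ)
    (hφ : ∀ t ∈ Set.Icc (0:ℝ) 1,
      IsNormalizedRiemannMap (unbddComp ((fun z => h z t) '' frontier X)) (φ t)) :
    ∃ G : ℝ → ℂ → ℂ, Fam (frontier X) h G ∧ ∀ t ∈ Icc (0:ℝ) 1, ∀ z : ℂ, ‖z‖ < 1 → z ≠ 0 →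
      φ t z = Complex.exp (G t z) / z := by
  have h01 : (0:ℝ) ∈ Icc (0:ℝ) 1 := by simp
  have hex : ∀ t ∈ Icc (0:ℝ) 1, ∃ G, Rie (unbddComp ((fun z => h z t) '' frontier X)) G ∧
      ∀ z : ℂ, ‖z‖ < 1 → z ≠ 0 → φ t z = Complex.exp (G z) / z := by
    intro t ht
    refine rie_of_norm (hφ t ht) ?_ ?_
    · intro hc
      exact hc.1 ⟨0, h0, hfix t ht⟩
    · intro z hz
      by_contra hc
      have := hXtb t ht hc
      rw [mem_ball_zero_iff] at this
      linarith
  choose! G hG hGe using hex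
  have hK : IsCompact (frontier X) := hXcpt.of_isClosed_subset isClosed_frontier
    hXcpt.isClosed.frontier_subset
  have hbd : ∀ t ∈ Icc (0:ℝ) 1, ∀ z ∈ frontier X, ‖h z t‖ < 1 := by
    intro t ht z hz
    have : h z t ∈ XtSet h X t := fun hc => hc.1 ⟨z, hz, rfl⟩
    simpa using hXtb t ht this
  have him0 : (fun z => h z 0) '' frontier X = frontier X := by
    rw [image_congr (g := id) (fun z hz => hid z hz), image_id]
  have hR0 := hG 0 h01
  rw [him0] at hR0
  have hfr : frontier X ⊆ closure (unbddComp (frontier X)) := by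
    rw [unbdd_frontier hXcpt hXns, frontier_eq_closure_inter_closure]
    exact inter_subset_right
  refine ⟨G, ⟨hK, ?_, h0, ?_, hfr, hcont, hinj, hid, hfix, hbd, hG⟩, hGe⟩
  · refine conn_of_rie hK ?_ hR0 hfr
    intro z hz
    have := hbd 0 h01 z hz
    rw [hid z hz] at this
    exact this.le
  · by_contra hc
    push Not at hc
    have : frontier X = {0} := by
      ext z
      constructor
      · exact hc z
      · rintro rfl; exact h0
    rw [this] at hR0
    exact rie_not_punct hR0


/-- extension of the isotopy over an external ray landing at `0`: if the
external ray `R⁰_θ` lands on `0`, then `h` extends to an isotopy of `Bd(X) ∪ R⁰_θ`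
such that for each `t` the image of `R⁰_θ` is an external ray of `X^t` landing on `0`. -/
theorem extend_over_external_ray
    (X : Set ℂ) (hXne : X.Nonempty) (hXcpt : IsCompact X) (hXconn : IsConnected X)
    (hXns : IsConnected Xᶜ) (h0 : (0:ℂ) ∈ frontier X) (hXb : X ⊆ Metric.ball 0 1)
    (h : ℂ → ℝ → ℂ)
    (hcont : ContinuousOn (fun p : ℂ × ℝ => h p.1 p.2) (frontier X ×ˢ Set.Icc 0 1))
    (hinj : ∀ t ∈ Set.Icc (0:ℝ) 1, Set.InjOn (fun z => h z t) (frontier X))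
    (hid : ∀ z ∈ frontier X, h z 0 = z)
    (hfix : ∀ t ∈ Set.Icc (0:ℝ) 1, h 0 t = 0)
    (hXtb : ∀ t ∈ Set.Icc (0:ℝ) 1, XtSet h X t ⊆ Metric.ball 0 1)
    (φ : ℝ → ℂ → ℂ)
    (hφ : ∀ t ∈ Set.Icc (0:ℝ) 1,
      IsNormalizedRiemannMap (unbddComp ((fun z => h z t) '' frontier X)) (φ t))
    (θ : ℝ)
    (hland : Filter.Tendsto
      (fun r : ℝ => φ 0 ((r : ℂ) * Complex.exp ((θ : ℂ) * Complex.I))) (𝓝[<] 1) (𝓝 0))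
    (R0 : Set ℂ)
    (hR0 : R0 = (fun r : ℝ => φ 0 ((r : ℂ) * Complex.exp ((θ : ℂ) * Complex.I)))
      '' Set.Ioo 0 1) :
    ∃ H : ℂ → ℝ → ℂ,
      ContinuousOn (fun p : ℂ × ℝ => H p.1 p.2) ((frontier X ∪ R0) ×ˢ Set.Icc 0 1) ∧
      (∀ z ∈ frontier X ∪ R0, H z 0 = z) ∧
      (∀ z ∈ frontier X, ∀ t ∈ Set.Icc (0:ℝ) 1, H z t = h z t) ∧
      (∀ t ∈ Set.Icc (0:ℝ) 1, Set.InjOn (fun z => H z t) (frontier X ∪ R0)) ∧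
      (∀ t ∈ Set.Icc (0:ℝ) 1, ∃ θt : ℝ,
        (fun z => H z t) '' R0 =
          (fun r : ℝ => φ t ((r : ℂ) * Complex.exp ((θt : ℂ) * Complex.I)))
            '' Set.Ioo 0 1 ∧
        Filter.Tendsto
          (fun r : ℝ => φ t ((r : ℂ) * Complex.exp ((θt : ℂ) * Complex.I)))
          (𝓝[<] 1) (𝓝 0)) := by
  have h01 : (0:ℝ) ∈ Icc (0:ℝ) 1 := by simp
  obtain ⟨G, F, hGe⟩ := extend_aux X hXcpt hXns h0 h hcont hinj hid hfix hXtb φ hφ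
  have hθ : ((θ : ℝ) : ℂ) = ((-(-θ) : ℝ) : ℂ) := by rw [neg_neg]
  have hexp : Tendsto (fun x : ℝ => Real.exp (-x)) (𝓝[>] 0) (𝓝[<] 1) := by
    refine tendsto_nhdsWithin_iff.2 ⟨?_, ?_⟩
    · have : Tendsto (fun x : ℝ => Real.exp (-x)) (𝓝 0) (𝓝 (Real.exp (-0))) :=
        (by fun_prop : Continuous fun x : ℝ => Real.exp (-x)).tendsto 0
      rw [neg_zero, Real.exp_zero] at this
      exact this.mono_left nhdsWithin_le_nhds
    · filter_upwards [self_mem_nhdsWithin] with x hx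
      have hx : 0 < x := hx
      show Real.exp (-x) < 1
      rw [← Real.exp_zero]
      exact Real.exp_lt_exp.2 (by linarith)
  have hlim : Tendsto (fun x : ℝ => (psi (G 0) ⟨x, -θ⟩).re) (𝓝[>] 0) atBot := by
    have h1 := (hland.comp hexp).norm
    rw [norm_zero] at h1
    have h2 : Tendsto (fun x : ℝ => Real.exp ((psi (G 0) ⟨x, -θ⟩).re)) (𝓝[>] 0) (𝓝[>] 0) := by
      refine tendsto_nhdsWithin_iff.2 ⟨h1.congr' ?_, Eventually.of_forall fun x => Real.exp_pos _⟩
      filter_upwards [self_mem_nhdsWithin] with x hx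
      have hx : 0 < x := hx
      have hr : Real.exp (-x) ∈ Ioo (0:ℝ) 1 := ⟨Real.exp_pos _, by
        rw [← Real.exp_zero]
        exact Real.exp_lt_exp.2 (by linarith)⟩
      simp only [Function.comp_apply]
      rw [hθ, ray_image (hGe 0 h01) (-θ) hr, Real.log_exp, neg_neg, Complex.norm_exp]
    have h3 := Real.tendsto_log_nhdsGT_zero.comp h2
    refine h3.congr fun x => ?_
    simp
  obtain ⟨l, LL, L⟩ := F.ex_lif hlim
  have himg : ∀ t ∈ Icc (0:ℝ) 1, (fun r : ℝ => φ t ((r : ℂ) *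
      Complex.exp (((-(thet (frontier X) l G t) : ℝ) : ℂ) * Complex.I))) '' Ioo 0 1 =
      gam (frontier X) l G t '' Ioi 0 := by
    intro t ht
    ext u
    constructor
    · rintro ⟨r, hr, rfl⟩
      refine ⟨-Real.log r, ?_, ?_⟩
      · have := Real.log_neg hr.1 hr.2
        show 0 < -Real.log r
        linarith
      · exact (ray_image (hGe t ht) _ hr).symm
    · rintro ⟨x, hx, rfl⟩
      have hx : 0 < x := hx
      have hr : Real.exp (-x) ∈ Ioo (0:ℝ) 1 := ⟨Real.exp_pos _, by
        rw [← Real.exp_zero]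
        exact Real.exp_lt_exp.2 (by linarith)⟩
      refine ⟨Real.exp (-x), hr, ?_⟩
      simp only
      rw [ray_image (hGe t ht) _ hr, Real.log_exp, neg_neg, gam]
  have hRg : R0 = gam (frontier X) l G 0 '' Ioi 0 := by
    rw [hR0, ← himg 0 h01, L.thet0, neg_neg]
  obtain ⟨H, H1, H2, H3, H4, H5⟩ := L.core
  rw [← hRg] at H1 H2 H4 H5
  refine ⟨H, H1, H2, H3, H4, fun t ht => ⟨-(thet (frontier X) l G t), ?_, ?_⟩⟩
  · rw [H5 t ht, himg t ht]
  · rw [Metric.tendsto_nhds]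
    intro ε hε
    obtain ⟨xb, hxb, τ, hτ, hu⟩ := L.uland ht hε
    have hxb1 : Real.exp (-xb) < 1 := by
      rw [← Real.exp_zero]
      exact Real.exp_lt_exp.2 (by linarith)
    filter_upwards [Ioo_mem_nhdsLT hxb1] with r hr
    have hr0 : 0 < r := (Real.exp_pos _).trans hr.1
    rw [dist_zero_right, ray_image (hGe t ht) _ ⟨hr0, hr.2⟩]
    refine hu t ht (by simpa using hτ) _ ?_ ?_
    · have := Real.log_neg hr0 hr.2
      linarith
    · have := (Real.lt_log_iff_exp_lt hr0).2 hr.1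
      linarith
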